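/- Assume the Riemann Hypothesis. Fix a real number η, a number ϑ with 0 < ϑ < 1/2, and a polynomial P with P(0) = 0. Then as T → ∞, Σ_{T<γ≤2T} | ζ'(ρ) · M(ρ + 2πiη/log T, P) |² ≪ T (log T)³, where ρ = 1/2 + iγ runs over the nontrivial zeros of ζ with ordinate in (T,2T], counted with multiplicity, and ζ' is the derivative of the Riemann zeta function. -/

import Mathlib

open Filter MeasureTheory
open scoped Real

noncomputable section

/-- The multiplicity (order of vanishing) of the Riemann zeta function at a point `z`:
the least `n` such that the `n`-th derivative of `ζ` at `z` is nonzero. -/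
def zetaMult (z : ℂ) : ℕ := sInf {n : ℕ | iteratedDeriv n riemannZeta z ≠ 0}

/-- Under RH, the set of ordinates `γ` with `0 < γ ≤ T` of nontrivial zeros `1/2 + iγ` of `ζ`. -/
def zetaOrds (T : ℝ) : Set ℝ :=
  {γ : ℝ | 0 < γ ∧ γ ≤ T ∧ riemannZeta (1 / 2 + γ * Complex.I) = 0}

/-- The multiplicity of the zero of `ζ` at `1/2 + iγ`. -/
def ordMult (γ : ℝ) : ℕ := zetaMult (1 / 2 + γ * Complex.I)

/-- `N(T)`: the number of ordinates of nontrivial zeros in `(0, T]`, counted with multiplicity. -/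
def zetaN (T : ℝ) : ℕ := ∑ᶠ γ ∈ zetaOrds T, ordMult γ

/-- The next ordinate of a nontrivial zero strictly above `γ`. -/
def nextOrd (γ : ℝ) : ℝ :=
  sInf {γ' : ℝ | γ < γ' ∧ riemannZeta (1 / 2 + γ' * Complex.I) = 0}

/-- The mollifier `M(s, P) = Σ_{n ≤ y} μ(n) P(log(y/n)/log y) n^{-s}` with `y = T^ϑ`. -/
def moll (T ϑ : ℝ) (P : Polynomial ℝ) (s : ℂ) : ℂ :=
  ∑ n ∈ Finset.Icc 1 ⌊T ^ ϑ⌋₊,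
    (ArithmeticFunction.moebius n : ℂ) *
      (P.eval (Real.log (T ^ ϑ / n) / Real.log (T ^ ϑ)) : ℝ) * (n : ℂ) ^ (-s)

namespace MZ

def muR : ArithmeticFunction ℝ := ⟨fun n => (ArithmeticFunction.moebius n : ℝ) / n, by simp⟩
def invR : ArithmeticFunction ℝ := ⟨fun n => 1 / (n:ℝ), by simp⟩

lemma muR_mul_invR : muR * invR = 1 := by
  ext n
  rw [ArithmeticFunction.mul_apply]
  have h : ∀ x ∈ n.divisorsAntidiagonal, muR x.1 * invR x.2 =
      (1/(n:ℝ)) * (ArithmeticFunction.moebius x.1 : ℝ) := by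
    intro x hx
    rw [Nat.mem_divisorsAntidiagonal] at hx
    simp only [muR, invR, ArithmeticFunction.coe_mk]
    rw [← hx.1]
    push_cast
    have h1 : (x.1:ℝ) ≠ 0 := by
      have := hx.2; rw [← hx.1] at this
      exact_mod_cast (left_ne_zero_of_mul this)
    have h2 : (x.2:ℝ) ≠ 0 := by
      have := hx.2; rw [← hx.1] at this
      exact_mod_cast (right_ne_zero_of_mul this)
    field_simp
  rw [Finset.sum_congr rfl h, ← Finset.mul_sum]
  have := congrArg (fun f : ArithmeticFunction ℝ => f n)
    (ArithmeticFunction.coe_moebius_mul_coe_zeta (R := ℝ))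
  simp only [ArithmeticFunction.mul_apply] at this
  have h3 : ∑ x ∈ n.divisorsAntidiagonal, (ArithmeticFunction.moebius x.1 : ℝ) =
      (1 : ArithmeticFunction ℝ) n := by
    rw [← this]
    apply Finset.sum_congr rfl
    intro x hx
    rw [Nat.mem_divisorsAntidiagonal] at hx
    have : x.2 ≠ 0 := by
      have := hx.2; rw [← hx.1] at this
      exact (right_ne_zero_of_mul this)
    simp [ArithmeticFunction.zeta_apply, this]
  rw [h3, ArithmeticFunction.one_apply]
  split_ifs with h <;> simp [h]

lemma harm_sum (N : ℕ) : ∑ m ∈ Finset.Ioc 0 N, invR m = (harmonic N : ℝ) := by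
  rw [harmonic_eq_sum_Icc]
  push_cast
  apply Finset.sum_congr (by ext; simp; omega)
  intro x _
  simp [invR]

lemma harm_est (x : ℝ) (hx : 1 ≤ x) :
    |(harmonic ⌊x⌋₊ : ℝ) - Real.log x - Real.eulerMascheroniConstant| ≤ 2 / x := by
  set n := ⌊x⌋₊ with hn
  have hn1 : 1 ≤ n := Nat.le_floor (by simpa using hx)
  have hnx : (n:ℝ) ≤ x := Nat.floor_le (by linarith)
  have hxn : x < n + 1 := Nat.lt_floor_add_one x
  have h1 := Real.eulerMascheroniSeq_lt_eulerMascheroniConstant n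
  have h2 := Real.eulerMascheroniConstant_lt_eulerMascheroniSeq' n
  rw [Real.eulerMascheroniSeq] at h1
  rw [Real.eulerMascheroniSeq', if_neg (by omega)] at h2
  have hn0 : (0:ℝ) < n := by exact_mod_cast hn1
  have hn1' : (1:ℝ) ≤ n := by exact_mod_cast hn1
  have l1 : Real.log n ≤ Real.log x := Real.log_le_log hn0 hnx
  have l2 : Real.log x ≤ Real.log (n+1) := Real.log_le_log (by linarith) hxn.le
  have l3 : Real.log (n+1) - Real.log n ≤ 1 / n := by
    rw [← Real.log_div (by positivity) (by positivity)]
    have := Real.log_le_sub_one_of_pos (show (0:ℝ) < (n+1)/n by positivity)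
    have e : ((n:ℝ)+1)/n - 1 = 1/n := by field_simp; ring
    linarith
  have l4 : 1/(n:ℝ) ≤ 2/x := by
    rw [div_le_div_iff₀ hn0 (by linarith)]; linarith
  rw [abs_le]; constructor <;> linarith

lemma sum_mu_harm (N : ℕ) (hN : 1 ≤ N) :
    ∑ n ∈ Finset.Ioc 0 N, muR n * (harmonic (N / n) : ℝ) = 1 := by
  have h := ArithmeticFunction.sum_Ioc_mul_eq_sum_sum muR invR N
  rw [muR_mul_invR] at h
  simp only [harm_sum] at h
  rw [← h]
  rw [Finset.sum_eq_single 1]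
  · simp
  · intro b _ hb; simp [ArithmeticFunction.one_apply, hb]
  · intro h; simp at h; omega

lemma sum_mu_floor (N : ℕ) (hN : 1 ≤ N) :
    ∑ n ∈ Finset.Ioc 0 N, (ArithmeticFunction.moebius n : ℝ) * ((N / n : ℕ) : ℝ) = 1 := by
  have h := ArithmeticFunction.sum_Ioc_mul_zeta_eq_sum
    ((ArithmeticFunction.moebius : ArithmeticFunction ℤ) : ArithmeticFunction ℝ) N
  rw [ArithmeticFunction.coe_moebius_mul_coe_zeta] at h
  simp only [ArithmeticFunction.intCoe_apply] at h
  rw [← h]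
  rw [Finset.sum_eq_single 1]
  · simp
  · intro b _ hb; simp [ArithmeticFunction.one_apply, hb]
  · intro h; simp at h; omega

lemma abs_mu_le (n : ℕ) : |(ArithmeticFunction.moebius n : ℝ)| ≤ 1 := by
  have := ArithmeticFunction.abs_moebius_le_one (n := n)
  exact_mod_cast this

lemma A_bound (N : ℕ) (hN : 1 ≤ N) : |∑ n ∈ Finset.Ioc 0 N, muR n| ≤ 2 := by
  have hN0 : (0:ℝ) < N := by exact_mod_cast hN
  have key : |N * ∑ n ∈ Finset.Ioc 0 N, muR n - 1| ≤ N := by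
    rw [← sum_mu_floor N hN, Finset.mul_sum, ← Finset.sum_sub_distrib]
    refine (Finset.abs_sum_le_sum_abs _ _).trans ?_
    refine (Finset.sum_le_sum (g := fun _ => (1:ℝ)) ?_).trans (by simp)
    intro n hn
    simp only [Finset.mem_Ioc] at hn
    have hn0 : (0:ℝ) < n := by exact_mod_cast hn.1
    have e : (N:ℝ) * muR n - ArithmeticFunction.moebius n * ((N / n : ℕ) : ℝ) =
      ArithmeticFunction.moebius n * ((N:ℝ)/n - ((N / n : ℕ) : ℝ)) := by
      simp only [muR, ArithmeticFunction.coe_mk]; ring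
    rw [e, abs_mul]
    have h1 : ((N / n : ℕ) : ℝ) ≤ (N:ℝ)/n := Nat.cast_div_le
    have h2 : (N:ℝ)/n < ((N / n : ℕ) : ℝ) + 1 := by
      rw [div_lt_iff₀ hn0]
      exact_mod_cast Nat.lt_mul_of_div_lt (Nat.lt_succ_self _) hn.1
    have h3 : |(N:ℝ)/n - ((N / n : ℕ) : ℝ)| ≤ 1 := by rw [abs_le]; constructor <;> linarith
    calc _ ≤ (1:ℝ) * 1 := mul_le_mul (abs_mu_le n) h3 (abs_nonneg _) (by norm_num)
      _ = 1 := by ring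
  rw [abs_le] at key ⊢
  have hN1 : (1:ℝ) ≤ N := by exact_mod_cast hN
  constructor
  · by_contra h; push Not at h; nlinarith
  · by_contra h; push Not at h; nlinarith

/-- `B_n(x)`. -/
def BB (n : ℕ) (x : ℝ) : ℝ :=
  ∑ l ∈ (Finset.Ioc 0 ⌊x⌋₊).filter (fun l => l.Coprime n), muR l * Real.log (x / l)

lemma BB_lt_one (n : ℕ) (x : ℝ) (hx : x < 1) : BB n x = 0 := by
  have : ⌊x⌋₊ = 0 := Nat.floor_eq_zero.2 hx
  simp [BB, this]

lemma BB_one (x : ℝ) : |BB 1 x| ≤ 8 := by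
  rcases lt_or_ge x 1 with hx | hx
  · rw [BB_lt_one 1 x hx]; norm_num
  set N := ⌊x⌋₊ with hN
  have hN1 : 1 ≤ N := Nat.le_floor (by simpa using hx)
  have hNx : (N:ℝ) ≤ x := Nat.floor_le (by linarith)
  have h1 := sum_mu_harm N hN1
  have h2 := A_bound N hN1
  have e : BB 1 x = 1 - Real.eulerMascheroniConstant * ∑ n ∈ Finset.Ioc 0 N, muR n
      - ∑ n ∈ Finset.Ioc 0 N, muR n *
        ((harmonic (N / n) : ℝ) - Real.log (x/n) - Real.eulerMascheroniConstant) := by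
    rw [← h1, BB, Finset.filter_true_of_mem (by simp), Finset.mul_sum, ← Finset.sum_sub_distrib,
      ← Finset.sum_sub_distrib]
    apply Finset.sum_congr rfl; intros; ring
  have h3 : |∑ n ∈ Finset.Ioc 0 N, muR n *
        ((harmonic (N / n) : ℝ) - Real.log (x/n) - Real.eulerMascheroniConstant)| ≤ 2 := by
    refine (Finset.abs_sum_le_sum_abs _ _).trans ?_
    refine (Finset.sum_le_sum (g := fun _ => (2/x:ℝ)) ?_).trans ?_
    · intro n hn
      simp only [Finset.mem_Ioc] at hn
      have hn0 : (0:ℝ) < n := by exact_mod_cast hn.1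
      have hnx : (n:ℝ) ≤ x := le_trans (by exact_mod_cast hn.2) hNx
      have hf : N / n = ⌊x / n⌋₊ := by rw [hN, Nat.floor_div_natCast]
      rw [hf, abs_mul]
      have := harm_est (x/n) (by rw [le_div_iff₀ hn0]; linarith)
      have h4 : |muR n| ≤ 1/n := by
        simp only [muR, ArithmeticFunction.coe_mk, abs_div, Nat.abs_cast]
        gcongr; exact abs_mu_le n
      calc _ ≤ 1/(n:ℝ) * (2/(x/n)) := mul_le_mul h4 this (abs_nonneg _) (by positivity)
        _ = 2/x := by field_simp
    · simp only [Finset.sum_const, Nat.card_Ioc, nsmul_eq_mul, Nat.sub_zero]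
      rw [mul_div_assoc', div_le_iff₀ (by linarith)]; linarith
  have g1 := Real.one_half_lt_eulerMascheroniConstant
  have g2 := Real.eulerMascheroniConstant_lt_two_thirds
  rw [abs_le] at h2 h3
  rw [e, abs_le]; constructor <;> nlinarith

/-- `K(n) = ∏_{p ∣ n} (1-1/p)⁻¹`. -/
def KK (n : ℕ) : ℝ := ∏ p ∈ n.primeFactors, (1 - 1/(p:ℝ))⁻¹

lemma KK_fac_pos {p : ℕ} (hp : p.Prime) : (0:ℝ) < 1 - 1/(p:ℝ) := by
  have : (1:ℝ) < p := by exact_mod_cast hp.one_lt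
  rw [sub_pos, div_lt_one (by linarith)]; exact this

lemma KK_pos (n : ℕ) : 0 < KK n :=
  Finset.prod_pos fun p hp => inv_pos.2 (KK_fac_pos (Nat.prime_of_mem_primeFactors hp))

lemma KK_mul_prime {p n : ℕ} (hp : p.Prime) (hn : n ≠ 0) (h : ¬ p ∣ n) :
    KK (p * n) = (1 - 1/(p:ℝ))⁻¹ * KK n := by
  unfold KK
  rw [Nat.primeFactors_mul hp.ne_zero hn, hp.primeFactors, Finset.prod_union, Finset.prod_singleton]
  rw [Finset.disjoint_singleton_left]; intro h'; exact h (Nat.dvd_of_mem_primeFactors h')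

lemma BB_rec {p n : ℕ} (hp : p.Prime) (hn : n ≠ 0) (h : ¬ p ∣ n) (x : ℝ) :
    BB n x = BB (p*n) x - (1/(p:ℝ)) * BB (p*n) (x/p) := by
  have hp0 : (0:ℝ) < p := by exact_mod_cast hp.pos
  have hcop : ∀ l : ℕ, l.Coprime (p*n) ↔ l.Coprime n ∧ ¬ p ∣ l := by
    intro l
    rw [Nat.coprime_mul_iff_right, Nat.coprime_comm, hp.coprime_iff_not_dvd, and_comm]
  unfold BB
  rw [← Finset.sum_filter_add_sum_filter_not _ (fun l => ¬ p ∣ l), sub_eq_add_neg]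
  congr 1
  · rw [Finset.filter_filter]; simp only [hcop]
  · rw [Finset.filter_filter]
    simp only [not_not]
    rw [Finset.mul_sum, ← Finset.sum_neg_distrib]
    have hf : ⌊x / p⌋₊ = ⌊x⌋₊ / p := by rw [Nat.floor_div_natCast]
    rw [← Finset.sum_filter_add_sum_filter_not (Finset.filter _ _) (fun l => ¬ p * p ∣ l)]
    rw [Finset.sum_eq_zero (s := Finset.filter (fun l => ¬¬ p * p ∣ l) _), add_zero]
    · symm
      apply Finset.sum_bij (fun l _ => p * l)
      · intro l hl
        simp only [Finset.mem_filter, Finset.mem_Ioc, hcop, hf] at hl ⊢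
        refine ⟨⟨⟨Nat.mul_pos hp.pos hl.1.1, ?_⟩, ?_, dvd_mul_right _ _⟩, ?_⟩
        · rw [mul_comm]; exact (Nat.le_div_iff_mul_le hp.pos).1 hl.1.2
        · exact Nat.Coprime.mul_left ((hp.coprime_iff_not_dvd).2 h) hl.2.1
        · intro hd; exact hl.2.2 (Nat.dvd_of_mul_dvd_mul_left hp.pos hd)
      · intro a _ b _ hab; exact Nat.eq_of_mul_eq_mul_left hp.pos hab
      · intro l hl
        simp only [Finset.mem_filter, Finset.mem_Ioc] at hl
        obtain ⟨⟨⟨h0, h1⟩, h2, k, rfl⟩, h4⟩ := hl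
        refine ⟨k, ?_, rfl⟩
        simp only [Finset.mem_filter, Finset.mem_Ioc, hcop, hf]
        refine ⟨⟨Nat.pos_of_mul_pos_left h0, ?_⟩, h2.coprime_dvd_left (dvd_mul_left _ _), ?_⟩
        · rw [Nat.le_div_iff_mul_le hp.pos, mul_comm]; exact h1
        · intro hd; exact h4 (Nat.mul_dvd_mul_left p hd)
      · intro l hl
        simp only [Finset.mem_filter, Finset.mem_Ioc, hcop] at hl
        have hl0 : (0:ℝ) < l := by exact_mod_cast hl.1.1
        have : ArithmeticFunction.moebius (p * l) = - ArithmeticFunction.moebius l := by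
          rw [ArithmeticFunction.isMultiplicative_moebius.map_mul_of_coprime
            ((hp.coprime_iff_not_dvd).2 hl.2.2), ArithmeticFunction.moebius_apply_prime hp]; ring
        simp only [muR, ArithmeticFunction.coe_mk, this]
        push_cast
        rw [div_div]
        field_simp
    · intro l hl
      simp only [Finset.mem_filter, not_not] at hl
      have : ArithmeticFunction.moebius l = 0 := by
        apply ArithmeticFunction.moebius_eq_zero_of_not_squarefree
        intro hs
        have := hs p hl.2
        exact hp.one_lt.ne' (Nat.isUnit_iff.1 this)
      simp [muR, this]

lemma BB_same {p n : ℕ} (h : p ∣ n) (x : ℝ) (hp : p.Prime) : BB (p*n) x = BB n x := by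
  unfold BB
  congr 1
  ext l
  simp only [Finset.mem_filter, and_congr_right_iff, Nat.coprime_mul_iff_right]
  intro _
  exact ⟨fun h => h.2, fun h' => ⟨h'.coprime_dvd_right h, h'⟩⟩

lemma KK_same {p n : ℕ} (hn : n ≠ 0) (h : p ∣ n) (hp : p.Prime) : KK (p*n) = KK n := by
  unfold KK
  rw [Nat.primeFactors_mul hp.ne_zero hn, hp.primeFactors, Finset.union_eq_right.2]
  simp [hp, h, hn]

lemma BB_bound (n : ℕ) (hn : n ≠ 0) : ∀ x : ℝ, |BB n x| ≤ 8 * KK n := by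
  induction n using induction_on_primes with
  | zero => exact absurd rfl hn
  | one => intro x; simpa [KK] using BB_one x
  | prime_mul p n hp ih =>
    have hn' : n ≠ 0 := right_ne_zero_of_mul hn
    have ih := ih hn'
    by_cases h : p ∣ n
    · intro x; rw [BB_same h x hp, KK_same hn' h hp]; exact ih x
    · have hfac := KK_fac_pos hp
      have hp1 : (1:ℝ) < p := by exact_mod_cast hp.one_lt
      have main : ∀ N : ℕ, ∀ x : ℝ, ⌊x⌋₊ = N → |BB (p*n) x| ≤ 8 * KK (p*n) := by
        intro N
        induction N using Nat.strong_induction_on with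
        | _ N IH =>
          intro x hx
          rcases lt_or_ge x 1 with hx1 | hx1
          · rw [BB_lt_one _ _ hx1]; simp; exact (KK_pos _).le
          have hN1 : 1 ≤ N := hx ▸ Nat.le_floor (by simpa using hx1)
          have := IH (N / p) (Nat.div_lt_self hN1 hp.one_lt) (x/p) (by rw [Nat.floor_div_natCast, hx])
          have e : BB (p*n) x = BB n x + (1/(p:ℝ)) * BB (p*n) (x/p) := by
            rw [BB_rec hp hn' h x]; ring
          rw [e]
          refine (abs_add_le _ _).trans ?_
          rw [abs_mul, abs_of_pos (show (0:ℝ) < 1/p by positivity)]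
          have h1 := ih x
          have h2 : KK n = (1 - 1/(p:ℝ)) * KK (p*n) := by
            rw [KK_mul_prime hp hn' h, ← mul_assoc, mul_inv_cancel₀ hfac.ne', one_mul]
          rw [h2] at h1
          have h3 : 1/(p:ℝ) * |BB (p*n) (x/p)| ≤ 1/(p:ℝ) * (8 * KK (p*n)) := by gcongr
          linarith
      intro x; exact main _ x rfl

end MZ

namespace MZ

lemma taylor2 (h h1 h2 : ℝ → ℂ) (V u : ℝ) (hd : ∀ v, HasDerivAt h (h1 v) v)
    (hd1 : ∀ v, HasDerivAt h1 (h2 v) v) (hc : Continuous h2) (hV : h V = 0) (hu0 : 0 ≤ u)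
    (huV : u ≤ V) :
    h u = - h1 V * ((V - u : ℝ) : ℂ) + ∫ v in (0:ℝ)..V, h2 v * ((max (v - u) 0 : ℝ) : ℂ) := by
  have hcont : Continuous fun v : ℝ => h2 v * ((max (v - u) 0 : ℝ) : ℂ) := by fun_prop
  rw [← intervalIntegral.integral_add_adjacent_intervals (b := u)
    (hcont.intervalIntegrable _ _) (hcont.intervalIntegrable _ _)]
  have e1 : ∫ v in (0:ℝ)..u, h2 v * ((max (v - u) 0 : ℝ) : ℂ) = ∫ v in (0:ℝ)..u, (0:ℂ) := by
    apply intervalIntegral.integral_congr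
    intro v hv
    rw [Set.uIcc_of_le hu0] at hv
    simp [max_eq_right (sub_nonpos.2 hv.2)]
  have e2 : ∫ v in u..V, h2 v * ((max (v - u) 0 : ℝ) : ℂ)
      = ∫ v in u..V, h2 v * ((v - u : ℝ) : ℂ) := by
    apply intervalIntegral.integral_congr
    intro v hv
    rw [Set.uIcc_of_le huV] at hv
    simp only [max_eq_left (sub_nonneg.2 hv.1)]
  have e3 : ∫ v in u..V, h2 v * ((v - u : ℝ) : ℂ) =
      (h1 V * ((V - u : ℝ) : ℂ) - h V) - (h1 u * ((u - u : ℝ) : ℂ) - h u) := by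
    apply intervalIntegral.integral_eq_sub_of_hasDerivAt (f := fun v => h1 v * ((v - u : ℝ):ℂ) - h v)
    · intro v _
      have hl : HasDerivAt (fun v : ℝ => ((v - u : ℝ) : ℂ)) 1 v := by
        have := ((hasDerivAt_id v).sub_const u).ofReal_comp
        simpa using this
      have := ((hd1 v).mul hl).sub (hd v)
      refine HasDerivAt.congr_deriv this ?_
      ring
    · apply Continuous.intervalIntegrable; fun_prop
  rw [e1, e2, e3, hV]
  simp

lemma BB_exp (n : ℕ) (Y v : ℝ) (hY : 1 ≤ Y) (hv : v ≤ Real.log Y) :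
    ∑ l ∈ (Finset.Ioc 0 ⌊Y⌋₊).filter (fun l => l.Coprime n), muR l * max (v - Real.log l) 0
      = BB n (Real.exp v) := by
  unfold BB
  symm
  have hev : Real.exp v ≤ Y := by
    rw [← Real.exp_log (by linarith : (0:ℝ) < Y)]; exact Real.exp_le_exp.2 hv
  have hsub : (Finset.Ioc 0 ⌊Real.exp v⌋₊).filter (fun l => l.Coprime n) ⊆
     (Finset.Ioc 0 ⌊Y⌋₊).filter (fun l => l.Coprime n) := by
    apply Finset.filter_subset_filter
    apply Finset.Ioc_subset_Ioc_right
    exact Nat.floor_le_floor hev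
  rw [← Finset.sum_subset hsub]
  · apply Finset.sum_congr rfl
    intro l hl
    simp only [Finset.mem_filter, Finset.mem_Ioc] at hl
    have hl0 : (0:ℝ) < l := by exact_mod_cast hl.1.1
    have hlv : (l:ℝ) ≤ Real.exp v := (Nat.le_floor_iff (Real.exp_pos v).le).1 hl.1.2
    rw [Real.log_div (Real.exp_pos v).ne' hl0.ne', Real.log_exp, max_eq_left]
    rw [sub_nonneg, Real.log_le_iff_le_exp hl0]; exact hlv
  · intro l hl hl'
    simp only [Finset.mem_filter, Finset.mem_Ioc] at hl hl'
    have hl0 : (0:ℝ) < l := by exact_mod_cast hl.1.1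
    rw [max_eq_right, mul_zero]
    rw [sub_nonpos, Real.le_log_iff_exp_le hl0]
    by_contra hc
    push Not at hc
    exact hl' ⟨⟨hl.1.1, Nat.le_floor hc.le⟩, hl.2⟩

lemma sum_mu_h (h h1 h2 : ℝ → ℂ) (Y D2 : ℝ) (n : ℕ) (hn : n ≠ 0) (hY : 1 ≤ Y)
    (hd : ∀ v, HasDerivAt h (h1 v) v)
    (hd1 : ∀ v, HasDerivAt h1 (h2 v) v) (hc : Continuous h2) (hV : h (Real.log Y) = 0)
    (hD2 : ∀ v, 0 ≤ v → v ≤ Real.log Y → ‖h2 v‖ ≤ D2) :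
    ‖∑ l ∈ (Finset.Ioc 0 ⌊Y⌋₊).filter (fun l => l.Coprime n), (muR l : ℂ) * h (Real.log l)‖
      ≤ 8 * KK n * (‖h1 (Real.log Y)‖ + Real.log Y * D2) := by
  set V := Real.log Y with hVdef
  have hV0 : 0 ≤ V := Real.log_nonneg hY
  set S := (Finset.Ioc 0 ⌊Y⌋₊).filter (fun l => l.Coprime n)
  have e1 : ∑ l ∈ S, (muR l : ℂ) * h (Real.log l) =
     - h1 V * (BB n Y : ℂ) + ∫ v in (0:ℝ)..V, h2 v * (BB n (Real.exp v) : ℂ) := by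
    have : ∀ l ∈ S, (muR l : ℂ) * h (Real.log l) = - h1 V * ((muR l * Real.log (Y / l) : ℝ) : ℂ)
       + ∫ v in (0:ℝ)..V, h2 v * ((muR l * max (v - Real.log l) 0 : ℝ) : ℂ) := by
      intro l hl
      simp only [S, Finset.mem_filter, Finset.mem_Ioc] at hl
      have hl1 : (1:ℝ) ≤ l := by exact_mod_cast hl.1.1
      have hlY : (l:ℝ) ≤ Y := (Nat.le_floor_iff (by linarith)).1 hl.1.2
      rw [taylor2 h h1 h2 V (Real.log l) hd hd1 hc hV (Real.log_nonneg hl1)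
        (Real.log_le_log (by linarith) hlY), Real.log_div (by linarith) (by linarith), ← hVdef]
      rw [mul_add, ← intervalIntegral.integral_const_mul]
      congr 1
      · push_cast; ring
      · congr 1; ext v; push_cast; ring
    rw [Finset.sum_congr rfl this, Finset.sum_add_distrib, ← Finset.mul_sum, ← Complex.ofReal_sum,
      ← intervalIntegral.integral_finset_sum]
    · congr 1
      apply intervalIntegral.integral_congr
      intro v hv
      rw [Set.uIcc_of_le hV0] at hv
      simp only
      rw [← Finset.mul_sum, ← Complex.ofReal_sum, BB_exp n Y v hY hv.2]
    · intro l _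
      apply Continuous.intervalIntegrable; fun_prop
  rw [e1]
  refine (norm_add_le _ _).trans ?_
  have b1 : ‖- h1 V * (BB n Y : ℂ)‖ ≤ ‖h1 V‖ * (8 * KK n) := by
    rw [norm_mul, norm_neg, Complex.norm_real]
    gcongr; exact BB_bound n hn Y
  have b2 : ‖∫ v in (0:ℝ)..V, h2 v * (BB n (Real.exp v) : ℂ)‖ ≤ (D2 * (8 * KK n)) * |V - 0| := by
    apply intervalIntegral.norm_integral_le_of_norm_le_const
    intro v hv
    rw [Set.uIoc_of_le hV0] at hv
    rw [norm_mul, Complex.norm_real]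
    have := hD2 v hv.1.le hv.2
    have h8 := BB_bound n hn (Real.exp v)
    exact mul_le_mul this h8 (norm_nonneg _) ((norm_nonneg _).trans this)
  rw [sub_zero, abs_of_nonneg hV0] at b2
  linarith

/-- coefficient -/
def cf (y : ℝ) (P : Polynomial ℝ) (c : ℂ) (d : ℕ) : ℂ :=
  (ArithmeticFunction.moebius d : ℂ) * (P.eval (Real.log (y / d) / Real.log y) : ℝ) * (d : ℂ) ^ (-c)

lemma poly_bdd (P : Polynomial ℝ) : ∃ B : ℝ, 0 ≤ B ∧ ∀ x, 0 ≤ x → x ≤ 1 → |P.eval x| ≤ B := by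
  obtain ⟨B, hB⟩ := (isCompact_Icc (a := (0:ℝ)) (b := 1)).exists_bound_of_continuousOn
    (f := fun x => P.eval x) P.continuous.continuousOn
  refine ⟨max B 0, le_max_right _ _, fun x h0 h1 => (hB x ⟨h0, h1⟩).trans (le_max_left _ _)⟩

lemma norm_exp_le' (c : ℂ) (v κ Λ : ℝ) (hΛ : 0 < Λ) (hc : ‖c‖ ≤ κ / Λ) (hv0 : 0 ≤ v) (hv : v ≤ Λ) :
    ‖Complex.exp (-c * v)‖ ≤ Real.exp κ := by
  rw [Complex.norm_exp, Real.exp_le_exp]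
  calc (-c * v).re ≤ ‖-c * v‖ := Complex.re_le_norm _
    _ = ‖c‖ * v := by rw [norm_mul, norm_neg, Complex.norm_real, Real.norm_of_nonneg hv0]
    _ ≤ κ / Λ * Λ := by gcongr; exact (norm_nonneg _).trans hc
    _ = κ := by field_simp

lemma F_aux (P : Polynomial ℝ) (hP : P.eval 0 = 0) (κ : ℝ) (hκ : 0 ≤ κ) : ∃ C : ℝ, 0 < C ∧
    ∀ (y Y : ℝ) (c : ℂ) (n : ℕ), n ≠ 0 → 1 < y → 1 ≤ Y → Y ≤ y → ‖c‖ ≤ κ / Real.log y →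
    ‖∑ l ∈ (Finset.Ioc 0 ⌊Y⌋₊).filter (fun l => l.Coprime n), (muR l : ℂ) *
      (Complex.exp (-c * Real.log l) * (P.eval ((Real.log Y - Real.log l) / Real.log y) : ℝ))‖ ≤
      C * KK n / Real.log y := by
  obtain ⟨B0, hB0, hb0⟩ := poly_bdd P
  obtain ⟨B1, hB1, hb1⟩ := poly_bdd P.derivative
  obtain ⟨B2, hB2, hb2⟩ := poly_bdd P.derivative.derivative
  set D1 : ℝ := Real.exp κ * (κ * B0 + B1)
  set D2 : ℝ := Real.exp κ * (κ^2 * B0 + 2 * κ * B1 + B2)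
  have hD1 : 0 ≤ D1 := by positivity
  have hD2 : 0 ≤ D2 := by positivity
  refine ⟨8 * (D1 + D2 + 1), by positivity, ?_⟩
  intro y Y c n hn hy hY hYy hc
  set Λ := Real.log y with hΛdef
  have hΛ : 0 < Λ := Real.log_pos hy
  set V := Real.log Y with hVdef
  have hV0 : 0 ≤ V := Real.log_nonneg hY
  have hVΛ : V ≤ Λ := Real.log_le_log (by linarith) hYy
  let Q : Polynomial ℝ → ℝ → ℂ := fun R v => ((R.eval ((V - v)/Λ) : ℝ) : ℂ)
  have hQ : ∀ R v, HasDerivAt (Q R) (-(1/Λ) * Q R.derivative v) v := by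
    intro R v
    have hl : HasDerivAt (fun v : ℝ => (V - v)/Λ) (-1/Λ) v :=
      ((hasDerivAt_id v).const_sub V).div_const Λ
    have := ((R.hasDerivAt ((V - v)/Λ)).comp v hl).ofReal_comp
    refine HasDerivAt.congr_deriv this ?_
    simp only [Q]; push_cast; ring
  have hE : ∀ v : ℝ, HasDerivAt (fun v : ℝ => Complex.exp (-c * v)) (Complex.exp (-c * v) * (-c)) v := by
    intro v
    have : HasDerivAt (fun v : ℝ => -c * (v:ℂ)) (-c * 1) v :=
      (HasDerivAt.const_mul (-c) (hasDerivAt_id v).ofReal_comp)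
    simpa using this.cexp
  have hQc : ∀ R, Continuous (Q R) := by
    intro R; simp only [Q]
    have := R.continuous
    fun_prop
  let h : ℝ → ℂ := fun v => Complex.exp (-c * v) * Q P v
  let h1 : ℝ → ℂ := fun v => Complex.exp (-c * v) * (-c * Q P v + -(1/Λ) * Q P.derivative v)
  let h2 : ℝ → ℂ := fun v => Complex.exp (-c * v) * (c^2 * Q P v + 2 * c * (1/Λ) * Q P.derivative v
    + (1/Λ)^2 * Q P.derivative.derivative v)
  have hd : ∀ v, HasDerivAt h (h1 v) v := by
    intro v
    have := (hE v).mul (hQ P v)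
    refine HasDerivAt.congr_deriv this ?_
    simp only [h1]; ring
  have hd1 : ∀ v, HasDerivAt h1 (h2 v) v := by
    intro v
    have := (hE v).mul (((hQ P v).const_mul (-c)).add ((hQ P.derivative v).const_mul (-(1/(Λ:ℂ)))))
    refine HasDerivAt.congr_deriv this ?_
    simp only [h2, Pi.add_apply]; ring
  have hcont : Continuous h2 := by
    have := hQc P; have := hQc P.derivative; have := hQc P.derivative.derivative
    fun_prop
  have hcn : 0 ≤ ‖c‖ := norm_nonneg c
  have arg0 : ∀ v, v ≤ V → 0 ≤ (V - v)/Λ := fun v hv => div_nonneg (by linarith) hΛ.le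
  have arg1 : ∀ v, 0 ≤ v → (V - v)/Λ ≤ 1 := fun v hv => by rw [div_le_one hΛ]; linarith
  have nΛ : ‖(1/(Λ:ℂ))‖ = 1/Λ := by
    rw [norm_div, norm_one, Complex.norm_real, Real.norm_of_nonneg hΛ.le]
  have main := sum_mu_h h h1 h2 Y (D2/Λ^2) n hn hY hd hd1 hcont
    (by simp [h, Q, ← hVdef, hP]) (by
      intro v hv0 hvV
      rw [← hVdef] at hvV
      have x0 : ‖Q P v‖ ≤ B0 := by
        simp only [Q, Complex.norm_real]; exact hb0 _ (arg0 v hvV) (arg1 v hv0)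
      have x1 : ‖Q P.derivative v‖ ≤ B1 := by
        simp only [Q, Complex.norm_real]; exact hb1 _ (arg0 v hvV) (arg1 v hv0)
      have x2 : ‖Q P.derivative.derivative v‖ ≤ B2 := by
        simp only [Q, Complex.norm_real]; exact hb2 _ (arg0 v hvV) (arg1 v hv0)
      simp only [h2]
      rw [norm_mul]
      have e1 := norm_exp_le' c v κ Λ hΛ hc hv0 (hvV.trans hVΛ)
      have e2 : ‖(c^2 * Q P v + 2 * c * (1/Λ) * Q P.derivative v
        + (1/Λ)^2 * Q P.derivative.derivative v)‖ ≤ (κ/Λ)^2 * B0 + 2 * (κ/Λ) * (1/Λ) * B1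
         + (1/Λ)^2 * B2 := by
        refine (norm_add₃_le).trans ?_
        simp only [norm_mul, norm_pow, nΛ, Complex.norm_ofNat]
        gcongr
      calc _ ≤ Real.exp κ * _ := mul_le_mul e1 e2 (norm_nonneg _) (Real.exp_pos _).le
        _ = D2/Λ^2 := by simp only [D2]; field_simp)
  have b1 : ‖h1 V‖ ≤ D1/Λ := by
    have x0 : ‖Q P V‖ ≤ B0 := by
      simp only [Q, Complex.norm_real]; exact hb0 _ (arg0 V le_rfl) (arg1 V hV0)
    have x1 : ‖Q P.derivative V‖ ≤ B1 := by
      simp only [Q, Complex.norm_real]; exact hb1 _ (arg0 V le_rfl) (arg1 V hV0)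
    simp only [h1]
    rw [norm_mul]
    have e1 := norm_exp_le' c V κ Λ hΛ hc hV0 hVΛ
    have e2 : ‖(-c * Q P V + -(1/Λ) * Q P.derivative V)‖ ≤ (κ/Λ) * B0 + (1/Λ) * B1 := by
      refine (norm_add_le _ _).trans ?_
      simp only [norm_mul, norm_neg, nΛ]
      gcongr
    calc _ ≤ Real.exp κ * _ := mul_le_mul e1 e2 (norm_nonneg _) (Real.exp_pos _).le
      _ = D1/Λ := by simp only [D1]; field_simp
  refine main.trans ?_
  have hK := KK_pos n
  have : V * (D2/Λ^2) ≤ D2/Λ := by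
    calc V * (D2/Λ^2) ≤ Λ * (D2/Λ^2) := by gcongr
      _ = D2/Λ := by field_simp
  rw [← hVdef]
  calc 8 * KK n * (‖h1 V‖ + V * (D2/Λ^2)) ≤ 8 * KK n * (D1/Λ + D2/Λ) := by gcongr
    _ ≤ 8 * KK n * (D1/Λ + D2/Λ + 1/Λ) := by
      apply mul_le_mul_of_nonneg_left _ (by positivity)
      linarith [show 0 < 1/Λ by positivity]
    _ = 8 * (D1 + D2 + 1) * KK n / Λ := by field_simp

end MZ

namespace MZ

lemma cpow_eq_exp (l : ℕ) (hl : l ≠ 0) (c : ℂ) : (l:ℂ) ^ (-c) = Complex.exp (-c * Real.log l) := by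
  rw [Complex.cpow_def_of_ne_zero (by exact_mod_cast hl), ← Complex.natCast_log, mul_comm]

lemma S_bound (P : Polynomial ℝ) (hP : P.eval 0 = 0) (κ : ℝ) (hκ : 0 ≤ κ) : ∃ C : ℝ, 0 < C ∧
    ∀ (y : ℝ) (c : ℂ) (q m : ℕ), q ≠ 0 → m ≠ 0 → 1 < y → ‖c‖ ≤ κ / Real.log y →
    ‖∑ l ∈ (Finset.Ioc 0 ⌊y / q⌋₊).filter (fun l => l.Coprime m),
      cf y P c (q * l) / ((q * l : ℕ) : ℂ)‖ ≤ C * KK (m * q) / (q * Real.log y) := by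
  obtain ⟨C, hC, hF⟩ := F_aux P hP κ hκ
  refine ⟨Real.exp κ * C, by positivity, ?_⟩
  intro y c q m hq hm hy hc
  have hq0 : (0:ℝ) < q := by exact_mod_cast Nat.pos_of_ne_zero hq
  have hq1 : (1:ℝ) ≤ q := by exact_mod_cast Nat.pos_of_ne_zero hq
  have hΛ : 0 < Real.log y := Real.log_pos hy
  have hK := KK_pos (m*q)
  rcases lt_or_ge (y/q) 1 with h1 | h1
  · rw [Nat.floor_eq_zero.2 h1]; simp; positivity
  have hqy : (q:ℝ) ≤ y := by rwa [le_div_iff₀ hq0, one_mul] at h1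
  have hYy : y/q ≤ y := div_le_self (by linarith) hq1
  have main := hF y (y/q) c (m*q) (mul_ne_zero hm hq) hy h1 hYy hc
  have e : ∑ l ∈ (Finset.Ioc 0 ⌊y / q⌋₊).filter (fun l => l.Coprime m),
      cf y P c (q * l) / ((q * l : ℕ) : ℂ) = ((ArithmeticFunction.moebius q : ℂ) * (q:ℂ)^(-c) / q) *
      ∑ l ∈ (Finset.Ioc 0 ⌊y / q⌋₊).filter (fun l => l.Coprime (m*q)), (muR l : ℂ) *
      (Complex.exp (-c * Real.log l) *
        (P.eval ((Real.log (y/q) - Real.log l) / Real.log y) : ℝ)) := by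
    rw [Finset.mul_sum]
    symm
    have hsub : (Finset.Ioc 0 ⌊y / q⌋₊).filter (fun l => l.Coprime (m*q)) ⊆
      (Finset.Ioc 0 ⌊y / q⌋₊).filter (fun l => l.Coprime m) := by
      intro l; simp only [Finset.mem_filter, Nat.coprime_mul_iff_right]; tauto
    rw [← Finset.sum_subset hsub]
    · apply Finset.sum_congr rfl
      intro l hl
      simp only [Finset.mem_filter, Finset.mem_Ioc, Nat.coprime_mul_iff_right] at hl
      have hl0 : l ≠ 0 := by omega
      have hl0' : (0:ℝ) < l := by exact_mod_cast hl.1.1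
      have hmu : ArithmeticFunction.moebius (q * l) =
        ArithmeticFunction.moebius q * ArithmeticFunction.moebius l :=
        ArithmeticFunction.isMultiplicative_moebius.map_mul_of_coprime hl.2.2.symm
      unfold cf
      rw [hmu]
      have hlog : Real.log (y / ((q*l : ℕ):ℝ)) = Real.log (y/q) - Real.log l := by
        push_cast
        rw [← div_div, Real.log_div (by positivity) (by positivity)]
      rw [hlog, ← cpow_eq_exp l hl0]
      have hmc : (((q * l : ℕ) : ℂ)) ^ (-c) = (q:ℂ)^(-c) * (l:ℂ)^(-c) := by
        rw [Nat.cast_mul, Complex.natCast_mul_natCast_cpow]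
      rw [hmc]
      simp only [muR, ArithmeticFunction.coe_mk]
      push_cast
      have : (q:ℂ) ≠ 0 := by exact_mod_cast hq
      have : (l:ℂ) ≠ 0 := by exact_mod_cast hl0
      field_simp
    · intro l hl hl'
      simp only [Finset.mem_filter, Finset.mem_Ioc, Nat.coprime_mul_iff_right] at hl hl'
      have hnc : ¬ q.Coprime l := fun h => hl' ⟨hl.1, hl.2, h.symm⟩
      have : ArithmeticFunction.moebius (q * l) = 0 := by
        apply ArithmeticFunction.moebius_eq_zero_of_not_squarefree
        intro hs
        exact hnc (Nat.coprime_of_squarefree_mul hs)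
      simp [cf, this]
  rw [e, norm_mul]
  have n1 : ‖(ArithmeticFunction.moebius q : ℂ) * (q:ℂ)^(-c) / q‖ ≤ Real.exp κ / q := by
    rw [norm_div, norm_mul, Complex.norm_natCast]
    gcongr
    have a1 : ‖(ArithmeticFunction.moebius q : ℂ)‖ ≤ 1 := by
      have := abs_mu_le q
      rw [← Complex.ofReal_intCast, Complex.norm_real]; exact this
    have a2 : ‖(q:ℂ)^(-c)‖ ≤ Real.exp κ := by
      rw [cpow_eq_exp q hq]
      exact norm_exp_le' c _ κ _ hΛ hc (Real.log_nonneg hq1) (Real.log_le_log hq0 hqy)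
    calc _ ≤ 1 * Real.exp κ := mul_le_mul a1 a2 (norm_nonneg _) (by norm_num)
      _ = _ := one_mul _
  calc _ ≤ Real.exp κ / q * (C * KK (m*q) / Real.log y) :=
        mul_le_mul n1 main (norm_nonneg _) (by positivity)
    _ = _ := by field_simp

lemma KK_two (q : ℕ) (hq : q ≠ 0) : KK (2 * q) ≤ 2 * KK q := by
  have := KK_pos q
  by_cases h : 2 ∣ q
  · rw [KK_same hq h Nat.prime_two]; linarith
  · rw [KK_mul_prime Nat.prime_two hq h]; norm_num

def gK (p : ℕ) : ℝ := ((1 - 1/(p:ℝ))⁻¹)^2 - 1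

lemma gK_bd {p : ℕ} (hp : p.Prime) : 0 ≤ gK p ∧ gK p ≤ 6 / p := by
  have h2 : (2:ℝ) ≤ p := by exact_mod_cast hp.two_le
  have e : gK p = (2*p-1)/(p-1)^2 := by
    unfold gK
    have : (p:ℝ) - 1 ≠ 0 := by linarith
    have : (p:ℝ) ≠ 0 := by linarith
    rw [show (1:ℝ) - 1/p = (p-1)/p by field_simp]
    field_simp; ring
  rw [e]
  constructor
  · apply div_nonneg <;> nlinarith
  · rw [div_le_div_iff₀ (by nlinarith) (by linarith)]; nlinarith

lemma sum_inv_multiples (N D : ℕ) (hD : 0 < D) :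
    ∑ q ∈ (Finset.Ioc 0 N).filter (fun q => D ∣ q), (1:ℝ)/q ≤ (1/(D:ℝ)) * (harmonic N : ℝ) := by
  rw [← harm_sum, Finset.mul_sum]
  have hD0 : (0:ℝ) < D := by exact_mod_cast hD
  have : ∑ q ∈ (Finset.Ioc 0 N).filter (fun q => D ∣ q), (1:ℝ)/q
    = ∑ k ∈ Finset.Ioc 0 (N/D), 1/(D:ℝ) * invR k := by
    symm
    apply Finset.sum_bij (fun k _ => D * k)
    · intro k hk
      simp only [Finset.mem_filter, Finset.mem_Ioc] at hk ⊢
      refine ⟨⟨Nat.mul_pos hD hk.1, ?_⟩, dvd_mul_right _ _⟩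
      rw [mul_comm]; exact (Nat.le_div_iff_mul_le hD).1 hk.2
    · intro a _ b _ h; exact Nat.eq_of_mul_eq_mul_left hD h
    · intro q hq
      simp only [Finset.mem_filter, Finset.mem_Ioc] at hq
      obtain ⟨⟨h0, h1⟩, k, rfl⟩ := hq
      refine ⟨k, ?_, rfl⟩
      simp only [Finset.mem_Ioc]
      exact ⟨Nat.pos_of_mul_pos_left h0, by rw [Nat.le_div_iff_mul_le hD, mul_comm]; exact h1⟩
    · intro k _
      simp only [invR, ArithmeticFunction.coe_mk]; push_cast
      rw [div_mul_div_comm, one_mul]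
  rw [this]
  apply Finset.sum_le_sum_of_subset_of_nonneg
  · exact Finset.Ioc_subset_Ioc_right (Nat.div_le_self _ _)
  · intro k _ _
    simp only [invR, ArithmeticFunction.coe_mk]; positivity

lemma harm_le (N : ℕ) : (harmonic N : ℝ) ≤ 1 + Real.log N := harmonic_le_one_add_log N

lemma sum_inv_sq (N : ℕ) : ∑ n ∈ Finset.Ioc 0 N, (1:ℝ)/(n:ℝ)^2 ≤ 2 := by
  rcases Nat.eq_zero_or_pos N with h | h
  · simp [h]
  have : ∀ N : ℕ, 1 ≤ N → ∑ n ∈ Finset.Ioc 0 N, (1:ℝ)/(n:ℝ)^2 ≤ 2 - 1/N := by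
    intro N hN
    induction N, hN using Nat.le_induction with
    | base => simp; norm_num
    | succ n hn ih =>
      rw [Finset.sum_Ioc_succ_top (by omega)]
      have hn0 : (0:ℝ) < n := by exact_mod_cast hn
      have : (1:ℝ)/((n+1:ℕ):ℝ)^2 ≤ 1/n - 1/((n+1:ℕ):ℝ) := by
        push_cast
        rw [div_sub_div _ _ (by positivity) (by positivity), div_le_div_iff₀ (by positivity) (by positivity)]
        nlinarith
      linarith
  have h2 := this N h
  have : (0:ℝ) ≤ 1/N := by positivity
  linarith

lemma sum_KK (N : ℕ) : ∑ q ∈ Finset.Ioc 0 N, (KK q)^2 / q ≤ Real.exp 12 * (1 + Real.log N) := by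
  set Pr := (Finset.Ioc 0 N).filter Nat.Prime
  have hpf : ∀ q ∈ Finset.Ioc 0 N, q.primeFactors = Pr.filter (fun p => p ∣ q) := by
    intro q hq
    simp only [Finset.mem_Ioc] at hq
    ext p
    simp only [Nat.mem_primeFactors, Pr, Finset.mem_filter, Finset.mem_Ioc]
    constructor
    · rintro ⟨hp, hd, _⟩
      exact ⟨⟨⟨hp.pos, (Nat.le_of_dvd hq.1 hd).trans hq.2⟩, hp⟩, hd⟩
    · rintro ⟨⟨_, hp⟩, hd⟩; exact ⟨hp, hd, by omega⟩
  have hg0 : ∀ S ∈ Pr.powerset, 0 ≤ ∏ p ∈ S, gK p := by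
    intro S hS
    apply Finset.prod_nonneg
    intro p hp
    exact (gK_bd (Finset.mem_filter.1 (Finset.mem_powerset.1 hS hp)).2).1
  have h1 : ∀ q ∈ Finset.Ioc 0 N, (KK q)^2 / q ≤
     ∑ S ∈ Pr.powerset, (∏ p ∈ S, gK p) * (if (∏ p ∈ S, p) ∣ q then (1:ℝ)/q else 0) := by
    intro q hq
    have : (KK q)^2 = ∏ p ∈ q.primeFactors, (1 + gK p) := by
      unfold KK; rw [← Finset.prod_pow]; apply Finset.prod_congr rfl
      intro p _; unfold gK; ring
    rw [this, Finset.prod_one_add, div_eq_mul_one_div, Finset.sum_mul]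
    have hsub : q.primeFactors.powerset ⊆ Pr.powerset := by
      rw [hpf q hq]; exact Finset.powerset_mono.2 (Finset.filter_subset _ _)
    refine (Finset.sum_le_sum ?_).trans (Finset.sum_le_sum_of_subset_of_nonneg hsub ?_)
    · intro S hS
      have : (∏ p ∈ S, p) ∣ q := by
        apply Finset.prod_primes_dvd
        · intro p hp
          exact (Nat.prime_of_mem_primeFactors (Finset.mem_powerset.1 hS hp)).prime
        · intro p hp
          exact Nat.dvd_of_mem_primeFactors (Finset.mem_powerset.1 hS hp)
      rw [if_pos this]
    · intro S hS _
      apply mul_nonneg (hg0 S hS)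
      split_ifs <;> positivity
  refine (Finset.sum_le_sum h1).trans ?_
  rw [Finset.sum_comm]
  have h2 : ∀ S ∈ Pr.powerset, ∑ q ∈ Finset.Ioc 0 N, (∏ p ∈ S, gK p) *
      (if (∏ p ∈ S, p) ∣ q then (1:ℝ)/q else 0) ≤ (∏ p ∈ S, gK p / p) * (harmonic N : ℝ) := by
    intro S hS
    rw [← Finset.mul_sum, ← Finset.sum_filter]
    have hpos : 0 < ∏ p ∈ S, p := by
      apply Finset.prod_pos; intro p hp
      exact ((Finset.mem_filter.1 (Finset.mem_powerset.1 hS hp)).2).pos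
    refine (mul_le_mul_of_nonneg_left (sum_inv_multiples N _ hpos) (hg0 S hS)).trans (le_of_eq ?_)
    rw [Finset.prod_div_distrib]; push_cast; ring
  refine (Finset.sum_le_sum h2).trans ?_
  rw [← Finset.sum_mul, ← Finset.prod_one_add]
  have hH : (0:ℝ) ≤ (harmonic N : ℝ) := by
    rw [← harm_sum]; apply Finset.sum_nonneg; intro k _
    simp only [invR, ArithmeticFunction.coe_mk]; positivity
  refine mul_le_mul ?_ (harm_le N) hH (Real.exp_pos _).le
  calc ∏ p ∈ Pr, (1 + gK p / p) ≤ ∏ p ∈ Pr, Real.exp (6 / (p:ℝ)^2) := by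
        apply Finset.prod_le_prod
        · intro p hp
          have := (gK_bd (Finset.mem_filter.1 hp).2).1
          positivity
        · intro p hp
          have hb := (gK_bd (Finset.mem_filter.1 hp).2).2
          have : gK p / p ≤ 6/(p:ℝ)^2 := by
            calc gK p / p ≤ (6/p)/p := by gcongr
              _ = _ := by rw [div_div, sq]
          have := Real.add_one_le_exp (6/(p:ℝ)^2)
          linarith
    _ = Real.exp (∑ p ∈ Pr, 6/(p:ℝ)^2) := by rw [Real.exp_sum]
    _ ≤ Real.exp 12 := by
        rw [Real.exp_le_exp]
        calc ∑ p ∈ Pr, 6/(p:ℝ)^2 ≤ ∑ p ∈ Finset.Ioc 0 N, 6/(p:ℝ)^2 := by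
              apply Finset.sum_le_sum_of_subset_of_nonneg (Finset.filter_subset _ _)
              intros; positivity
          _ = 6 * ∑ p ∈ Finset.Ioc 0 N, 1/(p:ℝ)^2 := by
              rw [Finset.mul_sum]; apply Finset.sum_congr rfl; intros; ring
          _ ≤ 12 := by linarith [sum_inv_sq N]

end MZ

namespace MZ

lemma sum_multiples {M : Type*} [AddCommMonoid M] (N D : ℕ) (hD : 0 < D) (F : ℕ → M) :
    ∑ q ∈ (Finset.Ioc 0 N).filter (fun q => D ∣ q), F q = ∑ k ∈ Finset.Ioc 0 (N/D), F (D * k) := by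
  symm
  apply Finset.sum_bij (fun k _ => D * k)
  · intro k hk
    simp only [Finset.mem_filter, Finset.mem_Ioc] at hk ⊢
    refine ⟨⟨Nat.mul_pos hD hk.1, ?_⟩, dvd_mul_right _ _⟩
    rw [mul_comm]; exact (Nat.le_div_iff_mul_le hD).1 hk.2
  · intro a _ b _ h; exact Nat.eq_of_mul_eq_mul_left hD h
  · intro q hq
    simp only [Finset.mem_filter, Finset.mem_Ioc] at hq
    obtain ⟨⟨h0, h1⟩, k, rfl⟩ := hq
    refine ⟨k, ?_, rfl⟩
    simp only [Finset.mem_Ioc]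
    exact ⟨Nat.pos_of_mul_pos_left h0, by rw [Nat.le_div_iff_mul_le hD, mul_comm]; exact h1⟩
  · intro k _; rfl

lemma zeta_partial (τ : ℝ) (hτ : 0 < τ) (N : ℕ) :
    ∑ n ∈ Finset.Ioc 0 N, (n:ℝ)^(-(1+τ)) ≤ 1 + 1/τ := by
  rcases Nat.eq_zero_or_pos N with h | h
  · simp [h]; positivity
  have : ∀ N : ℕ, 1 ≤ N → ∑ n ∈ Finset.Ioc 0 N, (n:ℝ)^(-(1+τ)) ≤ 1 + 1/τ - (N:ℝ)^(-τ)/τ := by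
    intro N hN
    induction N, hN using Nat.le_induction with
    | base => simp
    | succ n hn ih =>
      rw [Finset.sum_Ioc_succ_top (by omega)]
      have hn0 : (0:ℝ) < n := by exact_mod_cast hn
      set x : ℝ := ((n+1:ℕ):ℝ) with hx
      have hx0 : 0 < x := by rw [hx]; positivity
      have hxn : (n:ℝ) = x * (1 - 1/x) := by rw [mul_sub, mul_one_div_cancel hx0.ne', hx]; push_cast; ring
      have hpos : 0 < 1 - 1/x := by
        by_contra hc; push Not at hc
        have := mul_nonpos_of_nonneg_of_nonpos hx0.le hc
        rw [← hxn] at this; linarith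
      have key : 1 + τ/x ≤ (1-1/x)^(-τ) := by
        rw [Real.rpow_def_of_pos hpos]
        have h1 := Real.log_le_sub_one_of_pos hpos
        have h2 := Real.add_one_le_exp (Real.log (1-1/x) * -τ)
        have h3 : τ * (1/x) ≤ Real.log (1-1/x) * -τ := by nlinarith
        rw [mul_one_div] at h3
        linarith
      have e : (n:ℝ)^(-τ) = x^(-τ) * (1-1/x)^(-τ) := by
        rw [hxn, Real.mul_rpow hx0.le hpos.le]
      have e2 : x^(-(1+τ)) = x^(-τ) / x := by
        rw [neg_add, add_comm, Real.rpow_add hx0, Real.rpow_neg_one]; rfl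
      have hxp : 0 < x^(-τ) := Real.rpow_pos_of_pos hx0 _
      have : x^(-τ)*(1+τ/x) ≤ (n:ℝ)^(-τ) := by rw [e]; gcongr
      have h4 : x^(-τ)/τ + x^(-τ)/x ≤ (n:ℝ)^(-τ)/τ := by
        have : (x^(-τ)*(1+τ/x))/τ ≤ (n:ℝ)^(-τ)/τ := by gcongr
        calc _ = (x^(-τ)*(1+τ/x))/τ := by field_simp
          _ ≤ _ := this
      rw [e2]
      linarith
  have h2 := this N h
  have : (0:ℝ) ≤ (N:ℝ)^(-τ)/τ := by positivity
  linarith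

lemma zeta_le (τ : ℝ) (hτ : 0 < τ) : ∑' n : ℕ, (n:ℝ)^(-(1+τ)) ≤ 1 + 1/τ := by
  apply Real.tsum_le_of_sum_range_le
  · intro n; positivity
  · intro n
    refine le_trans ?_ (zeta_partial τ hτ n)
    rcases Nat.eq_zero_or_pos n with h | h
    · simp [h]
    rw [Finset.range_eq_Ico, Finset.sum_eq_sum_Ico_succ_bot h]
    have : ((0:ℕ):ℝ)^(-(1+τ)) = 0 := by
      rw [Nat.cast_zero, Real.zero_rpow (by linarith)]
    rw [this, zero_add]
    apply Finset.sum_le_sum_of_subset_of_nonneg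
    · intro k; simp only [Finset.mem_Ico, Finset.mem_Ioc]; omega
    · intros; positivity

lemma hasSum_mult (τ : ℝ) (hτ : 0 < τ) (D : ℕ) (hD : 0 < D) :
    HasSum (fun m : ℕ => if D ∣ m then (m:ℝ)^(-(1+τ)) else 0)
      ((D:ℝ)^(-(1+τ)) * ∑' n : ℕ, (n:ℝ)^(-(1+τ))) := by
  have hs : Summable fun n : ℕ => (n:ℝ)^(-(1+τ)) := Real.summable_nat_rpow.2 (by linarith)
  have hinj : Function.Injective (fun k : ℕ => D * k) := fun a b h => Nat.eq_of_mul_eq_mul_left hD h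
  rw [← hinj.hasSum_iff]
  · have := hs.hasSum.mul_left ((D:ℝ)^(-(1+τ)))
    have e : ((fun m : ℕ => if D ∣ m then (m:ℝ)^(-(1+τ)) else 0) ∘ fun k => D * k)
      = fun k : ℕ => (D:ℝ)^(-(1+τ)) * (k:ℝ)^(-(1+τ)) := by
      refine funext fun k => ?_
      show (if D ∣ D * k then ((D * k : ℕ) : ℝ)^(-(1+τ)) else 0) = _
      rw [if_pos (dvd_mul_right D k)]
      push_cast
      rw [Real.mul_rpow (by positivity) (by positivity)]
    rw [e]; exact this
  · intro m hm
    rw [if_neg]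
    rintro ⟨k, rfl⟩
    exact hm ⟨k, rfl⟩

def JJ (s : ℝ) : ArithmeticFunction ℝ :=
  ArithmeticFunction.prodPrimeFactors (fun p => (p:ℝ)^s - 1)

lemma JJ_sum (s : ℝ) (g : ℕ) (hg : Squarefree g) : ∑ q ∈ g.divisors, JJ s q = (g:ℝ)^s := by
  have hm : (JJ s).IsMultiplicative := ArithmeticFunction.IsMultiplicative.prodPrimeFactors _
  rw [← hm.prodPrimeFactors_one_add_of_squarefree hg]
  have : ∀ p ∈ g.primeFactors, 1 + JJ s p = (p:ℝ)^s := by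
    intro p hp
    have hp := Nat.prime_of_mem_primeFactors hp
    rw [JJ, ArithmeticFunction.prodPrimeFactors_apply hp.ne_zero, hp.primeFactors,
      Finset.prod_singleton]; ring
  rw [Finset.prod_congr rfl this, Real.finsetProd_rpow _ _ (by intros; positivity)]
  congr 1
  rw [← Nat.cast_prod, Nat.prod_primeFactors_of_squarefree hg]

lemma JJ_bd (s : ℝ) (hs : 0 ≤ s) (q : ℕ) (hq : q ≠ 0) : 0 ≤ JJ s q ∧ JJ s q ≤ (q:ℝ)^s := by
  rw [JJ, ArithmeticFunction.prodPrimeFactors_apply hq]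
  have h1 : ∀ p ∈ q.primeFactors, (1:ℝ) ≤ (p:ℝ)^s := by
    intro p hp
    apply Real.one_le_rpow _ hs
    exact_mod_cast (Nat.prime_of_mem_primeFactors hp).one_le
  constructor
  · apply Finset.prod_nonneg
    intro p hp; linarith [h1 p hp]
  · calc _ ≤ ∏ p ∈ q.primeFactors, (p:ℝ)^s := by
          apply Finset.prod_le_prod
          · intro p hp; linarith [h1 p hp]
          · intro p hp; linarith
      _ = ((∏ p ∈ q.primeFactors, p : ℕ) : ℝ)^s := by
          rw [Real.finsetProd_rpow _ _ (by intros; positivity), Nat.cast_prod]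
      _ ≤ (q:ℝ)^s := by
          apply Real.rpow_le_rpow (by positivity) _ hs
          exact_mod_cast Nat.le_of_dvd (Nat.pos_of_ne_zero hq) (Nat.prod_primeFactors_dvd q)

open ComplexConjugate in
lemma quad_id (b : ℕ → ℂ) (hb : ∀ d, ¬ Squarefree d → b d = 0) (N0 N : ℕ) (τ : ℝ) (hτ : 0 < τ) :
    ∑ m ∈ Finset.Ioc 0 N, ‖∑ d ∈ (Finset.Ioc 0 N0).filter (fun d => d ∣ m), b d‖^2
        * (m:ℝ)^(-(1+τ)) ≤
    (∑' n : ℕ, (n:ℝ)^(-(1+τ))) * ∑ q ∈ Finset.Ioc 0 N0, JJ (1+τ) q *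
      ‖∑ d ∈ (Finset.Ioc 0 N0).filter (fun d => q ∣ d), b d * ((d:ℝ)^(-(1+τ)) : ℝ)‖^2 := by
  set S := Finset.Ioc 0 N0 with hS
  set Z := ∑' n : ℕ, (n:ℝ)^(-(1+τ))
  set s := 1 + τ
  have hs : 0 < s := by positivity
  set F : ℕ → ℝ := fun m => ‖∑ d ∈ S.filter (fun d => d ∣ m), b d‖^2 * (m:ℝ)^(-s)
  have e1 : ∀ m, (F m : ℂ) = ∑ d ∈ S, ∑ e ∈ S, (b d * conj (b e)) *
      ((if Nat.lcm d e ∣ m then (m:ℝ)^(-s) else 0 : ℝ) : ℂ) := by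
    intro m
    simp only [F]
    push_cast
    rw [← Complex.mul_conj', map_sum, Finset.sum_filter, Finset.sum_filter, Finset.sum_mul_sum,
      Finset.sum_mul]
    apply Finset.sum_congr rfl; intro d _
    rw [Finset.sum_mul]
    apply Finset.sum_congr rfl; intro e _
    by_cases h1 : d ∣ m <;> by_cases h2 : e ∣ m <;> simp [Nat.lcm_dvd_iff, h1, h2]
  have hsum : HasSum (fun m => (F m : ℂ)) (∑ d ∈ S, ∑ e ∈ S, (b d * conj (b e)) *
      (((Nat.lcm d e : ℝ)^(-s) * Z : ℝ) : ℂ)) := by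
    simp only [e1]
    apply hasSum_sum; intro d hd
    apply hasSum_sum; intro e he
    apply HasSum.mul_left
    rw [Complex.hasSum_ofReal]
    apply hasSum_mult τ hτ
    simp only [hS, Finset.mem_Ioc] at hd he
    exact Nat.lcm_pos hd.1 he.1
  have hval : (∑ d ∈ S, ∑ e ∈ S, (b d * conj (b e)) *
      (((Nat.lcm d e : ℝ)^(-s) * Z : ℝ) : ℂ)) = ((Z * ∑ q ∈ S, JJ s q *
      ‖∑ d ∈ S.filter (fun d => q ∣ d), b d * ((d:ℝ)^(-s) : ℝ)‖^2 : ℝ) : ℂ) := by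
    have e2 : ∀ d ∈ S, ∀ e ∈ S, (b d * conj (b e)) * (((Nat.lcm d e : ℝ)^(-s) * Z : ℝ) : ℂ) =
       ∑ q ∈ S, (Z * JJ s q : ℂ) * ((if q ∣ d then b d * ((d:ℝ)^(-s) : ℝ) else 0) *
         (if q ∣ e then conj (b e) * ((e:ℝ)^(-s) : ℝ) else 0)) := by
      intro d hd e he
      simp only [hS, Finset.mem_Ioc] at hd he
      by_cases hd2 : Squarefree d
      swap
      · simp [hb d hd2]
      have hg : Squarefree (Nat.gcd d e) := hd2.squarefree_of_dvd (Nat.gcd_dvd_left _ _)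
      have hgp : 0 < Nat.gcd d e := Nat.gcd_pos_of_pos_left _ hd.1
      have hdiv : (Nat.gcd d e).divisors = S.filter (fun q => q ∣ d ∧ q ∣ e) := by
        ext q
        simp only [Nat.mem_divisors, Finset.mem_filter, hS, Finset.mem_Ioc, Nat.dvd_gcd_iff]
        constructor
        · rintro ⟨⟨h1, h2⟩, _⟩
          exact ⟨⟨Nat.pos_of_dvd_of_pos h1 hd.1, (Nat.le_of_dvd hd.1 h1).trans hd.2⟩, h1, h2⟩
        · rintro ⟨_, h⟩; exact ⟨h, hgp.ne'⟩
      have hJ := JJ_sum s _ hg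
      rw [hdiv, Finset.sum_filter] at hJ
      have hl : (Nat.lcm d e : ℝ)^(-s) = (d:ℝ)^(-s) * (e:ℝ)^(-s) * (Nat.gcd d e : ℝ)^s := by
        have h1 : (Nat.gcd d e : ℝ) * (Nat.lcm d e : ℝ) = d * e := by exact_mod_cast Nat.gcd_mul_lcm d e
        have hg0 : (0:ℝ) < Nat.gcd d e := by exact_mod_cast hgp
        have hl0 : (0:ℝ) < Nat.lcm d e := by exact_mod_cast Nat.lcm_pos hd.1 he.1
        rw [← Real.mul_rpow (by positivity) (by positivity), ← h1,
          Real.mul_rpow (by positivity) (by positivity), Real.rpow_neg hg0.le]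
        have := (Real.rpow_pos_of_pos hg0 s).ne'
        field_simp
      rw [hl, ← hJ]
      push_cast
      rw [Finset.mul_sum, Finset.sum_mul, Finset.mul_sum]
      apply Finset.sum_congr rfl; intro q _
      by_cases h1 : q ∣ d <;> by_cases h2 : q ∣ e <;> simp [h1, h2]
      ring
    rw [Finset.sum_congr rfl (fun d hd => Finset.sum_congr rfl (e2 d hd))]
    have : ∀ d ∈ S, ∑ e ∈ S, ∑ q ∈ S, (Z * JJ s q : ℂ) * ((if q ∣ d then b d * ((d:ℝ)^(-s) : ℝ) else 0) *
         (if q ∣ e then conj (b e) * ((e:ℝ)^(-s) : ℝ) else 0)) = ∑ q ∈ S, ∑ e ∈ S, (Z * JJ s q : ℂ) * ((if q ∣ d then b d * ((d:ℝ)^(-s) : ℝ) else 0) *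
         (if q ∣ e then conj (b e) * ((e:ℝ)^(-s) : ℝ) else 0)) := fun d _ => Finset.sum_comm
    rw [Finset.sum_congr rfl this, Finset.sum_comm]
    push_cast
    rw [Finset.mul_sum]
    apply Finset.sum_congr rfl; intro q _
    rw [← Complex.mul_conj', map_sum, Finset.sum_filter, Finset.sum_filter, Finset.sum_mul_sum,
      ← mul_assoc, Finset.mul_sum]
    apply Finset.sum_congr rfl; intro d _
    rw [Finset.mul_sum]
    apply Finset.sum_congr rfl; intro e _
    simp only [map_mul, Complex.conj_ofReal]
  rw [hval, Complex.hasSum_ofReal] at hsum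
  exact sum_le_hasSum _ (fun m _ => by positivity) hsum

lemma cf_nsq (y : ℝ) (P : Polynomial ℝ) (c : ℂ) (d : ℕ) (h : ¬ Squarefree d) : cf y P c d = 0 := by
  simp [cf, ArithmeticFunction.moebius_eq_zero_of_not_squarefree h]

lemma quad_bound (P : Polynomial ℝ) (hP : P.eval 0 = 0) (κ : ℝ) (hκ : 0 ≤ κ) : ∃ C : ℝ, 0 < C ∧
    ∀ (y : ℝ) (c : ℂ) (τ : ℝ) (N : ℕ), 1 ≤ Real.log y → 0 < y → 0 < τ → τ ≤ κ / Real.log y →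
      1 / τ ≤ κ * Real.log y → ‖c‖ ≤ κ / Real.log y →
    ∑ m ∈ Finset.Ioc 0 N, ‖∑ d ∈ (Finset.Ioc 0 ⌊y⌋₊).filter (fun d => d ∣ m), cf y P c d‖^2
        * (m:ℝ)^(-(1+τ)) ≤ C := by
  obtain ⟨C, hC, hS⟩ := S_bound P hP (2*κ) (by positivity)
  refine ⟨(1 + κ) * (Real.exp κ * C^2 * (Real.exp 12 * 2)), by positivity, ?_⟩
  intro y c τ N hy hy0 hτ hτ1 hτ2 hc
  set Λ := Real.log y with hΛ
  have hΛ0 : 0 < Λ := by linarith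
  have hy1 : 1 < y := by
    by_contra h; push Not at h
    have := Real.log_nonpos hy0.le h
    linarith
  refine (quad_id _ (cf_nsq y P c) ⌊y⌋₊ N τ hτ).trans ?_
  have hterm : ∀ q ∈ Finset.Ioc 0 ⌊y⌋₊, JJ (1+τ) q *
      ‖∑ d ∈ (Finset.Ioc 0 ⌊y⌋₊).filter (fun d => q ∣ d), cf y P c d * ((d:ℝ)^(-(1+τ)) : ℝ)‖^2 ≤
      Real.exp κ * C^2 / Λ^2 * ((KK q)^2 / q) := by
    intro q hq
    simp only [Finset.mem_Ioc] at hq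
    have hq0 : (0:ℝ) < q := by exact_mod_cast hq.1
    have hqy : (q:ℝ) ≤ y := (Nat.le_floor_iff hy0.le).1 hq.2
    have hJ := JJ_bd (1+τ) (by positivity) q (by omega)
    have hSq := hS y (c+τ) q 1 (by omega) one_ne_zero hy1 (by
      refine (norm_add_le _ _).trans ?_
      rw [Complex.norm_real, Real.norm_of_nonneg hτ.le, mul_div_assoc]; linarith)
    rw [one_mul] at hSq
    have e : ∑ d ∈ (Finset.Ioc 0 ⌊y⌋₊).filter (fun d => q ∣ d), cf y P c d * ((d:ℝ)^(-(1+τ)) : ℝ)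
      = ∑ l ∈ (Finset.Ioc 0 ⌊y / q⌋₊).filter (fun l => l.Coprime 1),
         cf y P (c+τ) (q * l) / ((q * l : ℕ) : ℂ) := by
      rw [sum_multiples _ _ hq.1, Finset.filter_true_of_mem (by simp), Nat.floor_div_natCast]
      apply Finset.sum_congr rfl; intro l hl
      simp only [Finset.mem_Ioc] at hl
      have hd : q * l ≠ 0 := (Nat.mul_pos hq.1 hl.1).ne'
      generalize q * l = d at hd
      have hd0 : (0:ℝ) < d := by exact_mod_cast Nat.pos_of_ne_zero hd
      have hdc : (d:ℂ) ≠ 0 := by exact_mod_cast hd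
      unfold cf
      rw [Complex.ofReal_cpow hd0.le]
      push_cast
      rw [show -(c + (τ:ℂ)) = -c + -τ by ring, Complex.cpow_add _ _ hdc,
        show -(1 + (τ:ℂ)) = -τ + -1 by ring, Complex.cpow_add _ _ hdc, Complex.cpow_neg_one]
      field_simp
    rw [e]
    calc _ ≤ (q:ℝ)^(1+τ) * (C * KK q / (q * Λ))^2 := by
          apply mul_le_mul hJ.2 _ (by positivity) (by positivity)
          exact pow_le_pow_left₀ (norm_nonneg _) hSq 2
      _ = (q:ℝ)^τ * (C^2 / Λ^2 * ((KK q)^2 / q)) := by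
          rw [Real.rpow_add hq0, Real.rpow_one]; field_simp
      _ ≤ Real.exp κ * (C^2 / Λ^2 * ((KK q)^2 / q)) := by
          gcongr
          rw [Real.rpow_def_of_pos hq0, Real.exp_le_exp]
          have : Real.log q ≤ Λ := Real.log_le_log hq0 hqy
          calc Real.log q * τ ≤ Λ * (κ/Λ) := by
                apply mul_le_mul this hτ1 hτ.le hΛ0.le
            _ = κ := by field_simp
      _ = _ := by ring
  have hsum := Finset.sum_le_sum hterm
  rw [← Finset.mul_sum] at hsum
  have hK : ∑ q ∈ Finset.Ioc 0 ⌊y⌋₊, (KK q)^2 / q ≤ Real.exp 12 * (2 * Λ) := by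
    refine (sum_KK _).trans ?_
    gcongr
    have : Real.log (⌊y⌋₊:ℝ) ≤ Λ := by
      apply Real.log_le_log
      · exact_mod_cast Nat.floor_pos.2 hy1.le
      · exact Nat.floor_le hy0.le
    linarith
  have hZ := zeta_le τ hτ
  have hZ2 : (∑' n : ℕ, (n:ℝ)^(-(1+τ))) ≤ (1+κ) * Λ := by nlinarith
  refine (mul_le_mul hZ2 (hsum.trans (mul_le_mul_of_nonneg_left hK (by positivity))) ?_
    (by positivity)).trans (le_of_eq ?_)
  · apply Finset.sum_nonneg; intro q hq
    simp only [Finset.mem_Ioc] at hq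
    have := (JJ_bd (1+τ) (by positivity) q (by omega)).1
    positivity
  · field_simp

end MZ

namespace MZ

def om (T : ℝ) : ℂ := ((1/T : ℝ) : ℂ) + Complex.I
def Ef (z : ℂ) : ℂ := (Complex.exp z + 1)⁻¹
def GG (b : ℕ → ℂ) (D : ℕ) (T v : ℝ) : ℂ := ∑ d ∈ Finset.Ioc 0 D, b d * Ef (d * om T * v)

lemma om_re (T : ℝ) : (om T).re = 1/T := by simp [om]
lemma om_im (T : ℝ) : (om T).im = 1 := by simp [om]

lemma exp_add_one_ne {z : ℂ} (hz : 0 < z.re) : Complex.exp z + 1 ≠ 0 := by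
  intro h
  have : Complex.exp z = -1 := by linear_combination h
  have h2 := congrArg norm this
  rw [Complex.norm_exp, norm_neg, norm_one, Real.exp_eq_one_iff] at h2
  linarith

lemma Ef_bound {z : ℂ} (hz : 0 < z.re) : ‖Ef z‖ ≤ 1 / (Real.exp z.re - 1) := by
  unfold Ef
  have h0 : 0 < Real.exp z.re - 1 := by have := Real.add_one_lt_exp hz.ne'; linarith
  rw [norm_inv, one_div]
  apply inv_anti₀ h0
  have := norm_sub_norm_le (Complex.exp z) (-1)
  rw [sub_neg_eq_add, norm_neg, norm_one, Complex.norm_exp] at this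
  exact this

lemma Ef_bound' {z : ℂ} (hz : 0 < z.re) : ‖Ef z‖ ≤ 1 / z.re := by
  refine (Ef_bound hz).trans ?_
  have := Real.add_one_le_exp z.re
  apply one_div_le_one_div_of_le hz; linarith

lemma Ef_geom {z : ℂ} (hz : 0 < z.re) (n : ℕ) :
    Ef z = (∑ k ∈ Finset.Ioc 0 n, (-1:ℂ)^(k+1) * Complex.exp (-(k*z)))
      + (-1)^n * Complex.exp (-(n*z)) * Ef z := by
  induction n with
  | zero => simp
  | succ n ih =>
    rw [Finset.sum_Ioc_succ_top (by omega)]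
    have h1 := exp_add_one_ne hz
    have key : (-1)^n * Complex.exp (-(n*z)) * Ef z = (-1:ℂ)^(n+1+1) * Complex.exp (-((n+1:ℕ)*z)) +
        (-1)^(n+1) * Complex.exp (-((n+1:ℕ)*z)) * Ef z := by
      have e : Complex.exp (-(n*z)) = Complex.exp (-((n+1:ℕ)*z)) * Complex.exp z := by
        rw [← Complex.exp_add]; congr 1; push_cast; ring
      rw [e]; unfold Ef
      field_simp; ring
    rw [add_assoc, ← key]; exact ih

lemma int_exp_bound (w : ℂ) (hw : w ≠ 0) (hre : 0 ≤ w.re) (V W : ℝ) (hVW : V ≤ W) :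
    ‖∫ v in V..W, Complex.exp (-(w * v))‖ ≤ 2 * Real.exp (-(w.re * V)) / ‖w‖ := by
  have : ∀ v : ℝ, Complex.exp (-(w * v)) = Complex.exp ((-w) * v) := by intro v; congr 1; ring
  simp only [this]
  rw [integral_exp_mul_complex (neg_ne_zero.2 hw), norm_div, norm_neg]
  gcongr
  refine (norm_sub_le _ _).trans ?_
  rw [Complex.norm_exp, Complex.norm_exp]
  simp only [Complex.mul_re, Complex.neg_re, Complex.ofReal_re, Complex.ofReal_im, mul_zero, sub_zero]
  have : Real.exp (-w.re * W) ≤ Real.exp (-(w.re*V)) := by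
    rw [Real.exp_le_exp]; nlinarith
  rw [← neg_mul] at *
  linarith

lemma invR_nonneg (k : ℕ) : 0 ≤ invR k := by
  simp only [invR, ArithmeticFunction.coe_mk]; positivity

lemma sum_invR_sub (N m : ℕ) : ∑ k ∈ Finset.Ioc 0 N, invR (k - m) ≤ (harmonic N : ℝ) := by
  have h : ∑ k ∈ Finset.Ioc 0 N, invR (k - m) = ∑ j ∈ Finset.Ioc 0 (N - m), invR j := by
    induction N with
    | zero => simp
    | succ N ih =>
      rw [Finset.sum_Ioc_succ_top (by omega), ih]
      rcases le_or_gt (N+1) m with h | h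
      · rw [show N + 1 - m = 0 by omega, show N - m = 0 by omega]; simp
      · rw [show N + 1 - m = (N - m) + 1 by omega, Finset.sum_Ioc_succ_top (by omega)]
  rw [h, ← harm_sum]
  apply Finset.sum_le_sum_of_subset_of_nonneg
  · exact Finset.Ioc_subset_Ioc_right (Nat.sub_le _ _)
  · intros; exact invR_nonneg _

lemma sum_invR_sub' (N m : ℕ) (hm : m ≤ N) :
    ∑ k ∈ Finset.Ioc 0 N, invR (m - k) ≤ (harmonic N : ℝ) := by
  have h : ∀ N, ∑ k ∈ Finset.Ioc 0 N, invR (m - k) = ∑ j ∈ Finset.Ico (m - N) m, invR j := by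
    intro N
    induction N with
    | zero => simp
    | succ N ih =>
      rw [Finset.sum_Ioc_succ_top (by omega), ih]
      rcases le_or_gt m N with h | h
      · rw [show m - N = 0 by omega, show m - (N + 1) = 0 by omega]; simp
      · rw [Finset.sum_eq_sum_Ico_succ_bot (show m - (N+1) < m by omega),
          show m - (N+1) + 1 = m - N by omega, add_comm]
  rw [h, ← harm_sum, show m - N = 0 by omega]
  rcases Nat.eq_zero_or_pos m with h0 | h0
  · subst h0; simp; exact Finset.sum_nonneg fun _ _ => invR_nonneg _
  rw [Finset.sum_eq_sum_Ico_succ_bot h0, show invR 0 = 0 by simp, zero_add]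
  apply Finset.sum_le_sum_of_subset_of_nonneg
  · intro k; simp only [Finset.mem_Ico, Finset.mem_Ioc]; omega
  · intros; exact invR_nonneg _

lemma sum_inv_dist (N m : ℕ) (hm : m ∈ Finset.Ioc 0 N) :
    ∑ k ∈ Finset.Ioc 0 N, (1 / |(m:ℝ) - k|) ≤ 2 * (harmonic N : ℝ) := by
  simp only [Finset.mem_Ioc] at hm
  have : ∀ k ∈ Finset.Ioc 0 N, 1 / |(m:ℝ) - k| = invR (m - k) + invR (k - m) := by
    intro k _
    rcases lt_trichotomy m k with h | h | h
    · rw [show m - k = 0 by omega, show invR 0 = 0 by simp, zero_add]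
      simp only [invR, ArithmeticFunction.coe_mk]
      rw [Nat.cast_sub h.le, abs_of_neg (by have : (m:ℝ) < k := by exact_mod_cast h
                                            linarith)]
      congr 1; ring
    · subst h; simp
    · rw [show k - m = 0 by omega, show invR 0 = 0 by simp, add_zero]
      simp only [invR, ArithmeticFunction.coe_mk]
      rw [Nat.cast_sub h.le, abs_of_pos (by have : (k:ℝ) < m := by exact_mod_cast h
                                            linarith)]
  rw [Finset.sum_congr rfl this, Finset.sum_add_distrib, two_mul]
  exact add_le_add (sum_invR_sub' N m hm.2) (sum_invR_sub N m)

lemma schur (S : Finset ℕ) (a : ℕ → ℝ) (K : ℕ → ℕ → ℝ) (hK : ∀ m k, K m k = K k m)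
    (hK0 : ∀ m k, 0 ≤ K m k) :
    ∑ m ∈ S, ∑ k ∈ S, a m * a k * K m k ≤ ∑ m ∈ S, a m ^ 2 * ∑ k ∈ S, K m k := by
  have h1 : ∑ m ∈ S, ∑ k ∈ S, a m * a k * K m k ≤
      ∑ m ∈ S, ∑ k ∈ S, (a m ^ 2 * K m k / 2 + a k ^ 2 * K k m / 2) := by
    apply Finset.sum_le_sum; intro m _; apply Finset.sum_le_sum; intro k _
    rw [hK k m]
    nlinarith [sq_nonneg (a m - a k), hK0 m k, mul_nonneg (hK0 m k) (sq_nonneg (a m - a k))]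
  refine h1.trans (le_of_eq ?_)
  simp only [Finset.sum_add_distrib]
  rw [Finset.sum_comm (f := fun m k => a k ^ 2 * K k m / 2), ← Finset.sum_add_distrib]
  apply Finset.sum_congr rfl; intro m _
  rw [← Finset.sum_add_distrib, Finset.mul_sum]
  apply Finset.sum_congr rfl; intros; ring

open ComplexConjugate in
lemma dir_int (c : ℕ → ℂ) (N : ℕ) (T V W : ℝ) (hT : 0 < T) (hV : 0 < V) (hVW : V ≤ W) :
    ∫ v in V..W, ‖∑ m ∈ Finset.Ioc 0 N, c m * Complex.exp (-(m * om T * v))‖^2 ≤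
      ∑ m ∈ Finset.Ioc 0 N, ‖c m‖^2 * (T / m * (1 + 4 * (harmonic N : ℝ) / V)) := by
  set S := Finset.Ioc 0 N
  let w : ℕ → ℕ → ℂ := fun m k => (((m + k) * (1/T) : ℝ) : ℂ) + ((m - k : ℝ) : ℂ) * Complex.I
  let K : ℕ → ℕ → ℝ := fun m k => if m = k then 2 * 1 / ((m + k) * (1/T))
    else 2 * Real.exp (-((m + k) * (1/T) * V)) / |(m:ℝ) - k|
  have hwre : ∀ m k, (w m k).re = (m+k) * (1/T) := by intro m k; simp [w]
  have hwim : ∀ m k, (w m k).im = m - k := by intro m k; simp [w]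
  have hI : ∀ m ∈ S, ∀ k ∈ S, ‖∫ v in V..W, Complex.exp (-(w m k * v))‖ ≤ K m k := by
    intro m hm k hk
    simp only [S, Finset.mem_Ioc] at hm hk
    have hm0 : (0:ℝ) < m := by exact_mod_cast hm.1
    have hk0 : (0:ℝ) < k := by exact_mod_cast hk.1
    have hre : 0 < (w m k).re := by rw [hwre]; positivity
    have hw0 : w m k ≠ 0 := by intro h; rw [h] at hre; simp at hre
    refine (int_exp_bound (w m k) hw0 hre.le V W hVW).trans ?_
    simp only [K]
    split_ifs with h
    · apply div_le_div₀ (by positivity) _ (by positivity)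
      · have := Complex.re_le_norm (w m k); rwa [hwre] at this
      · gcongr
        rw [Real.exp_le_one_iff]; nlinarith
    · rw [hwre]
      apply div_le_div_of_nonneg_left (by positivity)
      · rw [abs_pos, sub_ne_zero]; exact_mod_cast h
      · have := Complex.abs_im_le_norm (w m k); rwa [hwim] at this
  have e1 : ((∫ v in V..W, ‖∑ m ∈ S, c m * Complex.exp (-(m * om T * v))‖^2 : ℝ) : ℂ) =
     ∑ m ∈ S, ∑ k ∈ S, c m * conj (c k) * ∫ v in V..W, Complex.exp (-(w m k * v)) := by
    rw [← intervalIntegral.integral_ofReal]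
    have : ∀ v : ℝ, ((‖∑ m ∈ S, c m * Complex.exp (-(m * om T * v))‖^2 : ℝ) : ℂ) =
       ∑ m ∈ S, ∑ k ∈ S, c m * conj (c k) * Complex.exp (-(w m k * v)) := by
      intro v
      push_cast
      rw [← Complex.mul_conj', map_sum, Finset.sum_mul_sum]
      apply Finset.sum_congr rfl; intro m _; apply Finset.sum_congr rfl; intro k _
      rw [map_mul, ← Complex.exp_conj]
      have : Complex.exp (-(w m k * v)) = Complex.exp (-(m * om T * v)) *
         Complex.exp (conj (-(k * om T * v))) := by
        rw [← Complex.exp_add]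
        congr 1
        simp only [w, om, map_neg, map_mul, map_add, Complex.conj_ofReal, Complex.conj_I,
          Complex.conj_natCast]
        push_cast; ring
      rw [this]; ring
    simp only [this]
    rw [intervalIntegral.integral_finset_sum]
    · apply Finset.sum_congr rfl; intro m _
      rw [intervalIntegral.integral_finset_sum]
      · apply Finset.sum_congr rfl; intro k _
        rw [intervalIntegral.integral_const_mul]
      · intro k _; apply Continuous.intervalIntegrable; fun_prop
    · intro m _; apply Continuous.intervalIntegrable; fun_prop
  have e2 : ∫ v in V..W, ‖∑ m ∈ S, c m * Complex.exp (-(m * om T * v))‖^2 ≤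
     ∑ m ∈ S, ∑ k ∈ S, ‖c m‖ * ‖c k‖ * K m k := by
    refine (le_abs_self _).trans ?_
    rw [← Real.norm_eq_abs, ← Complex.norm_real, e1]
    refine (norm_sum_le _ _).trans (Finset.sum_le_sum fun m hm => ?_)
    refine (norm_sum_le _ _).trans (Finset.sum_le_sum fun k hk => ?_)
    rw [norm_mul, norm_mul, RCLike.norm_conj]
    gcongr
    exact hI m hm k hk
  refine e2.trans ((schur S (fun m => ‖c m‖) K ?_ ?_).trans ?_)
  · intro m k
    simp only [K]
    by_cases h : m = k
    · simp [h]
    · rw [if_neg h, if_neg (Ne.symm h), abs_sub_comm, add_comm (m:ℝ)]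
  · intro m k; simp only [K]; split_ifs <;> positivity
  · apply Finset.sum_le_sum; intro m hm
    gcongr
    have hm' := hm
    simp only [S, Finset.mem_Ioc] at hm
    have hm0 : (0:ℝ) < m := by exact_mod_cast hm.1
    have hK : ∀ k ∈ S, K m k ≤ (if m = k then T/m else 0) + 2 * (T/(m*V)) * (1 / |(m:ℝ) - k|) := by
      intro k hk
      simp only [K]
      split_ifs with h
      · subst h
        simp
        apply le_of_eq; field_simp; ring
      · rw [zero_add, mul_one_div (2 * (T/(m*V)))]
        refine div_le_div_of_nonneg_right (mul_le_mul_of_nonneg_left ?_ (by norm_num)) (abs_nonneg _)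
        have hk0 : (0:ℝ) ≤ k := by positivity
        have h1 : Real.exp (-((m + k) * (1/T) * V)) ≤ Real.exp (-(m * V / T)) := by
          rw [Real.exp_le_exp, neg_le_neg_iff]
          have : (m + k) * (1/T) * V = m * V / T + k * V / T := by field_simp
          rw [this]; have : 0 ≤ k * V / T := by positivity
          linarith
        refine h1.trans ?_
        rw [Real.exp_neg, ← one_div]
        have h2 := Real.add_one_le_exp (m * V / T)
        have h3 : T/(m*V) = 1/(m*V/T) := by field_simp
        rw [h3]
        apply one_div_le_one_div_of_le (by positivity); linarith
    refine (Finset.sum_le_sum hK).trans ?_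
    rw [Finset.sum_add_distrib, Finset.sum_ite_eq, if_pos hm', ← Finset.mul_sum]
    have := sum_inv_dist N m hm'
    calc _ ≤ T/m + 2 * (T/(m*V)) * (2 * (harmonic N : ℝ)) := by gcongr
      _ = _ := by field_simp; ring

end MZ

namespace MZ

lemma cf_bound (P : Polynomial ℝ) : ∃ B : ℝ, 0 < B ∧ ∀ (y : ℝ) (c : ℂ) (d : ℕ), 1 < y → c.re = 0 →
    d ∈ Finset.Ioc 0 ⌊y⌋₊ → ‖cf y P c d‖ ≤ B := by
  obtain ⟨B, hB, hb⟩ := poly_bdd P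
  refine ⟨B + 1, by linarith, ?_⟩
  intro y c d hy hc hd
  simp only [Finset.mem_Ioc] at hd
  have hd0 : (0:ℝ) < d := by exact_mod_cast hd.1
  have hd1 : (1:ℝ) ≤ d := by exact_mod_cast hd.1
  have hdy : (d:ℝ) ≤ y := (Nat.le_floor_iff (by linarith)).1 hd.2
  have hΛ := Real.log_pos hy
  unfold cf
  rw [norm_mul, norm_mul, Complex.norm_natCast_cpow_of_pos hd.1, Complex.neg_re, hc, neg_zero,
    Real.rpow_zero, mul_one]
  have a1 : ‖(ArithmeticFunction.moebius d : ℂ)‖ ≤ 1 := by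
    have := abs_mu_le d
    rw [← Complex.ofReal_intCast, Complex.norm_real]; exact this
  have a2 : ‖((P.eval (Real.log (y / d) / Real.log y) : ℝ) : ℂ)‖ ≤ B := by
    rw [Complex.norm_real]
    apply hb
    · apply div_nonneg _ hΛ.le
      apply Real.log_nonneg; rw [le_div_iff₀ hd0]; linarith
    · rw [div_le_one hΛ]
      apply Real.log_le_log (by positivity)
      exact div_le_self (by linarith) hd1
  calc _ ≤ 1 * B := mul_le_mul a1 a2 (norm_nonneg _) (by norm_num)
    _ ≤ _ := by linarith

lemma GG_re (d : ℕ) (T v : ℝ) : ((d:ℂ) * om T * v).re = d * v / T := by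
  simp [om]; ring
lemma GG_im (d : ℕ) (T v : ℝ) : ((d:ℂ) * om T * v).im = d * v := by
  simp [om]

lemma GG_cont (b : ℕ → ℂ) (D : ℕ) (T : ℝ) (hT : 0 < T) :
    ContinuousOn (GG b D T) (Set.Ioi 0) := by
  unfold GG
  apply continuousOn_finset_sum
  intro d hd
  simp only [Finset.mem_Ioc] at hd
  have hd0 : (0:ℝ) < d := by exact_mod_cast hd.1
  apply ContinuousOn.mul continuousOn_const
  unfold Ef
  apply ContinuousOn.inv₀
  · fun_prop
  · intro v hv
    apply exp_add_one_ne
    rw [GG_re]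
    have : 0 < v := hv
    positivity

def cc (b : ℕ → ℂ) (D m : ℕ) : ℂ :=
  ∑ d ∈ (Finset.Ioc 0 D).filter (fun d => d ∣ m), b d * (-1)^(m/d+1)

lemma GG_split (b : ℕ → ℂ) (D N : ℕ) (T v : ℝ) (hT : 0 < T) (hv : 0 < v) :
    GG b D T v = (∑ m ∈ Finset.Ioc 0 N, cc b D m * Complex.exp (-(m * om T * v))) +
      ∑ d ∈ Finset.Ioc 0 D, b d * ((-1)^(N/d) * Complex.exp (-((N/d : ℕ) * (d * om T * v)))
        * Ef (d * om T * v)) := by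
  have e1 : ∑ m ∈ Finset.Ioc 0 N, cc b D m * Complex.exp (-(m * om T * v)) =
     ∑ d ∈ Finset.Ioc 0 D, b d * ∑ k ∈ Finset.Ioc 0 (N/d), (-1:ℂ)^(k+1) *
      Complex.exp (-(k*(d * om T * v))) := by
    have : ∀ m ∈ Finset.Ioc 0 N, cc b D m * Complex.exp (-(m * om T * v)) =
      ∑ d ∈ Finset.Ioc 0 D, if d ∣ m then b d * ((-1)^(m/d+1) * Complex.exp (-(m * om T * v)))
        else 0 := by
      intro m _
      unfold cc
      rw [Finset.sum_mul, Finset.sum_filter]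
      apply Finset.sum_congr rfl; intro d _
      split_ifs <;> ring
    rw [Finset.sum_congr rfl this, Finset.sum_comm]
    apply Finset.sum_congr rfl; intro d hd
    simp only [Finset.mem_Ioc] at hd
    rw [← Finset.sum_filter, sum_multiples _ _ hd.1, Finset.mul_sum]
    apply Finset.sum_congr rfl; intro k _
    rw [Nat.mul_div_cancel_left k hd.1]
    congr 3; push_cast; ring
  rw [e1, ← Finset.sum_add_distrib]
  unfold GG
  apply Finset.sum_congr rfl; intro d hd
  simp only [Finset.mem_Ioc] at hd
  have hd0 : (0:ℝ) < d := by exact_mod_cast hd.1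
  rw [← mul_add, ← Ef_geom]
  rw [GG_re]; positivity

lemma GG_rem (b : ℕ → ℂ) (D N : ℕ) (T v B : ℝ) (hT : 1 ≤ T) (hv : 1 ≤ v) (hB : 0 ≤ B)
    (hb : ∀ d ∈ Finset.Ioc 0 D, ‖b d‖ ≤ B) (hD : (D:ℝ) ≤ T) (hN : T^2 ≤ N) :
    ‖∑ d ∈ Finset.Ioc 0 D, b d * ((-1)^(N/d) * Complex.exp (-((N/d : ℕ) * (d * om T * v)))
        * Ef (d * om T * v))‖ ≤ 6 * Real.exp 1 * B / T := by
  have hterm : ∀ d ∈ Finset.Ioc 0 D, ‖b d * ((-1)^(N/d) * Complex.exp (-((N/d : ℕ) * (d * om T * v)))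
        * Ef (d * om T * v))‖ ≤ B * (Real.exp (1 - T) * T) := by
    intro d hd
    have hb := hb d hd
    simp only [Finset.mem_Ioc] at hd
    have hd0 : (0:ℝ) < d := by exact_mod_cast hd.1
    have hd1 : (1:ℝ) ≤ d := by exact_mod_cast hd.1
    have hdD : (d:ℝ) ≤ D := by exact_mod_cast hd.2
    rw [norm_mul, norm_mul, norm_mul, norm_pow, norm_neg, norm_one, one_pow, one_mul, Complex.norm_exp]
    have h1 : (-(((N/d : ℕ):ℂ) * (d * om T * v))).re ≤ 1 - T := by
      have e : (-(((N/d : ℕ):ℂ) * (d * om T * v))).re = -(((N/d : ℕ):ℝ) * (d * v / T)) := by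
        rw [Complex.neg_re, ← Complex.ofReal_natCast (N/d), Complex.re_ofReal_mul, GG_re]
      rw [e]
      have h2 : (N:ℝ) ≤ ((N/d : ℕ):ℝ) * d + d := by
        have := Nat.lt_div_mul_add hd.1 (a := N)
        exact_mod_cast this.le
      have h3 : T^2 - T ≤ ((N/d : ℕ):ℝ) * d := by linarith
      have h4 : T - 1 ≤ ((N/d : ℕ):ℝ) * d / T := by
        rw [le_div_iff₀ (by linarith)]; nlinarith
      have h5 : ((N/d : ℕ):ℝ) * d / T ≤ ((N/d : ℕ):ℝ) * (d * v / T) := by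
        have : ((N/d : ℕ):ℝ) * (d * v / T) = ((N/d : ℕ):ℝ) * d / T * v := by ring
        rw [this]
        have : 0 ≤ ((N/d : ℕ):ℝ) * d / T := by positivity
        nlinarith
      linarith
    have h2 : ‖Ef (d * om T * v)‖ ≤ T := by
      have hre : 0 < ((d:ℂ) * om T * v).re := by rw [GG_re]; positivity
      refine (Ef_bound' hre).trans ?_
      rw [GG_re, one_div_div, div_le_iff₀ (by positivity)]
      have : 1 ≤ d * v := by nlinarith
      nlinarith
    gcongr
  refine (norm_sum_le _ _).trans ((Finset.sum_le_sum hterm).trans ?_)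
  rw [Finset.sum_const, Nat.card_Ioc, nsmul_eq_mul, Nat.sub_zero, le_div_iff₀ (by linarith)]
  have h3 : T^3 ≤ 6 * Real.exp T := by
    have := Real.pow_div_factorial_le_exp T (by linarith) 3
    rw [div_le_iff₀ (by positivity)] at this
    norm_num [Nat.factorial] at this
    linarith
  calc (D:ℝ) * (B * (Real.exp (1-T) * T)) * T ≤ T * (B * (Real.exp (1-T) * T)) * T := by
        gcongr
    _ = B * (Real.exp 1 * (T^3 * Real.exp (-T))) := by
        rw [sub_eq_add_neg, Real.exp_add]; ring
    _ ≤ B * (Real.exp 1 * ((6 * Real.exp T) * Real.exp (-T))) := by gcongr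
    _ = _ := by rw [mul_assoc 6, ← Real.exp_add]; simp; ring

lemma cc_eq (b : ℕ → ℂ) (D m : ℕ) (hm : 0 < m) : cc b D m =
    (∑ d ∈ (Finset.Ioc 0 D).filter (fun d => d ∣ m), b d) -
    2 * (if 2 ∣ m then ∑ d ∈ (Finset.Ioc 0 D).filter (fun d => d ∣ m/2), b d else 0) := by
  unfold cc
  have : (if 2 ∣ m then ∑ d ∈ (Finset.Ioc 0 D).filter (fun d => d ∣ m/2), b d else 0) =
      ∑ d ∈ (Finset.Ioc 0 D).filter (fun d => d ∣ m), if 2 ∣ m / d then b d else 0 := by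
    rw [← Finset.sum_filter, Finset.filter_filter]
    split_ifs with h
    · congr 1
      ext d
      simp only [Finset.mem_filter, and_congr_right_iff]
      intro hd
      simp only [Finset.mem_Ioc] at hd
      obtain ⟨k, rfl⟩ := h
      rw [Nat.mul_div_cancel_left _ (by norm_num)]
      constructor
      · rintro ⟨j, rfl⟩
        refine ⟨⟨2*j, by ring⟩, ?_⟩
        rw [show 2 * (d * j) = d * (2 * j) by ring, Nat.mul_div_cancel_left _ hd.1]
        exact dvd_mul_right _ _
      · rintro ⟨⟨j, hj⟩, h2⟩
        rw [hj, Nat.mul_div_cancel_left _ hd.1] at h2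
        obtain ⟨i, rfl⟩ := h2
        exact ⟨i, by nlinarith⟩
    · symm
      apply Finset.sum_eq_zero
      intro d hd
      simp only [Finset.mem_filter] at hd
      exact absurd (hd.2.2.trans (Nat.div_dvd_of_dvd hd.2.1)) h
  rw [this, Finset.mul_sum, ← Finset.sum_sub_distrib]
  apply Finset.sum_congr rfl
  intro d _
  split_ifs with h
  · rw [Odd.neg_one_pow (Even.add_one (even_iff_two_dvd.2 h))]; ring
  · rw [Even.neg_one_pow (Odd.add_one (Nat.not_even_iff_odd.1 (fun hh => h (even_iff_two_dvd.1 hh))))]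
    ring

lemma cc_sum (b : ℕ → ℂ) (D N : ℕ) (τ Q : ℝ) (hτ : 0 < τ)
    (hQ : ∀ N : ℕ, ∑ m ∈ Finset.Ioc 0 N, ‖∑ d ∈ (Finset.Ioc 0 D).filter (fun d => d ∣ m), b d‖^2
        * (m:ℝ)^(-(1+τ)) ≤ Q) :
    ∑ m ∈ Finset.Ioc 0 N, ‖cc b D m‖^2 * (m:ℝ)^(-(1+τ)) ≤ 10 * Q := by
  set co : ℕ → ℂ := fun m => ∑ d ∈ (Finset.Ioc 0 D).filter (fun d => d ∣ m), b d with hco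
  have h1 : ∀ m ∈ Finset.Ioc 0 N, ‖cc b D m‖^2 * (m:ℝ)^(-(1+τ)) ≤
     2 * (‖co m‖^2 * (m:ℝ)^(-(1+τ))) +
      (if 2 ∣ m then 8 * (‖co (m/2)‖^2 * (m:ℝ)^(-(1+τ))) else 0) := by
    intro m hm
    simp only [Finset.mem_Ioc] at hm
    rw [cc_eq b D m hm.1]
    have hp : 0 ≤ (m:ℝ)^(-(1+τ)) := by positivity
    have key : ∀ a c : ℂ, ‖a - 2 * c‖^2 ≤ 2 * ‖a‖^2 + 8 * ‖c‖^2 := by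
      intro a c
      have h1 := norm_sub_le a (2*c)
      rw [norm_mul, Complex.norm_ofNat] at h1
      have h2 := norm_nonneg (a - 2*c)
      nlinarith [sq_nonneg (‖a‖ - 2 * ‖c‖)]
    split_ifs with h
    · have := key (co m) (co (m/2))
      simp only [hco] at this ⊢
      nlinarith
    · have := key (co m) 0
      simp only [hco, norm_zero] at this ⊢
      nlinarith
  refine (Finset.sum_le_sum h1).trans ?_
  rw [Finset.sum_add_distrib, ← Finset.mul_sum, ← Finset.sum_filter, sum_multiples _ _ (by norm_num)]
  have h2 : ∑ k ∈ Finset.Ioc 0 (N/2), 8 * (‖co (2*k/2)‖^2 * ((2*k:ℕ):ℝ)^(-(1+τ))) ≤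
     8 * ∑ k ∈ Finset.Ioc 0 (N/2), ‖co k‖^2 * (k:ℝ)^(-(1+τ)) := by
    rw [Finset.mul_sum]
    apply Finset.sum_le_sum; intro k hk
    simp only [Finset.mem_Ioc] at hk
    have hk0 : (0:ℝ) < k := by exact_mod_cast hk.1
    rw [Nat.mul_div_cancel_left _ (by norm_num)]
    have hr : ((2*k:ℕ):ℝ)^(-(1+τ)) ≤ (k:ℝ)^(-(1+τ)) :=
      Real.rpow_le_rpow_of_nonpos hk0 (by push_cast; linarith) (by linarith)
    exact mul_le_mul_of_nonneg_left (mul_le_mul_of_nonneg_left hr (by positivity)) (by norm_num)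
  have := hQ N
  have := hQ (N/2)
  simp only [hco] at *
  linarith

lemma direct_bound (P : Polynomial ℝ) (hP : P.eval 0 = 0) (κ : ℝ) (hκ : 0 ≤ κ) : ∃ C : ℝ, 0 < C ∧
    ∀ (T y V : ℝ) (c : ℂ), 1 ≤ Real.log T → 1 ≤ T → y ≤ T → 0 < y → 1 ≤ Real.log y →
      1 / Real.log T ≤ κ / Real.log y → Real.log T ≤ κ * Real.log y → ‖c‖ ≤ κ / Real.log y →
      c.re = 0 → Real.log T ≤ V → V ≤ T^2 →
      ∫ v in V..T^2, ‖GG (cf y P c) ⌊y⌋₊ T v‖^2 ≤ C * T := by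
  obtain ⟨Q, hQ, hquad⟩ := quad_bound P hP κ hκ
  obtain ⟨B, hB, hcf⟩ := cf_bound P
  refine ⟨2 * (17 * Real.exp 3 * (10 * Q)) + 2 * (6 * Real.exp 1 * B)^2, by positivity, ?_⟩
  intro T y V c hL hT hyT hy0 hΛ h1 h2 hc hc0 hV hVT
  set L := Real.log T with hLdef
  have hL0 : 0 < L := by linarith
  have hT0 : 0 < T := by linarith
  have hV0 : 0 < V := by linarith
  have hy1 : 1 < y := by
    by_contra h; push Not at h
    have := Real.log_nonpos hy0.le h
    linarith
  set b := cf y P c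
  set D := ⌊y⌋₊
  set N := ⌊T^2⌋₊ + 1 with hN
  have hNT : T^2 ≤ N := by rw [hN]; push_cast; exact (Nat.lt_floor_add_one _).le
  have hN2 : (N:ℝ) ≤ 2 * T^2 := by
    rw [hN]; push_cast
    have := Nat.floor_le (show 0 ≤ T^2 by positivity)
    nlinarith
  have hlogN : Real.log N ≤ 3 * L := by
    calc Real.log N ≤ Real.log (2 * T^2) := Real.log_le_log (by nlinarith) hN2
      _ = Real.log 2 + 2 * L := by
        rw [Real.log_mul (by norm_num) (by positivity), Real.log_pow]; push_cast; ring
      _ ≤ _ := by have := Real.log_two_lt_d9; linarith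
  have hD : (D:ℝ) ≤ T := (Nat.floor_le hy0.le).trans hyT
  set M : ℝ → ℂ := fun v => ∑ m ∈ Finset.Ioc 0 N, cc b D m * Complex.exp (-(m * om T * v)) with hM
  have hpt : ∀ v ∈ Set.Icc V (T^2), ‖GG b D T v‖^2 ≤ 2 * ‖M v‖^2 + 2 * (6 * Real.exp 1 * B / T)^2 := by
    intro v hv
    have hv1 : 1 ≤ v := by linarith [hv.1]
    rw [GG_split b D N T v hT0 (by linarith)]
    have hR := GG_rem b D N T v B hT hv1 hB.le (fun d hd => hcf y c d hy1 hc0 hd) hD hNT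
    set R := ∑ d ∈ Finset.Ioc 0 D, b d * ((-1)^(N/d) * Complex.exp (-((N/d : ℕ) * (d * om T * v)))
        * Ef (d * om T * v))
    have h3 := norm_add_le (M v) R
    have h4 : ‖R‖^2 ≤ (6 * Real.exp 1 * B / T)^2 := pow_le_pow_left₀ (norm_nonneg _) hR 2
    have h5 : ‖M v + R‖^2 ≤ (‖M v‖ + ‖R‖)^2 := pow_le_pow_left₀ (norm_nonneg _) h3 2
    nlinarith [sq_nonneg (‖M v‖ - ‖R‖)]
  have hMc : Continuous fun v => ‖M v‖^2 := by simp only [hM]; fun_prop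
  have i1 : ∫ v in V..T^2, ‖GG b D T v‖^2 ≤
      ∫ v in V..T^2, (2 * ‖M v‖^2 + 2 * (6 * Real.exp 1 * B / T)^2) := by
    apply intervalIntegral.integral_mono_on hVT _ _ hpt
    · apply ContinuousOn.intervalIntegrable
      rw [Set.uIcc_of_le hVT]
      apply ContinuousOn.pow
      apply ContinuousOn.norm
      apply (GG_cont b D T hT0).mono
      intro v hv; exact lt_of_lt_of_le hV0 hv.1
    · apply Continuous.intervalIntegrable; fun_prop
  refine i1.trans ?_
  have ia : IntervalIntegrable (fun v => 2*‖M v‖^2) volume V (T^2) :=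
    (continuous_const.mul hMc).intervalIntegrable _ _
  have ib : IntervalIntegrable (fun _ : ℝ => 2 * (6 * Real.exp 1 * B / T)^2) volume V (T^2) :=
    continuous_const.intervalIntegrable _ _
  rw [intervalIntegral.integral_add ia ib, intervalIntegral.integral_const_mul,
    intervalIntegral.integral_const, smul_eq_mul]
  have i2 := dir_int (cc b D) N T V (T^2) hT0 hV0 hVT
  have hτ : 0 < 1/L := by positivity
  have hcs := cc_sum b D N (1/L) Q hτ (fun N => hquad y c (1/L) N hΛ hy0 hτ h1
    (by rw [one_div_one_div]; exact h2) hc)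
  have hH : 1 + 4 * (harmonic N : ℝ) / V ≤ 17 := by
    have : (harmonic N : ℝ) ≤ 4 * L := (harm_le N).trans (by linarith)
    have : 4 * (harmonic N : ℝ) / V ≤ 16 := by
      rw [div_le_iff₀ hV0]; linarith
    linarith
  have i3 : ∑ m ∈ Finset.Ioc 0 N, ‖cc b D m‖^2 * (T / m * (1 + 4 * (harmonic N : ℝ) / V)) ≤
     T * (17 * Real.exp 3 * (10 * Q)) := by
    calc _ ≤ ∑ m ∈ Finset.Ioc 0 N, T * (17 * Real.exp 3) * (‖cc b D m‖^2 * (m:ℝ)^(-(1+1/L))) := by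
          apply Finset.sum_le_sum; intro m hm
          simp only [Finset.mem_Ioc] at hm
          have hm0 : (0:ℝ) < m := by exact_mod_cast hm.1
          have hmN : (m:ℝ) ≤ N := by exact_mod_cast hm.2
          have h6 : 1/(m:ℝ) ≤ Real.exp 3 * (m:ℝ)^(-(1+1/L)) := by
            have e : (m:ℝ)^(-(1+1/L)) = 1/(m * (m:ℝ)^(1/L)) := by
              rw [Real.rpow_neg hm0.le, Real.rpow_add hm0, Real.rpow_one, ← one_div]
            have h7 : (m:ℝ)^(1/L) ≤ Real.exp 3 := by
              rw [Real.rpow_def_of_pos hm0, Real.exp_le_exp, mul_one_div, div_le_iff₀ hL0]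
              exact (Real.log_le_log hm0 hmN).trans hlogN
            rw [e, mul_one_div, div_le_div_iff₀ hm0 (by positivity), one_mul, mul_comm]
            exact mul_le_mul_of_nonneg_right h7 hm0.le
          calc ‖cc b D m‖^2 * (T / m * (1 + 4 * (harmonic N : ℝ) / V)) ≤
                ‖cc b D m‖^2 * (T / m * 17) := by gcongr
            _ = T * 17 * ‖cc b D m‖^2 * (1/m) := by ring
            _ ≤ T * 17 * ‖cc b D m‖^2 * (Real.exp 3 * (m:ℝ)^(-(1+1/L))) := by gcongr
            _ = _ := by ring
      _ = T * (17 * Real.exp 3) * ∑ m ∈ Finset.Ioc 0 N, (‖cc b D m‖^2 * (m:ℝ)^(-(1+1/L))) := by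
          rw [Finset.mul_sum]
      _ ≤ T * (17 * Real.exp 3) * (10 * Q) := by gcongr
      _ = _ := by ring
  have i4 : (T^2 - V) * (2 * (6 * Real.exp 1 * B / T)^2) ≤ 2 * (6 * Real.exp 1 * B)^2 * T := by
    calc (T^2 - V) * (2 * (6 * Real.exp 1 * B / T)^2) ≤ T^2 * (2 * (6 * Real.exp 1 * B / T)^2) := by
          gcongr; linarith
      _ = 2 * (6 * Real.exp 1 * B)^2 * 1 := by field_simp
      _ ≤ _ := by gcongr
  have i5 := i2.trans i3
  simp only [hM]
  linarith

end MZ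

namespace MZ

lemma exp_sub_one_lower (w : ℂ) (hre : 0 < w.re) (him : |w.im| ≤ 3*π/2) (hw : 1/2 ≤ ‖w‖) :
    1/4 ≤ ‖1 - Complex.exp w‖ := by
  rcases le_or_gt (1/4) w.re with h | h
  · have h1 := norm_sub_norm_le (Complex.exp w) 1
    rw [Complex.norm_exp, norm_one, norm_sub_rev] at h1
    have := Real.add_one_le_exp w.re
    linarith
  · have hn : ‖w‖^2 = w.re^2 + w.im^2 := by
      rw [← Complex.normSq_eq_norm_sq, Complex.normSq_apply]; ring
    have hb : 3/16 ≤ w.im^2 := by nlinarith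
    have hb' : 2/5 ≤ |w.im| := by
      by_contra hh; push Not at hh
      have : |w.im|^2 < (2/5)^2 := by
        apply pow_lt_pow_left₀ hh (abs_nonneg _) (by norm_num)
      rw [sq_abs] at this; linarith
    have he : 1 ≤ Real.exp w.re := Real.one_le_exp hre.le
    rcases le_or_gt |w.im| (π/2) with h2 | h2
    · have h3 := Complex.abs_im_le_norm (1 - Complex.exp w)
      have h4 : (1 - Complex.exp w).im = - (Real.exp w.re * Real.sin w.im) := by
        simp [Complex.exp_im]
      rw [h4, abs_neg, abs_mul, abs_of_pos (Real.exp_pos _)] at h3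
      have h5 := Real.mul_abs_le_abs_sin h2
      have h6 : 1/4 ≤ |Real.sin w.im| := by
        refine le_trans ?_ h5
        have : (5/8:ℝ) ≤ 2/π := by
          rw [le_div_iff₀ Real.pi_pos]; have := Real.pi_lt_d2; linarith
        nlinarith
      nlinarith [abs_nonneg (Real.sin w.im)]
    · have h3 := Complex.re_le_norm (1 - Complex.exp w)
      have h4 : (1 - Complex.exp w).re = 1 - Real.exp w.re * Real.cos w.im := by
        simp [Complex.exp_re]
      have h5 : Real.cos w.im ≤ 0 := by
        rw [← Real.cos_abs]
        apply Real.cos_nonpos_of_pi_div_two_le_of_le h2.le; linarith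
      nlinarith

lemma exp_near (w : ℂ) (hre : 0 < w.re) (him : |w.im| ≤ 3*π/2) :
    ‖(1 - Complex.exp w)⁻¹ + 1/w‖ ≤ 6 := by
  have hw0 : w ≠ 0 := by rintro rfl; simp at hre
  have hw0' : 0 < ‖w‖ := norm_pos_iff.2 hw0
  rcases le_or_gt (1/2) ‖w‖ with h | h
  · have h1 := exp_sub_one_lower w hre him h
    refine (norm_add_le _ _).trans ?_
    rw [norm_inv, norm_div, norm_one]
    have h2 : ‖1 - Complex.exp w‖⁻¹ ≤ (1/4)⁻¹ := inv_anti₀ (by norm_num) h1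
    have h3 : 1/‖w‖ ≤ 1/(1/2) := one_div_le_one_div_of_le (by norm_num) h
    norm_num at h2 h3 ⊢
    linarith
  · have h1 := Complex.norm_exp_sub_one_sub_id_le (x := w) (by linarith)
    have h2 : ‖w‖/2 ≤ ‖1 - Complex.exp w‖ := by
      have := norm_sub_norm_le w (-(Complex.exp w - 1 - w))
      rw [norm_neg, show w - -(Complex.exp w - 1 - w) = -(1 - Complex.exp w) by ring, norm_neg] at this
      nlinarith
    have h3 : (1 - Complex.exp w) ≠ 0 := by
      intro h; rw [h, norm_zero] at h2; linarith
    rw [show (1 - Complex.exp w)⁻¹ + 1/w = -(Complex.exp w - 1 - w)/(w * (1 - Complex.exp w)) by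
      field_simp; ring]
    rw [norm_div, norm_neg, norm_mul, div_le_iff₀ (by positivity)]
    nlinarith

lemma Ef_near (z : ℂ) (k : ℤ) (hre : 0 < z.re) (him : |z.im - π * (2*k+1)| ≤ 3*π/2) :
    ‖Ef z + 1/(z - ((π * (2*k+1) : ℝ) : ℂ) * Complex.I)‖ ≤ 6 := by
  have := exp_near (z - ((π * (2*k+1) : ℝ) : ℂ) * Complex.I) (by simpa using hre) (by simpa using him)
  have e : Complex.exp (z - ((π * (2*k+1) : ℝ) : ℂ) * Complex.I) = - Complex.exp z := by
    rw [Complex.exp_sub, show ((π * (2*k+1) : ℝ) : ℂ) * Complex.I = π * Complex.I + k * (2 * π * Complex.I) by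
      push_cast; ring, Complex.exp_add, Complex.exp_pi_mul_I, Complex.exp_int_mul_two_pi_mul_I]
    rw [mul_one, div_neg, div_one]
  rw [e, sub_neg_eq_add, add_comm 1] at this
  exact this

/-- rounding index -/
def kk (a : ℤ) (q d : ℕ) : ℤ := round ((d:ℝ) * a / q - 1/2)
def rr (a : ℤ) (q d : ℕ) : ℤ := 2 * d * a - q - 2 * q * kk a q d

lemma rr_real (a : ℤ) (q d : ℕ) (hq : 0 < q) :
    ((rr a q d : ℤ) : ℝ) = 2 * q * ((d:ℝ) * a / q - 1/2 - kk a q d) := by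
  have : (q:ℝ) ≠ 0 := by positivity
  simp only [rr]; push_cast; field_simp

lemma rr_abs (a : ℤ) (q d : ℕ) (hq : 0 < q) : |((rr a q d : ℤ) : ℝ)| ≤ q := by
  have hq' : (0:ℝ) < q := by positivity
  rw [rr_real a q d hq, abs_mul, abs_of_pos (by positivity)]
  have := abs_sub_round ((d:ℝ) * a / q - 1/2)
  simp only [kk]
  nlinarith

lemma far_sum (a : ℤ) (q D : ℕ) (hq : 0 < q) (hco : IsCoprime a (q:ℤ)) :
    ∑ d ∈ (Finset.Ioc 0 D).filter (fun d => rr a q d ≠ 0), (q:ℝ) / |((rr a q d : ℤ) : ℝ)|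
      ≤ 2 * (D + q) * (harmonic q : ℝ) := by
  set S := (Finset.Ioc 0 D).filter (fun d => rr a q d ≠ 0)
  let φ : ℕ → ℕ × ℕ × Bool := fun d => (d / q, (rr a q d).natAbs, decide (0 < rr a q d))
  have hinj : Set.InjOn φ S := by
    intro d _ d' _ h
    simp only [φ, Prod.mk.injEq] at h
    obtain ⟨h1, h2, h3⟩ := h
    have h4 : rr a q d = rr a q d' := by
      by_cases h5 : 0 < rr a q d
      · have : 0 < rr a q d' := by simpa [h5] using h3
        omega
      · have : ¬ 0 < rr a q d' := by simpa [h5] using h3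
        omega
    have h5 : (q:ℤ) ∣ ((d:ℤ) - d') * a := by
      refine ⟨kk a q d - kk a q d', ?_⟩
      simp only [rr] at h4
      linarith
    have h6 : (q:ℤ) ∣ (d:ℤ) - d' := hco.symm.dvd_of_dvd_mul_right h5
    obtain ⟨t, ht⟩ := h6
    have e1 := Nat.div_add_mod d q
    have e2 := Nat.div_add_mod d' q
    rw [h1] at e1
    have m1 := Nat.mod_lt d hq
    have m2 := Nat.mod_lt d' hq
    generalize q * (d' / q) = u at e1 e2
    generalize d % q = m at e1 m1
    generalize d' % q = m' at e2 m2
    have e3 : (m:ℤ) - m' = q * t := by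
      rw [← ht]; omega
    have hq1 : (0:ℤ) < q := by exact_mod_cast hq
    have m1' : (m:ℤ) < q := by exact_mod_cast m1
    have m2' : (m':ℤ) < q := by exact_mod_cast m2
    have : t = 0 := by
      by_contra h
      rcases lt_or_gt_of_ne h with h | h
      · nlinarith
      · nlinarith
    subst this; simp at ht; omega
  have hsub : S.image φ ⊆ Finset.range (D/q+1) ×ˢ (Finset.Ioc 0 q ×ˢ (Finset.univ : Finset Bool)) := by
    intro p hp
    simp only [Finset.mem_image] at hp
    obtain ⟨d, hd, rfl⟩ := hp
    simp only [S, Finset.mem_filter, Finset.mem_Ioc] at hd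
    simp only [φ, Finset.mem_product, Finset.mem_range, Finset.mem_Ioc, Finset.mem_univ, and_true]
    refine ⟨Nat.lt_succ_of_le (Nat.div_le_div_right hd.1.2), Int.natAbs_pos.2 hd.2, ?_⟩
    have := rr_abs a q d hq
    have h : |rr a q d| ≤ (q:ℤ) := by exact_mod_cast this
    rw [Int.abs_eq_natAbs] at h
    exact_mod_cast h
  calc ∑ d ∈ S, (q:ℝ) / |((rr a q d : ℤ) : ℝ)| = ∑ p ∈ S.image φ, (q:ℝ) / (p.2.1:ℝ) := by
        rw [Finset.sum_image hinj]
        apply Finset.sum_congr rfl; intro d _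
        simp only [φ]
        rw [Nat.cast_natAbs]; push_cast; rfl
    _ ≤ ∑ p ∈ Finset.range (D/q+1) ×ˢ (Finset.Ioc 0 q ×ˢ (Finset.univ : Finset Bool)), (q:ℝ) / (p.2.1:ℝ) :=
        Finset.sum_le_sum_of_subset_of_nonneg hsub (fun _ _ _ => by positivity)
    _ = (D/q+1 : ℕ) * (2 * (q * (harmonic q : ℝ))) := by
        rw [Finset.sum_product]; simp only [Finset.sum_const, Finset.card_range, nsmul_eq_mul]
        rw [Finset.sum_product]; simp only [Finset.sum_const, Finset.card_univ, Fintype.card_bool, nsmul_eq_mul]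
        rw [← harm_sum]
        simp only [Finset.mul_sum]
        apply Finset.sum_congr rfl; intro r _
        simp only [invR, ArithmeticFunction.coe_mk]; push_cast; field_simp
    _ ≤ _ := by
        have h1 : ((D/q : ℕ):ℝ) ≤ D/q := Nat.cast_div_le
        have hq' : (0:ℝ) < q := by positivity
        have h2 : ((D/q+1 : ℕ):ℝ) * q ≤ D + q := by
          push_cast
          have : ((D/q : ℕ):ℝ) * q ≤ D := by rwa [le_div_iff₀ hq'] at h1
          linarith
        have h0 : (0:ℝ) ≤ harmonic q := by rw [← harm_sum]; exact Finset.sum_nonneg (fun k _ => invR_nonneg k)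
        nlinarith

end MZ

namespace MZ

def AA (b : ℕ → ℂ) (D q : ℕ) : ℂ :=
  ∑ l ∈ (Finset.Ioc 0 (D/q)).filter (fun l => Nat.Coprime l 2), b (q*l) / ((q*l : ℕ) : ℂ)

lemma rr_odd (a : ℤ) (q d : ℕ) (hq : Odd q) : rr a q d ≠ 0 := by
  intro h
  simp only [rr] at h
  obtain ⟨m, hm⟩ := hq
  subst hm
  push_cast at h
  have : 2 * ((d:ℤ) * a - m - (2 * m + 1) * kk a (2*m+1) d) = 1 := by linarith
  omega

lemma rr_even (a : ℤ) (q d : ℕ) (hq : 0 < q) (hco : IsCoprime a ((2*q : ℕ):ℤ)) :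
    rr a (2*q) d = 0 ↔ q ∣ d ∧ Nat.Coprime (d/q) 2 := by
  have hco2 : IsCoprime a (q:ℤ) := by
    push_cast at hco; exact hco.of_mul_right_right
  have hao : IsCoprime a 2 := by
    push_cast at hco; exact hco.of_mul_right_left
  have hao' : a % 2 = 1 := by
    rcases Int.emod_two_eq_zero_or_one a with h | h
    · exfalso
      have h2 : (2:ℤ) ∣ a := Int.dvd_of_emod_eq_zero h
      have := hao.isUnit_of_dvd' h2 (dvd_refl _)
      rw [Int.isUnit_iff] at this; omega
    · exact h
  have hq0 : (q:ℤ) ≠ 0 := by exact_mod_cast hq.ne'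
  constructor
  · intro h
    simp only [rr] at h
    push_cast at h
    have h1 : (d:ℤ) * a = q * (1 + 2 * kk a (2*q) d) := by linarith
    have h2 : (q:ℤ) ∣ d := hco2.symm.dvd_of_dvd_mul_right ⟨_, h1⟩
    have h3 : q ∣ d := by exact_mod_cast h2
    refine ⟨h3, ?_⟩
    obtain ⟨l, rfl⟩ := h3
    rw [Nat.mul_div_cancel_left _ hq, Nat.coprime_two_right]
    push_cast at h1
    rw [mul_assoc] at h1
    have h4 := mul_left_cancel₀ hq0 h1
    have : (l:ℤ) % 2 = 1 := by
      rcases Int.emod_two_eq_zero_or_one l with h | h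
      · have := Int.mul_emod (l:ℤ) a 2
        rw [h, h4] at this; omega
      · exact h
    rw [Nat.odd_iff]; omega
  · rintro ⟨⟨l, rfl⟩, h2⟩
    rw [Nat.mul_div_cancel_left _ hq, Nat.coprime_two_right, Nat.odd_iff] at h2
    have h3 : ((l:ℤ) * a) % 2 = 1 := by
      rw [Int.mul_emod, hao']; omega
    obtain ⟨m, hm⟩ : ∃ m : ℤ, (l:ℤ) * a = 2 * m + 1 := ⟨(l:ℤ)*a/2, by omega⟩
    have hk : kk a (2*q) (q*l) = m := by
      have hq' : (q:ℝ) ≠ 0 := by positivity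
      have hmR : (l:ℝ) * a = 2 * m + 1 := by exact_mod_cast hm
      simp only [kk]
      rw [show (((q*l:ℕ):ℝ)) * a / ((2*q:ℕ):ℝ) - 1/2 = (m:ℝ) by
        push_cast; field_simp; linear_combination hmR]
      exact round_intCast m
    simp only [rr, hk]; push_cast
    linear_combination 2 * (q:ℤ) * hm

lemma dual_pt (b : ℕ → ℂ) (D : ℕ) (T v V B : ℝ) (hD : 0 < D) (hT : 0 < T) (hv : 0 < v) (hvV : v ≤ V)
    (hV : 1 ≤ V) (hB : 0 ≤ B) (hb : ∀ d ∈ Finset.Ioc 0 D, ‖b d‖ ≤ B) :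
    ‖GG b D T v‖^2 ≤ 2 * (∑ q ∈ Finset.Ioc 0 (2*D), ∑ a ∈ Finset.Ioc 0 ⌊2*q*V⌋₊,
        ‖AA b D q‖^2 / ‖om T * v - ((π * a / q : ℝ):ℂ) * Complex.I‖^2)
      + 2 * (B * (6 * D + 10 * D * (harmonic (4*D) : ℝ)))^2 := by
  obtain ⟨x, hx, hxd⟩ := Real.exists_rat_abs_sub_le_and_den_le (v/(2*π)) (n := 4*D) (by omega)
  set q := x.den with hqdef
  set a := x.num with hadef
  have hq : 0 < q := x.den_pos
  have hqR : (0:ℝ) < q := by exact_mod_cast hq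
  have hco : IsCoprime a (q:ℤ) := by
    rw [Int.isCoprime_iff_gcd_eq_one, Int.gcd_eq_natAbs]
    simpa using x.reduced
  have hxe : (x:ℝ) = a / q := by
    rw [hadef, hqdef]; exact_mod_cast (Rat.num_div_den x).symm
  rw [hxe] at hx
  have hπ := Real.pi_pos
  set X := v/(2*π) with hX
  have hvX : v = 2*π*X := by rw [hX]; field_simp
  have happ : ∀ d ∈ Finset.Ioc 0 D, |(d:ℝ)*X - d*a/q| ≤ 1/(4*q) := by
    intro d hd
    simp only [Finset.mem_Ioc] at hd
    have hdD : (d:ℝ) ≤ D := by exact_mod_cast hd.2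
    rw [show (d:ℝ)*X - d*a/q = d * (X - a/q) by ring, abs_mul, Nat.abs_cast]
    calc (d:ℝ) * |X - a/q| ≤ D * (1/(((4*D:ℕ):ℝ)+1)/q) := by
          refine mul_le_mul hdD (hx.trans (le_of_eq ?_)) (abs_nonneg _) (by positivity)
          rw [div_div]
      _ ≤ 1/(4*q) := by
          push_cast
          rw [div_div, mul_one_div, div_le_div_iff₀ (by positivity) (by positivity)]
          nlinarith
  set k := kk a q with hk
  set w : ℕ → ℂ := fun d => d * om T * v - ((π * (2*(k d)+1) : ℝ) : ℂ) * Complex.I with hw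
  have hzre : ∀ d : ℕ, ((d:ℂ) * om T * v).re = d * (1/T) * v := by
    intro d; simp [om]
  have hzim : ∀ d : ℕ, ((d:ℂ) * om T * v).im = d * v := by
    intro d; simp [om]
  have hwim : ∀ d, (w d).im = 2*π*(d * X - 1/2 - k d) := by
    intro d
    simp only [hw, Complex.sub_im, hzim]
    simp; rw [hvX]; ring
  have hrk : ∀ d : ℕ, (d:ℝ) * a / q - 1/2 - k d = (rr a q d : ℝ) / (2*q) := by
    intro d; rw [rr_real a q d hq, hk]; field_simp
  have h1 : ∀ d ∈ Finset.Ioc 0 D, ‖Ef (d * om T * v) + 1/ w d‖ ≤ 6 := by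
    intro d hd
    have hd0 : (0:ℝ) < d := by simp only [Finset.mem_Ioc] at hd; exact_mod_cast hd.1
    apply Ef_near
    · rw [hzre]; positivity
    · have := hwim d
      simp only [hw, Complex.sub_im, hzim] at this
      have e : ((d:ℂ) * om T * v).im - π * (2*(k d : ℝ)+1) = 2*π*(d * X - 1/2 - k d) := by
        rw [hzim, hvX]; ring
      rw [e, abs_mul, abs_of_pos (by positivity)]
      have h2 := happ d hd
      have h3 : |(d:ℝ) * a / q - 1/2 - k d| ≤ 1/2 := abs_sub_round _
      have h4 : 1/(4*(q:ℝ)) ≤ 1/4 := by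
        apply one_div_le_one_div_of_le (by norm_num)
        have : (1:ℝ) ≤ q := by exact_mod_cast hq
        linarith
      have h5 : |(d:ℝ) * X - 1/2 - k d| ≤ 3/4 := by
        rw [abs_le] at *; constructor <;> linarith
      nlinarith
  have h2 : ∀ d ∈ Finset.Ioc 0 D, rr a q d ≠ 0 → ‖1 / w d‖ ≤ q / |(rr a q d : ℝ)| := by
    intro d hd hr
    have hr1 : (1:ℝ) ≤ |(rr a q d : ℝ)| := by exact_mod_cast Int.one_le_abs hr
    rw [norm_div, norm_one]
    have h6 : |(rr a q d : ℝ)| / q ≤ ‖w d‖ := by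
      refine le_trans ?_ (Complex.abs_im_le_norm _)
      rw [hwim, abs_mul, abs_of_pos (show 0 < 2*π by positivity)]
      have h3 := happ d hd
      have h4 := hrk d
      have h5 : |(rr a q d : ℝ)| / (2*q) - 1/(4*q) ≤ |(d:ℝ) * X - 1/2 - k d| := by
        have : |(rr a q d : ℝ)| / (2*q) = |(d:ℝ) * a / q - 1/2 - k d| := by
          rw [h4, abs_div, abs_of_pos (show (0:ℝ) < 2*q by positivity)]
        rw [this]
        have e := abs_sub_abs_le_abs_sub ((d:ℝ) * a / q - 1/2 - k d) ((d:ℝ) * X - 1/2 - k d)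
        rw [show ((d:ℝ) * a / q - 1/2 - k d) - ((d:ℝ) * X - 1/2 - k d) = -((d:ℝ)*X - d*a/q) by ring, abs_neg] at e
        linarith
      have h7 : |(rr a q d : ℝ)| / (4*q) ≤ |(rr a q d : ℝ)| / (2*q) - 1/(4*q) := by
        have : |(rr a q d : ℝ)| / (2*q) = 2 * |(rr a q d : ℝ)| / (4*q) := by field_simp; norm_num
        rw [this, ← sub_div]
        apply div_le_div_of_nonneg_right _ (by positivity)
        linarith
      have hπ3 := Real.pi_gt_three
      calc |(rr a q d : ℝ)| / q = 4 * (|(rr a q d : ℝ)| / (4*q)) := by field_simp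
        _ ≤ 2*π * (|(rr a q d : ℝ)| / (4*q)) :=
            mul_le_mul_of_nonneg_right (by linarith) (by positivity)
        _ ≤ _ := mul_le_mul_of_nonneg_left (h7.trans h5) (by positivity)
    calc 1/‖w d‖ ≤ 1/(|(rr a q d : ℝ)| / q) := one_div_le_one_div_of_le (by positivity) h6
      _ = _ := by rw [one_div_div]
  set near := ∑ d ∈ (Finset.Ioc 0 D).filter (fun d => rr a q d = 0), b d * (1/w d) with hnear
  have hfar : ‖GG b D T v + near‖ ≤ B * (6 * D + 10 * D * (harmonic (4*D) : ℝ)) := by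
    have e : GG b D T v + near = ∑ d ∈ Finset.Ioc 0 D, b d * (Ef (d * om T * v) + 1/w d)
        - ∑ d ∈ (Finset.Ioc 0 D).filter (fun d => rr a q d ≠ 0), b d * (1/w d) := by
      have := Finset.sum_filter_add_sum_filter_not (Finset.Ioc 0 D) (fun d => rr a q d = 0)
        (fun d => b d * (1/w d))
      simp only [mul_add, Finset.sum_add_distrib]
      rw [← this, GG]
      ring
    rw [e]
    have hh : (harmonic q : ℝ) ≤ harmonic (4*D) := by
      rw [← harm_sum, ← harm_sum]
      apply Finset.sum_le_sum_of_subset_of_nonneg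
      · exact Finset.Ioc_subset_Ioc_right hxd
      · intro i _ _; exact invR_nonneg i
    have hh0 : (0:ℝ) ≤ harmonic q := by
      rw [← harm_sum]; exact Finset.sum_nonneg (fun k _ => invR_nonneg k)
    calc _ ≤ ∑ d ∈ Finset.Ioc 0 D, B * 6 + ∑ d ∈ (Finset.Ioc 0 D).filter (fun d => rr a q d ≠ 0),
            B * (q / |(rr a q d : ℝ)|) := by
          refine (norm_sub_le _ _).trans (add_le_add ?_ ?_)
          · refine norm_sum_le_of_le _ (fun d hd => ?_)
            rw [norm_mul]; exact mul_le_mul (hb d hd) (h1 d hd) (norm_nonneg _) hB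
          · refine norm_sum_le_of_le _ (fun d hd => ?_)
            rw [Finset.mem_filter] at hd
            rw [norm_mul]; exact mul_le_mul (hb d hd.1) (h2 d hd.1 hd.2) (norm_nonneg _) hB
      _ ≤ D * (B * 6) + B * (2 * (D + q) * (harmonic q : ℝ)) := by
          have := far_sum a q D hq hco
          rw [Finset.sum_const, Nat.card_Ioc, tsub_zero, nsmul_eq_mul, ← Finset.mul_sum]
          exact add_le_add le_rfl (mul_le_mul_of_nonneg_left this hB)
      _ ≤ _ := by
          have hq4 : (q:ℝ) ≤ 4 * D := by exact_mod_cast hxd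
          have : 2 * (D + q) * (harmonic q : ℝ) ≤ 10 * D * (harmonic (4*D) : ℝ) := by
            apply mul_le_mul _ hh hh0 (by positivity)
            linarith
          nlinarith
  have hn : ‖near‖^2 ≤ ∑ q ∈ Finset.Ioc 0 (2*D), ∑ a ∈ Finset.Ioc 0 ⌊2*q*V⌋₊,
        ‖AA b D q‖^2 / ‖om T * v - ((π * a / q : ℝ):ℂ) * Complex.I‖^2 := by
    rcases Nat.even_or_odd q with hqe | hqo
    · obtain ⟨p, hp⟩ := hqe
      have hp2 : q = 2 * p := by omega
      have hp0 : 0 < p := by omega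
      have hpR : (0:ℝ) < p := by exact_mod_cast hp0
      rw [hp2] at hco
      have hch := fun d => rr_even a p d hp0 hco
      have hne : near = AA b D p * (1/(om T * v - ((π * a / p : ℝ):ℂ) * Complex.I)) := by
        rw [hnear, hp2]
        simp only [hch]
        rw [← Finset.filter_filter, Finset.sum_filter, sum_multiples _ _ hp0, AA, Finset.sum_mul,
          Finset.sum_filter]
        apply Finset.sum_congr rfl
        intro l hl
        rw [Nat.mul_div_cancel_left _ hp0]
        split_ifs with hl2
        · have hl0 : 0 < l := by simp only [Finset.mem_Ioc] at hl; exact hl.1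
          have hr0 : rr a q (p*l) = 0 := by
            rw [hp2, hch]; exact ⟨Dvd.intro _ rfl, by rwa [Nat.mul_div_cancel_left _ hp0]⟩
          have hwv : w (p*l) = ((p*l:ℕ):ℂ) * (om T * v - ((π * a / p : ℝ):ℂ) * Complex.I) := by
            have h5 := hrk (p*l)
            rw [hr0, hp2] at h5
            have h6 : (2*(k (p*l) : ℝ)+1) = l * a := by
              push_cast at h5
              rw [zero_div, show (p:ℝ) * l * a / (2 * p) = l * a / 2 by field_simp] at h5
              linarith
            simp only [hw]
            rw [h6]; push_cast
            have : (p:ℂ) ≠ 0 := by exact_mod_cast hp0.ne'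
            field_simp
          rw [hwv, ← one_div_mul_one_div]; ring
        · rfl
      have haR : (0:ℝ) < a := by
        have ha1 : -1 < (a:ℝ) := by
          have hX0 : 0 < X := by rw [hX]; positivity
          have h5 : X - a/q < 1/q := by
            refine lt_of_le_of_lt ((le_abs_self _).trans hx) ?_
            apply one_div_lt_one_div_of_lt hqR
            have : (0:ℝ) < D := by exact_mod_cast hD
            push_cast; nlinarith
          have : -1/(q:ℝ) < a/q := by rw [neg_div]; linarith
          exact (div_lt_div_iff_of_pos_right hqR).1 this
        have ha2 : a ≠ 0 := by
          intro h
          rw [h] at hco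
          have := isCoprime_zero_left.1 hco
          rw [Int.isUnit_iff] at this; omega
        have ha3 : -1 < a := by exact_mod_cast ha1
        have : 0 < a := by omega
        exact_mod_cast this
      have haV : (a:ℝ) ≤ 2 * p * V := by
        have h5 : a/q - X ≤ 1/q := by
          refine le_trans ((neg_le_abs _).trans' (by linarith)) (hx.trans ?_)
          apply one_div_le_one_div_of_le hqR
          have : (0:ℝ) < D := by exact_mod_cast hD
          push_cast; nlinarith
        have hXV : X ≤ V/2 := by
          rw [hX, div_le_div_iff₀ (by positivity) (by norm_num)]
          have := Real.pi_gt_three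
          nlinarith
        have h6 : (a:ℝ)/q ≤ V/2 + 1/q := by linarith
        rw [div_le_iff₀ hqR] at h6
        have h7 : (V/2 + 1/(q:ℝ))*q = V/2*q+1 := by field_simp
        rw [h7, hp2] at h6
        push_cast at h6
        have : (1:ℝ) ≤ p := by exact_mod_cast hp0
        nlinarith
      obtain ⟨m, hm⟩ : ∃ m : ℕ, a = m := ⟨a.toNat, by
        have : 0 < a := by exact_mod_cast haR
        omega⟩
      rw [hm] at haR haV hne
      push_cast at haR haV
      have hmem1 : p ∈ Finset.Ioc 0 (2*D) := by
        rw [Finset.mem_Ioc]; omega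
      have hmem2 : m ∈ Finset.Ioc 0 ⌊2*(p:ℝ)*V⌋₊ := by
        rw [Finset.mem_Ioc]
        exact ⟨by exact_mod_cast haR, Nat.le_floor haV⟩
      calc ‖near‖^2 = ‖AA b D p‖^2 / ‖om T * v - ((π * m / p : ℝ):ℂ) * Complex.I‖^2 := by
            rw [hne, norm_mul, norm_div, norm_one, mul_pow, div_pow, one_pow, mul_one_div]
            push_cast; rfl
        _ ≤ ∑ a ∈ Finset.Ioc 0 ⌊2*(p:ℝ)*V⌋₊,
              ‖AA b D p‖^2 / ‖om T * v - ((π * a / p : ℝ):ℂ) * Complex.I‖^2 :=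
            Finset.single_le_sum (f := fun a : ℕ => ‖AA b D p‖^2 / ‖om T * v - ((π * a / p : ℝ):ℂ) * Complex.I‖^2)
              (fun _ _ => by positivity) hmem2
        _ ≤ _ := Finset.single_le_sum (f := fun q : ℕ => ∑ a ∈ Finset.Ioc 0 ⌊2*(q:ℝ)*V⌋₊,
              ‖AA b D q‖^2 / ‖om T * v - ((π * a / q : ℝ):ℂ) * Complex.I‖^2)
              (fun _ _ => Finset.sum_nonneg (fun _ _ => by positivity)) hmem1
    · have : near = 0 := by
        rw [hnear]
        apply Finset.sum_eq_zero
        intro d hd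
        rw [Finset.mem_filter] at hd
        exact absurd hd.2 (rr_odd a q d hqo)
      rw [this]; simp only [norm_zero]
      rw [zero_pow (by norm_num)]
      exact Finset.sum_nonneg (fun _ _ => Finset.sum_nonneg (fun _ _ => by positivity))
  have h3 : ‖GG b D T v‖ ≤ ‖near‖ + ‖GG b D T v + near‖ := by
    have := norm_sub_le (GG b D T v + near) near
    rw [add_sub_cancel_right] at this; linarith
  have h4 : ‖GG b D T v‖^2 ≤ (‖near‖ + ‖GG b D T v + near‖)^2 := pow_le_pow_left₀ (norm_nonneg _) h3 2
  have h5 := pow_le_pow_left₀ (norm_nonneg _) hfar 2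
  nlinarith [sq_nonneg (‖near‖ - ‖GG b D T v + near‖)]

end MZ

namespace MZ

lemma ker_norm (T v μ : ℝ) : ‖om T * v - (μ:ℂ) * Complex.I‖^2 = (v/T)^2 + (v-μ)^2 := by
  rw [← Complex.normSq_eq_norm_sq, Complex.normSq_apply]
  simp [om]; ring

lemma ker_int (T μ α β : ℝ) (hT : 1 ≤ T) (hμ : 0 < μ) (hα : 0 < α) (hαβ : α ≤ β) :
    IntervalIntegrable (fun v : ℝ => 1/‖om T * v - (μ:ℂ) * Complex.I‖^2) volume α β ∧
    ∫ v in α..β, 1/‖om T * v - (μ:ℂ) * Complex.I‖^2 ≤ 2*π*T/μ := by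
  have hT0 : 0 < T := by linarith
  simp only [ker_norm]
  set e : ℝ := (1/T)^2 with he
  have he0 : 0 < e := by positivity
  have he1 : e ≤ 1 := by
    rw [he]; apply pow_le_one₀ (by positivity)
    rw [div_le_one hT0]; exact hT
  set m := μ/(1+e) with hm
  have hμm : μ = m*(1+e) := by rw [hm]; field_simp
  set s := μ/(2*T) with hs
  have hs0 : 0 < s := by positivity
  have hs2 : s^2 = μ^2*e/4 := by rw [hs, he]; field_simp; norm_num
  have hlow : ∀ v : ℝ, (v-m)^2 + s^2 ≤ (v/T)^2 + (v-μ)^2 := by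
    intro v
    have h1 : (v/T)^2 = e * v^2 := by rw [he]; field_simp
    rw [h1, hs2, hμm]
    have h2 : 0 ≤ e*(v-m)^2 + m^2*(e*(1+e)*(1-(1+e)/4)) := by
      have : 0 ≤ 1-(1+e)/4 := by linarith
      positivity
    nlinarith
  have hpos : ∀ v : ℝ, 0 < (v-m)^2 + s^2 := fun v => by positivity
  have hc1 : Continuous fun v : ℝ => 1/((v/T)^2 + (v-μ)^2) := by
    apply Continuous.div continuous_const (by fun_prop)
    intro v; exact ((hpos v).trans_le (hlow v)).ne'
  have hc2 : Continuous fun v : ℝ => 1/((v-m)^2 + s^2) := by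
    apply Continuous.div continuous_const (by fun_prop)
    intro v; exact (hpos v).ne'
  refine ⟨hc1.intervalIntegrable _ _, ?_⟩
  calc ∫ v in α..β, 1/((v/T)^2 + (v-μ)^2) ≤ ∫ v in α..β, 1/((v-m)^2 + s^2) := by
        apply intervalIntegral.integral_mono_on hαβ (hc1.intervalIntegrable _ _) (hc2.intervalIntegrable _ _)
        intro v _
        exact one_div_le_one_div_of_le (hpos v) (hlow v)
    _ = Real.arctan ((β-m)/s)/s - Real.arctan ((α-m)/s)/s := by
        apply intervalIntegral.integral_eq_sub_of_hasDerivAt (f := fun v => Real.arctan ((v-m)/s)/s)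
        · intro v _
          have h := ((((hasDerivAt_id v).sub_const m).div_const s).arctan).div_const s
          refine HasDerivAt.congr_deriv h ?_
          have := (hpos v).ne'
          simp only [id]
          have h3 : 1 + ((v-m)/s)^2 = ((v-m)^2+s^2)/s^2 := by field_simp; ring
          rw [h3]; field_simp
        · exact hc2.intervalIntegrable _ _
    _ ≤ π/s := by
        rw [← sub_div]
        apply div_le_div_of_nonneg_right _ hs0.le
        have := Real.arctan_lt_pi_div_two ((β-m)/s)
        have := Real.neg_pi_div_two_lt_arctan ((α-m)/s)
        linarith
    _ = _ := by rw [hs]; field_simp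

set_option maxHeartbeats 1000000 in
lemma dual_bound (P : Polynomial ℝ) (hP : P.eval 0 = 0) (κ : ℝ) (hκ : 0 ≤ κ) : ∃ C : ℝ, 0 < C ∧
    ∀ (T y V : ℝ) (c : ℂ), 1 ≤ T → 0 < y → 1 ≤ Real.log y → 1 ≤ V → Real.log V ≤ κ * Real.log y →
      ‖c‖ ≤ κ / Real.log y → c.re = 0 → V * y^2 * (1 + Real.log y)^2 ≤ T →
      ∫ v in (1/T)..V, ‖GG (cf y P c) ⌊y⌋₊ T v‖^2 ≤ C * T := by
  obtain ⟨S, hS, hSb⟩ := S_bound P hP κ hκ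
  obtain ⟨B, hB, hcf⟩ := cf_bound P
  refine ⟨2 * (2 * (4+κ) * (4 * S^2) * (Real.exp 12 * 3)) + 2592 * B^2, by positivity, ?_⟩
  intro T y V c hT hy0 hΛ hV hVl hc hc0 hVT
  set Λ := Real.log y with hΛdef
  have hT0 : 0 < T := by linarith
  have hy1 : 1 < y := by
    by_contra h; push Not at h
    have := Real.log_nonpos hy0.le h
    linarith
  set b := cf y P c with hbdef
  set D := ⌊y⌋₊ with hDdef
  have hD : 0 < D := Nat.floor_pos.2 hy1.le
  have hDR : (0:ℝ) < D := by exact_mod_cast hD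
  have hDy : (D:ℝ) ≤ y := Nat.floor_le hy0.le
  have h1TV : 1/T ≤ V := by
    refine le_trans ?_ hV
    rw [div_le_one hT0]; exact hT
  have h1T : 0 < 1/T := by positivity
  have hlog2 := Real.log_two_lt_d9
  have hlog4 : Real.log 4 ≤ 2 := by
    rw [show (4:ℝ) = 2^2 by norm_num, Real.log_pow]; push_cast; linarith
  set K : ℕ → ℕ → ℝ → ℝ := fun q a v => 1/‖om T * v - ((π * a / q : ℝ):ℂ) * Complex.I‖^2 with hK
  set R := B * (6 * D + 10 * D * (harmonic (4*D) : ℝ)) with hR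
  have hKi : ∀ q a : ℕ, 0 < q → 0 < a → IntervalIntegrable (K q a) volume (1/T) V ∧
      ∫ v in (1/T)..V, K q a v ≤ 2 * T * q * (1/a) := by
    intro q a hq ha
    have hq' : (0:ℝ) < q := by exact_mod_cast hq
    have ha' : (0:ℝ) < a := by exact_mod_cast ha
    have hp := Real.pi_pos
    have := ker_int T (π * a / q) (1/T) V hT (by positivity) h1T h1TV
    refine ⟨this.1, this.2.trans (le_of_eq ?_)⟩
    field_simp
  have hpt : ∀ v ∈ Set.Icc (1/T) V, ‖GG b D T v‖^2 ≤ 2 * (∑ q ∈ Finset.Ioc 0 (2*D),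
      ∑ a ∈ Finset.Ioc 0 ⌊2*q*V⌋₊, ‖AA b D q‖^2 * K q a v) + 2 * R^2 := by
    intro v hv
    have := dual_pt b D T v V B hD hT0 (lt_of_lt_of_le h1T hv.1) hv.2 hV hB.le
      (fun d hd => hcf y c d hy1 hc0 hd)
    simp only [hK, mul_one_div]
    exact this
  have ii : ∀ q ∈ Finset.Ioc 0 (2*D), ∀ a ∈ Finset.Ioc 0 ⌊2*(q:ℝ)*V⌋₊,
      IntervalIntegrable (fun v => ‖AA b D q‖^2 * K q a v) volume (1/T) V := by
    intro q hq a ha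
    exact (hKi q a (Finset.mem_Ioc.1 hq).1 (Finset.mem_Ioc.1 ha).1).1.const_mul _
  have ii2 : ∀ q ∈ Finset.Ioc 0 (2*D), IntervalIntegrable (fun v => ∑ a ∈ Finset.Ioc 0 ⌊2*(q:ℝ)*V⌋₊,
      ‖AA b D q‖^2 * K q a v) volume (1/T) V := by
    intro q hq
    have e : (fun v => ∑ a ∈ Finset.Ioc 0 ⌊2*(q:ℝ)*V⌋₊, ‖AA b D q‖^2 * K q a v) =
        ∑ a ∈ Finset.Ioc 0 ⌊2*(q:ℝ)*V⌋₊, (fun v => ‖AA b D q‖^2 * K q a v) := by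
      funext v; rw [Finset.sum_apply]
    rw [e]
    exact IntervalIntegrable.sum _ (ii q hq)
  have ii3 : IntervalIntegrable (fun v => ∑ q ∈ Finset.Ioc 0 (2*D), ∑ a ∈ Finset.Ioc 0 ⌊2*(q:ℝ)*V⌋₊,
      ‖AA b D q‖^2 * K q a v) volume (1/T) V := by
    have e : (fun v => ∑ q ∈ Finset.Ioc 0 (2*D), ∑ a ∈ Finset.Ioc 0 ⌊2*(q:ℝ)*V⌋₊, ‖AA b D q‖^2 * K q a v) =
        ∑ q ∈ Finset.Ioc 0 (2*D), (fun v => ∑ a ∈ Finset.Ioc 0 ⌊2*(q:ℝ)*V⌋₊, ‖AA b D q‖^2 * K q a v) := by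
      funext v; rw [Finset.sum_apply]
    rw [e]
    exact IntervalIntegrable.sum _ ii2
  have i1 : ∫ v in (1/T)..V, ‖GG b D T v‖^2 ≤ ∫ v in (1/T)..V, (2 * (∑ q ∈ Finset.Ioc 0 (2*D),
      ∑ a ∈ Finset.Ioc 0 ⌊2*(q:ℝ)*V⌋₊, ‖AA b D q‖^2 * K q a v) + 2 * R^2) := by
    apply intervalIntegral.integral_mono_on h1TV _ _ hpt
    · apply ContinuousOn.intervalIntegrable
      rw [Set.uIcc_of_le h1TV]
      apply ContinuousOn.pow
      apply ContinuousOn.norm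
      apply (GG_cont b D T hT0).mono
      intro v hv; exact lt_of_lt_of_le h1T hv.1
    · exact (ii3.const_mul 2).add (continuous_const.intervalIntegrable _ _)
  refine i1.trans ?_
  rw [intervalIntegral.integral_add (ii3.const_mul 2) (continuous_const.intervalIntegrable _ _),
    intervalIntegral.integral_const_mul, intervalIntegral.integral_const, smul_eq_mul,
    intervalIntegral.integral_finsetSum ii2]
  have i2 : ∀ q ∈ Finset.Ioc 0 (2*D), ∫ v in (1/T)..V, ∑ a ∈ Finset.Ioc 0 ⌊2*(q:ℝ)*V⌋₊, ‖AA b D q‖^2 * K q a v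
      ≤ T * (2 * (4+κ) * (4 * S^2)) / Λ * (KK q^2 / q) := by
    intro q hq
    rw [intervalIntegral.integral_finsetSum (ii q hq)]
    have hq0 := (Finset.mem_Ioc.1 hq).1
    have hqD := (Finset.mem_Ioc.1 hq).2
    have hq' : (0:ℝ) < q := by exact_mod_cast hq0
    have hqD' : (q:ℝ) ≤ 2 * D := by exact_mod_cast hqD
    have hA : ‖AA b D q‖ ≤ 2 * S * KK q / (q * Λ) := by
      have h := hSb y c q 2 hq0.ne' (by norm_num) hy1 hc
      rw [Nat.floor_div_natCast] at h
      refine h.trans ?_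
      apply div_le_div_of_nonneg_right _ (by positivity)
      have := KK_two q hq0.ne'
      nlinarith
    have hh : (harmonic ⌊2*(q:ℝ)*V⌋₊ : ℝ) ≤ (4+κ) * Λ := by
      refine (harm_le _).trans ?_
      have h1 : ((⌊2*(q:ℝ)*V⌋₊ : ℕ):ℝ) ≤ 4 * y * V := by
        refine (Nat.floor_le (by positivity)).trans ?_
        exact mul_le_mul_of_nonneg_right (by linarith) (by linarith)
      have h2 : Real.log ((⌊2*(q:ℝ)*V⌋₊ : ℕ):ℝ) ≤ Real.log (4 * y * V) := by
        rcases Nat.eq_zero_or_pos ⌊2*(q:ℝ)*V⌋₊ with h | h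
        · rw [h]; simp only [Nat.cast_zero, Real.log_zero]
          apply Real.log_nonneg; nlinarith
        · exact Real.log_le_log (by exact_mod_cast h) h1
      rw [Real.log_mul (by positivity) (by positivity), Real.log_mul (by norm_num) (by positivity)] at h2
      nlinarith
    calc ∑ a ∈ Finset.Ioc 0 ⌊2*(q:ℝ)*V⌋₊, ∫ v in (1/T)..V, ‖AA b D q‖^2 * K q a v
        ≤ ∑ a ∈ Finset.Ioc 0 ⌊2*(q:ℝ)*V⌋₊, ‖AA b D q‖^2 * (2 * T * q) * invR a := by
          apply Finset.sum_le_sum; intro a ha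
          rw [intervalIntegral.integral_const_mul, mul_assoc]
          apply mul_le_mul_of_nonneg_left _ (by positivity)
          refine (hKi q a hq0 (Finset.mem_Ioc.1 ha).1).2.trans (le_of_eq ?_)
          simp only [invR, ArithmeticFunction.coe_mk, one_div]
      _ = ‖AA b D q‖^2 * (2 * T * q) * (harmonic ⌊2*(q:ℝ)*V⌋₊ : ℝ) := by
          rw [← Finset.mul_sum, harm_sum]
      _ ≤ (2 * S * KK q / (q * Λ))^2 * (2 * T * q) * ((4+κ) * Λ) := by
          have h0 : (0:ℝ) ≤ harmonic ⌊2*(q:ℝ)*V⌋₊ := by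
            rw [← harm_sum]; exact Finset.sum_nonneg (fun k _ => invR_nonneg k)
          gcongr
      _ = _ := by field_simp; ring
  have i3 := (Finset.sum_le_sum i2)
  rw [← Finset.mul_sum] at i3
  have i4 := sum_KK (2*D)
  have hlD : 1 + Real.log ((2*D:ℕ):ℝ) ≤ 3 * Λ := by
    push_cast
    rw [Real.log_mul (by norm_num) (by positivity)]
    have := Real.log_le_log hDR hDy
    linarith
  have i5 : T * (2 * (4+κ) * (4 * S^2)) / Λ * ∑ q ∈ Finset.Ioc 0 (2*D), KK q^2/q ≤
      T * (2 * (4+κ) * (4 * S^2) * (Real.exp 12 * 3)) := by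
    calc _ ≤ T * (2 * (4+κ) * (4 * S^2)) / Λ * (Real.exp 12 * (3*Λ)) := by
          apply mul_le_mul_of_nonneg_left _ (by positivity)
          exact i4.trans (mul_le_mul_of_nonneg_left hlD (by positivity))
      _ = _ := by field_simp
  have hRb : R ≤ 36 * B * (y * (1+Λ)) := by
    have hH : (harmonic (4*D) : ℝ) ≤ 3 * (1+Λ) := by
      refine (harm_le _).trans ?_
      push_cast
      rw [Real.log_mul (by norm_num) (by positivity)]
      have := Real.log_le_log hDR hDy
      linarith
    have : 6 * (D:ℝ) + 10 * D * (harmonic (4*D) : ℝ) ≤ 36 * (y*(1+Λ)) := by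
      have h1 : (D:ℝ) * (harmonic (4*D) : ℝ) ≤ D * (3*(1+Λ)) := mul_le_mul_of_nonneg_left hH hDR.le
      have h2 : (D:ℝ) * (3*(1+Λ)) ≤ y * (3*(1+Λ)) := mul_le_mul_of_nonneg_right hDy (by linarith)
      nlinarith
    rw [hR]; nlinarith
  have hR0 : 0 ≤ R := by
    have h0 : (0:ℝ) ≤ harmonic (4*D) := by
      rw [← harm_sum]; exact Finset.sum_nonneg (fun k _ => invR_nonneg k)
    rw [hR]; positivity
  have i6 : (V - 1/T) * (2 * R^2) ≤ 2592 * B^2 * T := by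
    calc (V - 1/T) * (2 * R^2) ≤ V * (2 * (36 * B * (y * (1+Λ)))^2) := by
          have := pow_le_pow_left₀ hR0 hRb 2
          gcongr
          · linarith
      _ = 2592 * B^2 * (V * y^2 * (1+Λ)^2) := by ring
      _ ≤ _ := by gcongr
  nlinarith

end MZ

namespace MZ

lemma Ef_small (z : ℂ) (hz : ‖z‖ ≤ 1/2) : ‖Ef z‖ ≤ 1 := by
  unfold Ef
  have h1 : ‖Complex.exp z - 1‖ ≤ 2 * ‖z‖ := Complex.norm_exp_sub_one_le (by linarith)
  have h2 : 1 ≤ ‖Complex.exp z + 1‖ := by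
    have := norm_sub_norm_le (2:ℂ) (-(Complex.exp z - 1))
    rw [show (2:ℂ) - -(Complex.exp z - 1) = Complex.exp z + 1 by ring, norm_neg] at this
    norm_num at this
    linarith
  rw [norm_inv]
  exact inv_le_one_of_one_le₀ h2

lemma GG_small (b : ℕ → ℂ) (D : ℕ) (T v B y : ℝ) (hT : 1 ≤ T) (hv : 0 < v) (hvT : v ≤ 1/T)
    (hDy : (D:ℝ) ≤ y) (hyT : 4 * y ≤ T) (hB : 0 ≤ B) (hb : ∀ d ∈ Finset.Ioc 0 D, ‖b d‖ ≤ B) :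
    ‖GG b D T v‖ ≤ B * y := by
  have hT0 : 0 < T := by linarith
  have : ‖GG b D T v‖ ≤ ∑ d ∈ Finset.Ioc 0 D, B * 1 := by
    refine norm_sum_le_of_le _ (fun d hd => ?_)
    rw [norm_mul]
    refine mul_le_mul (hb d hd) (Ef_small _ ?_) (norm_nonneg _) hB
    have hdD : (d:ℝ) ≤ D := by exact_mod_cast (Finset.mem_Ioc.1 hd).2
    have hom : ‖om T‖ ≤ 2 := by
      refine (norm_add_le _ _).trans ?_
      rw [Complex.norm_I, Complex.norm_real, Real.norm_of_nonneg (by positivity)]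
      have : 1/T ≤ 1 := by rw [div_le_one hT0]; exact hT
      linarith
    rw [norm_mul, norm_mul, Complex.norm_natCast, Complex.norm_real, Real.norm_of_nonneg hv.le]
    calc (d:ℝ) * ‖om T‖ * v ≤ y * 2 * (1/T) := by
          have : 0 ≤ y := le_trans (by positivity) hDy
          gcongr; linarith
      _ ≤ 1/2 := by rw [mul_one_div, div_le_div_iff₀ hT0 (by norm_num)]; linarith
  refine this.trans ?_
  rw [Finset.sum_const, Nat.card_Ioc, tsub_zero, nsmul_eq_mul]
  nlinarith

lemma GG_large (b : ℕ → ℂ) (D : ℕ) (T v B y : ℝ) (hT : 1 ≤ T) (hvT : T ≤ v)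
    (hDy : (D:ℝ) ≤ y) (hB : 0 ≤ B) (hb : ∀ d ∈ Finset.Ioc 0 D, ‖b d‖ ≤ B) :
    ‖GG b D T v‖ ≤ 2 * B * y * Real.exp (-(v/T)) := by
  have hT0 : 0 < T := by linarith
  have hv : 0 < v := by linarith
  have hvT1 : 1 ≤ v/T := by rw [one_le_div hT0]; exact hvT
  have : ‖GG b D T v‖ ≤ ∑ d ∈ Finset.Ioc 0 D, B * (2 * Real.exp (-(v/T))) := by
    refine norm_sum_le_of_le _ (fun d hd => ?_)
    rw [norm_mul]
    refine mul_le_mul (hb d hd) ?_ (norm_nonneg _) hB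
    have hd1 : (1:ℝ) ≤ d := by exact_mod_cast (Finset.mem_Ioc.1 hd).1
    have hre : ((d:ℂ) * om T * v).re = d * (v/T) := by simp [om]; ring
    have hre1 : v/T ≤ ((d:ℂ) * om T * v).re := by rw [hre]; nlinarith
    refine (Ef_bound (by linarith)).trans ?_
    have he : Real.exp (v/T) ≤ Real.exp ((d:ℂ) * om T * v).re := Real.exp_le_exp.2 hre1
    have he2 : 2 ≤ Real.exp (v/T) := by
      have := Real.add_one_le_exp (v/T); linarith
    rw [Real.exp_neg, ← div_eq_mul_inv, div_le_div_iff₀ (by linarith) (by positivity)]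
    linarith
  refine this.trans ?_
  rw [Finset.sum_const, Nat.card_Ioc, tsub_zero, nsmul_eq_mul]
  calc (D:ℝ) * (B * (2 * Real.exp (-(v/T)))) ≤ y * (B * (2 * Real.exp (-(v/T)))) := by gcongr
    _ = _ := by ring

lemma small_int (F : ℝ → ℝ) (T σ K : ℝ) (hT : 1 ≤ T) (hσ : |σ-1/2| ≤ 1/4) (hK : 0 ≤ K)
    (hF : ∀ v, 0 < v → v ≤ 1/T → F v ≤ K) :
    ∫⁻ v in Set.Ioc 0 (1/T), ENNReal.ofReal (F v * v^(2*σ-1)) ≤ ENNReal.ofReal (2*K) := by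
  have hT0 : 0 < T := by linarith
  have h1T : 1/T ≤ 1 := by rw [div_le_one hT0]; exact hT
  have hi : IntervalIntegrable (fun v : ℝ => v^(-(1/2):ℝ)) volume 0 1 :=
    intervalIntegral.intervalIntegrable_rpow' (by norm_num)
  have hi' : IntegrableOn (fun v : ℝ => K * v^(-(1/2):ℝ)) (Set.Ioc 0 1) := by
    have := (intervalIntegrable_iff_integrableOn_Ioc_of_le (by norm_num)).1 (hi.const_mul K)
    exact this
  calc ∫⁻ v in Set.Ioc 0 (1/T), ENNReal.ofReal (F v * v^(2*σ-1))
      ≤ ∫⁻ v in Set.Ioc 0 (1/T), ENNReal.ofReal (K * v^(-(1/2):ℝ)) := by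
        apply setLIntegral_mono' measurableSet_Ioc
        intro v hv
        apply ENNReal.ofReal_le_ofReal
        apply mul_le_mul (hF v hv.1 hv.2) _ (Real.rpow_nonneg hv.1.le _) hK
        apply Real.rpow_le_rpow_of_exponent_ge hv.1 (hv.2.trans h1T)
        rw [abs_le] at hσ; linarith
    _ ≤ ∫⁻ v in Set.Ioc 0 1, ENNReal.ofReal (K * v^(-(1/2):ℝ)) :=
        lintegral_mono_set (Set.Ioc_subset_Ioc_right h1T)
    _ = ENNReal.ofReal (∫ v in Set.Ioc 0 1, K * v^(-(1/2):ℝ)) := by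
        rw [ofReal_integral_eq_lintegral_ofReal hi']
        filter_upwards [ae_restrict_mem measurableSet_Ioc] with v hv
        exact mul_nonneg hK (Real.rpow_nonneg hv.1.le _)
    _ ≤ _ := by
        apply ENNReal.ofReal_le_ofReal
        rw [← intervalIntegral.integral_of_le (by norm_num), intervalIntegral.integral_const_mul,
          integral_rpow (Or.inl (by norm_num))]
        norm_num; linarith

lemma large_int (F : ℝ → ℝ) (T σ K : ℝ) (hT : 1 ≤ T) (hσ : |σ-1/2| ≤ 1/4) (hK : 0 ≤ K)
    (hF : ∀ v, T^2 < v → F v ≤ K * Real.exp (-(v/T))^2) :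
    ∫⁻ v in Set.Ioi (T^2), ENNReal.ofReal (F v * v^(2*σ-1)) ≤ ENNReal.ofReal (2*K) := by
  have hT0 : 0 < T := by linarith
  have hi : IntegrableOn (fun v : ℝ => K * T * Real.exp ((-(1/T))*v)) (Set.Ioi (T^2)) :=
    (integrableOn_exp_mul_Ioi (by rw [neg_lt_zero]; positivity) _).const_mul _
  calc ∫⁻ v in Set.Ioi (T^2), ENNReal.ofReal (F v * v^(2*σ-1))
      ≤ ∫⁻ v in Set.Ioi (T^2), ENNReal.ofReal (K * T * Real.exp ((-(1/T))*v)) := by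
        apply setLIntegral_mono' measurableSet_Ioi
        intro v hv
        have hv' : T^2 < v := hv
        have hv1 : 1 ≤ v := by nlinarith
        apply ENNReal.ofReal_le_ofReal
        have h1 : v^(2*σ-1) ≤ v := by
          conv_rhs => rw [← Real.rpow_one v]
          apply Real.rpow_le_rpow_of_exponent_le hv1
          rw [abs_le] at hσ; linarith
        have h2 : v ≤ T * Real.exp (v/T) := by
          have := Real.add_one_le_exp (v/T)
          have h3 : v = T * (v/T) := by field_simp
          nlinarith
        calc F v * v^(2*σ-1) ≤ (K * Real.exp (-(v/T))^2) * (T * Real.exp (v/T)) :=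
              mul_le_mul (hF v hv) (h1.trans h2) (Real.rpow_nonneg (by linarith) _) (by positivity)
          _ = _ := by
              rw [← Real.exp_nat_mul]
              rw [show (-(1/T))*v = (2:ℕ) * (-(v/T)) + v/T by push_cast; ring, Real.exp_add]; ring
    _ = ENNReal.ofReal (∫ v in Set.Ioi (T^2), K * T * Real.exp ((-(1/T))*v)) := by
        rw [ofReal_integral_eq_lintegral_ofReal hi]
        filter_upwards with v
        positivity
    _ ≤ _ := by
        apply ENNReal.ofReal_le_ofReal
        rw [integral_const_mul, integral_exp_mul_Ioi (by rw [neg_lt_zero]; positivity)]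
        have h1 : -(1/T) * T^2 = -T := by field_simp
        rw [h1]
        have h2 : T^2/2 ≤ Real.exp T := by
          have := Real.quadratic_le_exp_of_nonneg hT0.le; nlinarith
        have h3 : K * T * (-Real.exp (-T) / -(1/T)) = K * (T^2 * Real.exp (-T)) := by field_simp
        rw [h3]
        have h4 : T^2 * Real.exp (-T) ≤ 2 := by
          rw [Real.exp_neg, ← div_eq_mul_inv, div_le_iff₀ (Real.exp_pos _)]; linarith
        nlinarith

lemma mid_int (F : ℝ → ℝ) (T σ κ a b K : ℝ) (hL : 0 < Real.log T) (hT : 1 ≤ T) (hσ : |σ-1/2| ≤ κ/Real.log T)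
    (ha : 1/T ≤ a) (hab : a ≤ b) (hb : b ≤ T^2) (hF0 : ∀ v, 0 ≤ F v) (hFi : ContinuousOn F (Set.Ioi 0))
    (hF : ∫ v in a..b, F v ≤ K) :
    ∫⁻ v in Set.Ioc a b, ENNReal.ofReal (F v * v^(2*σ-1)) ≤ ENNReal.ofReal (Real.exp (4*κ) * K) := by
  have hT0 : 0 < T := by linarith
  have ha0 : 0 < a := lt_of_lt_of_le (by positivity) ha
  have hi : IntegrableOn (fun v : ℝ => Real.exp (4*κ) * F v) (Set.Ioc a b) := by
    have h1 : IntervalIntegrable F volume a b := by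
      apply ContinuousOn.intervalIntegrable
      rw [Set.uIcc_of_le hab]
      exact hFi.mono (fun v hv => lt_of_lt_of_le ha0 hv.1)
    exact (intervalIntegrable_iff_integrableOn_Ioc_of_le hab).1 (h1.const_mul _)
  calc ∫⁻ v in Set.Ioc a b, ENNReal.ofReal (F v * v^(2*σ-1))
      ≤ ∫⁻ v in Set.Ioc a b, ENNReal.ofReal (Real.exp (4*κ) * F v) := by
        apply setLIntegral_mono' measurableSet_Ioc
        intro v hv
        have hv0 : 0 < v := ha0.trans hv.1
        apply ENNReal.ofReal_le_ofReal
        rw [mul_comm]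
        apply mul_le_mul_of_nonneg_right _ (hF0 v)
        rw [Real.rpow_def_of_pos hv0, Real.exp_le_exp]
        have hl1 : Real.log v ≤ 2 * Real.log T := by
          have := Real.log_le_log hv0 (hv.2.trans hb)
          rw [Real.log_pow] at this; exact_mod_cast this
        have hl2 : -Real.log T ≤ Real.log v := by
          have := Real.log_le_log (by positivity) (ha.trans hv.1.le)
          rw [one_div, Real.log_inv] at this; exact this
        have habs : |Real.log v| ≤ 2 * Real.log T := by rw [abs_le]; constructor <;> linarith
        have h2σ : |2*σ-1| ≤ 2*(κ/Real.log T) := by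
          rw [show 2*σ-1 = 2*(σ-1/2) by ring, abs_mul, abs_two]; linarith
        calc Real.log v * (2*σ-1) ≤ |Real.log v| * |2*σ-1| := by
              rw [← abs_mul]; exact le_abs_self _
          _ ≤ (2 * Real.log T) * (2*(κ/Real.log T)) :=
              mul_le_mul habs h2σ (abs_nonneg _) (by linarith)
          _ = 4*κ := by field_simp; ring
    _ = ENNReal.ofReal (∫ v in Set.Ioc a b, Real.exp (4*κ) * F v) := by
        rw [ofReal_integral_eq_lintegral_ofReal hi]
        filter_upwards with v
        have := hF0 v
        positivity
    _ ≤ _ := by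
        apply ENNReal.ofReal_le_ofReal
        rw [← intervalIntegral.integral_of_le hab, intervalIntegral.integral_const_mul]
        exact mul_le_mul_of_nonneg_left hF (Real.exp_pos _).le

def cpar (η T : ℝ) : ℂ := 2 * π * Complex.I * η / Real.log T

set_option maxHeartbeats 1000000 in
lemma mean_bound (P : Polynomial ℝ) (hP : P.eval 0 = 0) (η ϑ κ : ℝ) (h0 : 0 < ϑ) (h1 : ϑ < 1/2) (hκ : 0 ≤ κ) :
    ∃ C : ℝ, 0 < C ∧ ∀ᶠ T : ℝ in atTop, ∀ σ : ℝ, |σ-1/2| ≤ κ/Real.log T →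
      ∫⁻ v in Set.Ioi 0, ENNReal.ofReal (‖GG (cf (T^ϑ) P (cpar η T)) ⌊T^ϑ⌋₊ T v‖^2 * v^(2*σ-1)) ≤
        ENNReal.ofReal (C * T) := by
  set κ1 : ℝ := 2*π*|η| + 1 + 1/ϑ with hκ1
  have hπ := Real.pi_pos
  have hκ1' : 0 ≤ κ1 := by positivity
  obtain ⟨C1, hC1, hdir⟩ := direct_bound P hP κ1 hκ1'
  obtain ⟨C2, hC2, hdual⟩ := dual_bound P hP κ1 hκ1'
  obtain ⟨B, hB, hcf⟩ := cf_bound P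
  refine ⟨2*B^2 + (Real.exp (4*κ) * C2 + (Real.exp (4*κ) * C1 + 8*B^2)), by positivity, ?_⟩
  set ε := (1-2*ϑ)/2 with hε
  have hε0 : 0 < ε := by rw [hε]; linarith
  have ev1 : ∀ᶠ T : ℝ in atTop, Real.log T ≤ (1/4) * T^(ε/2) := by
    have := (isLittleO_log_rpow_atTop (r := ε/2) (by positivity)).bound (c := 1/4) (by norm_num)
    filter_upwards [this, eventually_ge_atTop 1] with T hT h1
    rw [Real.norm_of_nonneg (Real.log_nonneg h1), Real.norm_of_nonneg (by positivity)] at hT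
    exact hT
  have ev2 : ∀ᶠ T : ℝ in atTop, 1/ϑ + 4*κ + 1 ≤ Real.log T :=
    Real.tendsto_log_atTop.eventually_ge_atTop _
  have ev3 : ∀ᶠ T : ℝ in atTop, 4 ≤ T^(1-ϑ) :=
    (tendsto_rpow_atTop (by linarith)).eventually_ge_atTop _
  filter_upwards [ev1, ev2, ev3, eventually_ge_atTop 1] with T e1 e2 e3 hT
  intro σ hσ
  have hT0 : 0 < T := by linarith
  set L := Real.log T with hLdef
  have hϑ' : 0 < 1/ϑ := by positivity
  have hL1 : 1 ≤ L := by linarith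
  have hL0 : 0 < L := by linarith
  set y := T^ϑ with hy
  have hy0 : 0 < y := by positivity
  have hlogy : Real.log y = ϑ * L := by rw [hy, Real.log_rpow hT0]
  have hΛ : 1 ≤ Real.log y := by
    rw [hlogy]
    have : ϑ * (1/ϑ) ≤ ϑ * L := by apply mul_le_mul_of_nonneg_left _ h0.le; linarith
    rwa [mul_one_div, div_self h0.ne'] at this
  have hy1 : 1 < y := by
    by_contra h; push Not at h
    have := Real.log_nonpos hy0.le h
    linarith
  set V := T^ε with hV
  have hV1 : 1 ≤ V := Real.one_le_rpow hT hε0.le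
  have hVT : V ≤ T^2 := by
    rw [hV, ← Real.rpow_natCast]
    apply Real.rpow_le_rpow_of_exponent_le hT
    push_cast; linarith
  have hhalf : (T^(ε/2))^2 = V := by
    rw [hV, ← Real.rpow_natCast, ← Real.rpow_mul hT0.le]; congr 1; push_cast; ring
  have hhalf1 : 1 ≤ T^(ε/2) := Real.one_le_rpow hT (by positivity)
  have hLV : L ≤ V := by nlinarith
  have hyT4 : 4*y ≤ T := by
    have : T = T^(1-ϑ) * y := by
      rw [hy, ← Real.rpow_add hT0]; simp
    nlinarith
  have hy2T : y^2 ≤ T := by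
    rw [hy, ← Real.rpow_natCast, ← Real.rpow_mul hT0.le]
    conv_rhs => rw [← Real.rpow_one T]
    apply Real.rpow_le_rpow_of_exponent_le hT
    push_cast; linarith
  have hVyT : V * y^2 * (1 + Real.log y)^2 ≤ T := by
    have hl : 1 + Real.log y ≤ T^(ε/2) := by
      rw [hlogy]; nlinarith
    calc V * y^2 * (1 + Real.log y)^2 ≤ V * y^2 * (T^(ε/2))^2 := by gcongr
      _ = T := by
        rw [hhalf, hV, hy, ← Real.rpow_natCast (T^ϑ), ← Real.rpow_mul hT0.le, ← Real.rpow_add hT0, ← Real.rpow_add hT0]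
        rw [show ε + ϑ * (2:ℕ) + ε = 1 by rw [hε]; push_cast; ring, Real.rpow_one]
  set c := cpar η T with hcdef
  have hc0 : c.re = 0 := by
    have : c = ((2*π*η/L : ℝ):ℂ) * Complex.I := by
      rw [hcdef, cpar]; push_cast; ring
    rw [this]; simp
  have hcn : ‖c‖ ≤ κ1 / Real.log y := by
    have : c = ((2*π*η/L : ℝ):ℂ) * Complex.I := by
      rw [hcdef, cpar]; push_cast; ring
    rw [this, norm_mul, Complex.norm_I, mul_one, Complex.norm_real, Real.norm_eq_abs, abs_div, abs_mul,
      abs_of_pos (show 0 < 2*π by positivity), abs_of_pos hL0, hlogy, div_le_div_iff₀ hL0 (by positivity)]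
    have h3 : 2*π*|η| * ϑ ≤ 2*π*|η| := by
      have : 0 ≤ 2*π*|η| := by positivity
      nlinarith
    have h4 : 2*π*|η| * ϑ ≤ κ1 := by rw [hκ1]; linarith
    nlinarith
  have hh1 : 1 / L ≤ κ1 / Real.log y := by
    rw [hlogy, div_le_div_iff₀ hL0 (by positivity)]
    have : 1 ≤ κ1 := by
      rw [hκ1]; have : 0 ≤ 2*π*|η| := by positivity
      linarith
    nlinarith
  have hκϑ : 1 ≤ κ1 * ϑ := by
    have : 1/ϑ ≤ κ1 := by
      rw [hκ1]; have : 0 ≤ 2*π*|η| := by positivity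
      linarith
    rwa [div_le_iff₀ h0] at this
  have hh2 : L ≤ κ1 * Real.log y := by
    rw [hlogy]; nlinarith
  have hlV : Real.log V ≤ κ1 * Real.log y := by
    refine le_trans ?_ hh2
    rw [hV, Real.log_rpow hT0]
    have : ε ≤ 1 := by rw [hε]; linarith
    nlinarith
  have d1 := hdir T y V c hL1 hT (by linarith) hy0 hΛ hh1 hh2 hcn hc0 hLV hVT
  have d2 := hdual T y V c hT hy0 hΛ hV1 hlV hcn hc0 hVyT
  have hDy : ((⌊y⌋₊:ℕ):ℝ) ≤ y := Nat.floor_le hy0.le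
  have hbb : ∀ d ∈ Finset.Ioc 0 ⌊y⌋₊, ‖cf y P c d‖ ≤ B := fun d hd => hcf y c d hy1 hc0 hd
  set F : ℝ → ℝ := fun v => ‖GG (cf y P c) ⌊y⌋₊ T v‖^2 with hF
  have hFc : ContinuousOn F (Set.Ioi 0) := ((GG_cont _ _ T hT0).norm).pow 2
  have hF0 : ∀ v, 0 ≤ F v := fun v => by positivity
  have hσ4 : |σ-1/2| ≤ 1/4 := by
    refine hσ.trans ?_
    rw [div_le_div_iff₀ hL0 (by norm_num)]; linarith
  have hTV : 1/T ≤ V := by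
    refine le_trans ?_ hV1
    rw [div_le_one hT0]; exact hT
  have hset : Set.Ioi (0:ℝ) = Set.Ioc 0 (1/T) ∪ (Set.Ioc (1/T) V ∪ (Set.Ioc V (T^2) ∪ Set.Ioi (T^2))) := by
    rw [Set.Ioc_union_Ioi_eq_Ioi hVT, Set.Ioc_union_Ioi_eq_Ioi hTV, Set.Ioc_union_Ioi_eq_Ioi (by positivity)]
  have j1 : ∫⁻ v in Set.Ioc 0 (1/T), ENNReal.ofReal (F v * v^(2*σ-1)) ≤ ENNReal.ofReal (2*B^2*T) := by
    refine (small_int F T σ (B^2*y^2) hT hσ4 (by positivity) ?_).trans ?_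
    · intro v hv hvT
      have := GG_small (cf y P c) ⌊y⌋₊ T v B y hT hv hvT hDy hyT4 hB.le hbb
      calc F v ≤ (B*y)^2 := pow_le_pow_left₀ (norm_nonneg _) this 2
        _ = _ := by ring
    · apply ENNReal.ofReal_le_ofReal; nlinarith [sq_nonneg B]
  have j4 : ∫⁻ v in Set.Ioi (T^2), ENNReal.ofReal (F v * v^(2*σ-1)) ≤ ENNReal.ofReal (8*B^2*T) := by
    refine (large_int F T σ (4*B^2*y^2) hT hσ4 (by positivity) ?_).trans ?_
    · intro v hv
      have := GG_large (cf y P c) ⌊y⌋₊ T v B y hT (by nlinarith) hDy hB.le hbb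
      calc F v ≤ (2*B*y*Real.exp (-(v/T)))^2 := pow_le_pow_left₀ (norm_nonneg _) this 2
        _ = _ := by ring
    · apply ENNReal.ofReal_le_ofReal; nlinarith [sq_nonneg B]
  have j2 := mid_int F T σ κ (1/T) V (C2*T) hL0 hT hσ le_rfl hTV hVT hF0 hFc d2
  have j3 := mid_int F T σ κ V (T^2) (C1*T) hL0 hT hσ hTV hVT le_rfl hF0 hFc d1
  rw [hset]
  refine (lintegral_union_le _ _ _).trans ?_
  have e : ENNReal.ofReal ((2*B^2 + (Real.exp (4*κ) * C2 + (Real.exp (4*κ) * C1 + 8*B^2))) * T) =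
     ENNReal.ofReal (2*B^2*T) + (ENNReal.ofReal (Real.exp (4*κ) * (C2*T)) +
      (ENNReal.ofReal (Real.exp (4*κ) * (C1*T)) + ENNReal.ofReal (8*B^2*T))) := by
    rw [← ENNReal.ofReal_add (by positivity) (by positivity), ← ENNReal.ofReal_add (by positivity) (by positivity),
      ← ENNReal.ofReal_add (by positivity) (by positivity)]
    congr 1; ring
  rw [e]
  refine add_le_add j1 ?_
  refine (lintegral_union_le _ _ _).trans (add_le_add j2 ?_)
  exact (lintegral_union_le _ _ _).trans (add_le_add j3 j4)

end MZ

namespace MZ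

open FourierTransform SchwartzMap in
lemma planch (g : ℝ → ℂ) (h1 : Integrable g) (h2 : MemLp g 2) :
    ∫⁻ t, ‖𝓕 g t‖ₑ^2 = ∫⁻ t, ‖g t‖ₑ^2 := by
  set f : Lp ℂ 2 (volume : Measure ℝ) := h2.toLp g with hf
  have hcont : Continuous (𝓕 g) :=
    VectorFourier.fourierIntegral_continuous Real.continuous_fourierChar
      (by exact continuous_inner) h1
  have hae : ∀ᵐ x, (𝓕 f : Lp ℂ 2 (volume : Measure ℝ)) x = 𝓕 g x := by
    apply ae_eq_of_integral_contDiff_smul_eq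
    · exact (Lp.memLp _).locallyIntegrable (by norm_num)
    · exact hcont.locallyIntegrable
    · intro φ φs φc
      have hg₁ : HasCompactSupport (Complex.ofRealCLM ∘ φ) := φc.comp_left rfl
      have hg₂ : ContDiff ℝ (↑(⊤:ℕ∞)) (Complex.ofRealCLM ∘ φ) := Complex.ofRealCLM.contDiff.comp φs
      set ψ := hg₁.toSchwartzMap hg₂ with hψ
      have hψv : ∀ x, ψ x = (φ x : ℂ) := by intro x; rfl
      have e1 := congrArg (fun D => D ψ) (Lp.fourier_toTemperedDistribution_eq f)
      simp only [TemperedDistribution.fourier_apply, Lp.toTemperedDistribution_apply] at e1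
      have e2 : ∫ x, (𝓕 ψ) x • f x = ∫ x, (𝓕 ψ) x • g x := by
        apply integral_congr_ae
        filter_upwards [h2.coeFn_toLp] with x hx
        rw [hf, hx]
      have e3 : ∫ x, (𝓕 ψ) x • g x = ∫ x, ψ x • 𝓕 g x := by
        simpa using! (VectorFourier.integral_fourierIntegral_smul_eq_flip (L := innerₗ ℝ)
          Real.continuous_fourierChar continuous_inner ψ.integrable h1)
      have e4 := (e1.symm.trans e2).trans e3
      simpa [hψv] using e4
  have hn := Lp.norm_fourier_eq f
  have hn2 : eLpNorm (𝓕 g) 2 volume = eLpNorm g 2 volume := by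
    have a1 : eLpNorm (𝓕 f : Lp ℂ 2 (volume : Measure ℝ)) 2 volume = eLpNorm f 2 volume := by
      rw [Lp.norm_def, Lp.norm_def] at hn
      rwa [ENNReal.toReal_eq_toReal_iff' (Lp.eLpNorm_ne_top _) (Lp.eLpNorm_ne_top _)] at hn
    rw [eLpNorm_congr_ae hae, eLpNorm_congr_ae h2.coeFn_toLp] at a1
    exact a1
  rw [eLpNorm_eq_lintegral_rpow_enorm_toReal (by norm_num) (by norm_num),
    eLpNorm_eq_lintegral_rpow_enorm_toReal (by norm_num) (by norm_num)] at hn2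
  have := ENNReal.rpow_left_injective (x := 1 / (2:ENNReal).toReal) (by norm_num) hn2
  simpa using this

lemma mellin_planch (G : ℝ → ℂ) (σ : ℝ) (hG : ContinuousOn G (Set.Ioi 0))
    (hc : MellinConvergent G (σ:ℂ))
    (hfin : ∫⁻ v in Set.Ioi 0, ENNReal.ofReal (‖G v‖^2 * v^(2*σ-1)) < ⊤) :
    ∫⁻ t : ℝ, ‖mellin G (σ + t * Complex.I)‖ₑ^2 =
      ENNReal.ofReal (2*π) * ∫⁻ v in Set.Ioi 0, ENNReal.ofReal (‖G v‖^2 * v^(2*σ-1)) := by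
  set g : ℝ → ℂ := fun u => Real.exp (-σ*u) • G (Real.exp (-u)) with hg
  have hgc : Continuous g := by
    have hG' : Continuous fun u:ℝ => G (Real.exp (-u)) :=
      hG.comp_continuous (by fun_prop) (fun u => Real.exp_pos _)
    have hE : Continuous fun u:ℝ => Real.exp (-σ*u) := by fun_prop
    exact hE.smul hG'
  have himg : (fun u : ℝ => Real.exp (-u)) '' Set.univ = Set.Ioi 0 := by
    rw [Set.image_univ]
    ext v; simp only [Set.mem_range, Set.mem_Ioi]
    constructor
    · rintro ⟨u, rfl⟩; exact Real.exp_pos _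
    · intro hv; exact ⟨-Real.log v, by rw [neg_neg, Real.exp_log hv]⟩
  have hder : ∀ u ∈ Set.univ, HasDerivWithinAt (fun u : ℝ => Real.exp (-u)) (-Real.exp (-u)) Set.univ u := by
    intro u _
    have := ((hasDerivAt_id u).neg).exp
    exact (this.congr_deriv (by simp)).hasDerivWithinAt
  have hinj : Set.InjOn (fun u : ℝ => Real.exp (-u)) Set.univ := by
    intro u _ w _ h
    have := Real.exp_injective h; linarith
  have hL2 : ∫⁻ v in Set.Ioi 0, ENNReal.ofReal (‖G v‖^2 * v^(2*σ-1)) = ∫⁻ u, ‖g u‖ₑ^2 := by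
    rw [← himg, lintegral_image_eq_lintegral_abs_deriv_mul MeasurableSet.univ hder hinj, Measure.restrict_univ]
    apply lintegral_congr; intro u
    rw [← ENNReal.ofReal_mul (abs_nonneg _), ← ofReal_norm, ← ENNReal.ofReal_pow (norm_nonneg _)]
    congr 1
    simp only [hg, norm_smul, Real.norm_eq_abs, abs_of_pos (Real.exp_pos _), abs_neg]
    rw [← Real.exp_mul, mul_pow, ← Real.exp_nat_mul, mul_comm (‖G _‖^2), ← mul_assoc, ← Real.exp_add]
    congr 2; push_cast; ring
  have hL1 : Integrable g := by
    have h := hc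
    unfold MellinConvergent at h
    rw [← himg, integrableOn_image_iff_integrableOn_abs_deriv_smul MeasurableSet.univ hder hinj,
      integrableOn_univ] at h
    refine h.congr (Eventually.of_forall fun u => ?_)
    simp only [hg]
    rw [abs_neg, abs_of_pos (Real.exp_pos _), Complex.ofReal_exp, Complex.cpow_def_of_ne_zero (Complex.exp_ne_zero _),
      ← Complex.ofReal_exp, ← Complex.ofReal_log (Real.exp_pos _).le, Real.log_exp]
    rw [Complex.real_smul, Complex.real_smul, smul_eq_mul, ← mul_assoc]
    congr 1
    push_cast
    rw [← Complex.exp_add]; congr 1; ring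
  have hM2 : MemLp g 2 := by
    refine ⟨hgc.aestronglyMeasurable, ?_⟩
    rw [eLpNorm_lt_top_iff_lintegral_rpow_enorm_lt_top (by norm_num) (by norm_num)]
    simp only [ENNReal.toReal_ofNat, ENNReal.rpow_ofNat]
    rw [← hL2]; exact hfin
  have hm : ∀ t : ℝ, mellin G (σ + t * Complex.I) = FourierTransform.fourier g (t/(2*π)) := by
    intro t
    rw [mellin_eq_fourier]
    simp [hg]
  simp only [hm]
  rw [hL2, ← planch g hL1 hM2]
  have hpi : (0:ℝ) < 2*π := by positivity
  have hd2 : ∀ u ∈ Set.univ, HasDerivWithinAt (fun u : ℝ => u/(2*π)) (1/(2*π)) Set.univ u := by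
    intro u _
    exact ((hasDerivAt_id u).div_const (2*π)).hasDerivWithinAt
  have hi2 : Set.InjOn (fun u : ℝ => u/(2*π)) Set.univ := by
    intro u _ w _ h
    simpa [hpi.ne', Real.pi_ne_zero] using h
  have him2 : (fun u : ℝ => u/(2*π)) '' Set.univ = Set.univ := by
    rw [Set.image_univ, Set.range_eq_univ]
    intro v; exact ⟨v*(2*π), by field_simp⟩
  have key := lintegral_image_eq_lintegral_abs_deriv_mul MeasurableSet.univ hd2 hi2
    (fun t => ‖FourierTransform.fourier g t‖ₑ^2)
  rw [him2, Measure.restrict_univ, lintegral_const_mul' _ _ ENNReal.ofReal_ne_top] at key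
  rw [key, ← mul_assoc, ← ENNReal.ofReal_mul hpi.le, abs_of_pos (by positivity),
    mul_one_div_cancel hpi.ne', ENNReal.ofReal_one, one_mul]

end MZ

namespace MZ

lemma gam_norm (a w : ℂ) (t : ℝ) (ht : 0 < t) :
    ‖(t:ℂ)^(a-1) * Complex.exp (-(w*t))‖ = t^(a.re-1) * Real.exp (-(w.re*t)) := by
  rw [norm_mul, Complex.norm_cpow_eq_rpow_re_of_pos ht, Complex.norm_exp]
  simp

lemma gam_meas (a w : ℂ) : AEStronglyMeasurable (fun t:ℝ => (t:ℂ)^(a-1) * Complex.exp (-(w*t)))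
    (volume.restrict (Set.Ioi 0)) := by
  apply ContinuousOn.aestronglyMeasurable _ measurableSet_Ioi
  apply ContinuousOn.mul
  · intro t ht
    apply ContinuousAt.continuousWithinAt
    exact Complex.continuousAt_ofReal_cpow_const _ _ (Or.inr (ne_of_gt ht))
  · fun_prop

lemma gam_real_int (s b : ℝ) (hs : 0 < s) (hb : 0 < b) :
    IntegrableOn (fun t : ℝ => t^(s-1) * Real.exp (-(b*t))) (Set.Ioi 0) := by
  have := integrableOn_rpow_mul_exp_neg_mul_rpow (p := 1) (s := s-1) (b := b) (by linarith) (by norm_num) hb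
  simpa using this

lemma gam_int (a w : ℂ) (ha : 0 < a.re) (hw : 0 < w.re) :
    IntegrableOn (fun t:ℝ => (t:ℂ)^(a-1) * Complex.exp (-(w*t))) (Set.Ioi 0) := by
  refine Integrable.mono' (gam_real_int a.re w.re ha hw) (gam_meas a w) ?_
  filter_upwards [ae_restrict_mem measurableSet_Ioi] with t ht
  rw [gam_norm a w t ht]

lemma gam_diff (a w : ℂ) (ha : 0 < a.re) (hw : 0 < w.re) :
    DifferentiableAt ℂ (fun w : ℂ => ∫ t in Set.Ioi (0:ℝ), (t:ℂ)^(a-1) * Complex.exp (-(w*t))) w := by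
  have h := hasDerivAt_integral_of_dominated_loc_of_deriv_le (𝕜 := ℂ) (μ := volume.restrict (Set.Ioi (0:ℝ)))
    (F := fun w t => (t:ℂ)^(a-1) * Complex.exp (-(w*t)))
    (F' := fun w t => (t:ℂ)^(a-1) * (Complex.exp (-(w*t)) * (-t))) (x₀ := w)
    (s := Metric.ball w (w.re/2)) (bound := fun t => t^((a.re+1)-1) * Real.exp (-(w.re/2*t)))
    (Metric.ball_mem_nhds _ (by linarith))
    (Eventually.of_forall fun z => gam_meas a z) (gam_int a w ha hw) ?_ ?_ ?_ ?_
  · exact h.2.differentiableAt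
  · have := (gam_meas a w).mul (f := fun t:ℝ => (t:ℂ)^(a-1) * Complex.exp (-(w*t)))
      (g := fun t : ℝ => (-t:ℂ)) (by fun_prop)
    refine this.congr (Eventually.of_forall fun t => ?_)
    simp only [Pi.mul_apply]; ring
  · filter_upwards [ae_restrict_mem measurableSet_Ioi] with t ht z hz
    have ht : 0 < t := ht
    rw [← mul_assoc, norm_mul, gam_norm a z t ht, norm_neg, Complex.norm_real, Real.norm_eq_abs, abs_of_pos ht,
      show a.re + 1 - 1 = (a.re - 1) + 1 by ring, Real.rpow_add_one ht.ne']
    have hz' : w.re/2 ≤ z.re := by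
      have h1 := Complex.abs_re_le_norm (z - w)
      rw [Metric.mem_ball, dist_eq_norm] at hz
      rw [Complex.sub_re] at h1
      have := abs_le.1 h1; linarith
    have : Real.exp (-(z.re*t)) ≤ Real.exp (-(w.re/2*t)) := by
      apply Real.exp_le_exp.2; nlinarith
    have h3 : 0 ≤ t^(a.re-1) * t := by positivity
    nlinarith
  · exact gam_real_int _ _ (by linarith) (by linarith)
  · refine Eventually.of_forall fun t z hz => ?_
    apply HasDerivAt.const_mul
    have := (((hasDerivAt_id z).mul_const (t:ℂ)).neg).cexp
    exact this.congr_deriv (by simp)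

lemma gam_complex (a w : ℂ) (ha : 0 < a.re) (hw : 0 < w.re) :
    ∫ t in Set.Ioi (0:ℝ), (t:ℂ)^(a-1) * Complex.exp (-(w*t)) = (1/w)^a * Complex.Gamma a := by
  set U : Set ℂ := {z | 0 < z.re}
  have hU : IsOpen U := isOpen_lt continuous_const Complex.continuous_re
  have hUc : IsPreconnected U := (convex_halfSpace_re_gt 0).isPreconnected
  have h1 : AnalyticOnNhd ℂ (fun w : ℂ => ∫ t in Set.Ioi (0:ℝ), (t:ℂ)^(a-1) * Complex.exp (-(w*t))) U :=
    DifferentiableOn.analyticOnNhd (fun z hz => (gam_diff a z ha hz).differentiableWithinAt) hU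
  have h2 : AnalyticOnNhd ℂ (fun w : ℂ => (1/w)^a * Complex.Gamma a) U := by
    apply DifferentiableOn.analyticOnNhd _ hU
    intro z hz
    apply DifferentiableAt.differentiableWithinAt
    have hz : 0 < z.re := hz
    have hz0 : z ≠ 0 := by rintro rfl; simp at hz
    apply DifferentiableAt.mul_const
    apply DifferentiableAt.cpow_const
    · exact (differentiableAt_const _).div differentiableAt_id hz0
    · left
      rw [one_div, Complex.inv_re]
      exact div_pos hz (Complex.normSq_pos.2 hz0)
  have hfr : ∃ᶠ z in nhdsWithin (1:ℂ) {1}ᶜ, (fun w : ℂ => ∫ t in Set.Ioi (0:ℝ), (t:ℂ)^(a-1) * Complex.exp (-(w*t))) z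
      = (fun w : ℂ => (1/w)^a * Complex.Gamma a) z := by
    have ht : Tendsto (fun n : ℕ => (((1 + 1/((n:ℝ)+1) : ℝ)) : ℂ)) atTop (nhdsWithin (1:ℂ) {1}ᶜ) := by
      apply tendsto_nhdsWithin_of_tendsto_nhds_of_eventually_within
      · have := (tendsto_one_div_add_atTop_nhds_zero_nat (𝕜 := ℝ)).const_add 1
        have h := (Complex.continuous_ofReal.tendsto _).comp this
        refine (h.congr fun n => ?_).mono_right (by simp)
        simp
      · refine Eventually.of_forall fun n => ?_
        simp only [Set.mem_compl_iff, Set.mem_singleton_iff]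
        intro h
        have : (1 + 1/((n:ℝ)+1) : ℝ) = 1 := by exact_mod_cast h
        have h2 : 0 < 1/((n:ℝ)+1) := by positivity
        linarith
    apply ht.frequently
    refine (Eventually.of_forall fun n => ?_).frequently
    have h := Complex.integral_cpow_mul_exp_neg_mul_Ioi (a := a) (r := 1 + 1/((n:ℝ)+1)) ha (by positivity)
    exact h
  exact h1.eqOn_of_preconnected_of_frequently_eq h2 hUc (z₀ := 1) (by simp [U]) hfr hw

lemma nat_mul_cpow (n : ℕ) (hn : n ≠ 0) (w s : ℂ) (hw : w ≠ 0) :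
    (1/((n:ℂ)*w))^s = (n:ℂ)^(-s) * (1/w)^s := by
  have h1 : (1/((n:ℂ)*w)) = ((1/(n:ℝ) : ℝ):ℂ) * (1/w) := by push_cast; field_simp
  have hp : (0:ℝ) < 1/(n:ℝ) := by positivity
  have hn' : (n:ℂ) ≠ 0 := by exact_mod_cast hn
  rw [h1, Complex.cpow_def_of_ne_zero (mul_ne_zero (by exact_mod_cast hp.ne') (one_div_ne_zero hw)),
    Complex.log_ofReal_mul hp (one_div_ne_zero hw), Complex.cpow_def_of_ne_zero hn',
    Complex.cpow_def_of_ne_zero (one_div_ne_zero hw), ← Complex.exp_add, Complex.ofReal_log hp.le]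
  congr 1
  rw [← Complex.natCast_log, ← Complex.ofReal_log hp.le, one_div (n:ℝ), Real.log_inv]
  push_cast; ring

lemma hasSum_cg {f g : ℕ → ℂ} {a : ℂ} (h : HasSum f a) (e : ∀ n, f n = g n) : HasSum g a := by
  rw [← funext e]; exact h

lemma eta_sum (s : ℂ) (hs : 1 < s.re) :
    HasSum (fun n : ℕ => (-1:ℂ)^n * ((n:ℂ)+1)^(-s)) ((1 - 2^(1-s)) * riemannZeta s) := by
  have hz : HasSum (fun n : ℕ => 1/(n:ℂ)^s) (riemannZeta s) := by
    rw [zeta_eq_tsum_one_div_nat_cpow hs]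
    exact (Complex.summable_one_div_nat_cpow.2 hs).hasSum
  have hs0 : s ≠ 0 := by rintro rfl; simp at hs; linarith
  have he : HasSum (fun n : ℕ => if Even n then 1/(n:ℂ)^s else 0) (2^(-s) * riemannZeta s) := by
    have hinj : Function.Injective (fun n : ℕ => 2*n) := fun a b h => by simpa using h
    rw [← hinj.hasSum_iff]
    · have := hz.mul_left ((2:ℂ)^(-s))
      refine hasSum_cg this fun n => ?_
      simp only [Function.comp]
      rw [if_pos (even_two_mul n), Complex.cpow_neg]
      have : (((2*n:ℕ):ℂ))^s = 2^s * (n:ℂ)^s := by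
        have := Complex.natCast_mul_natCast_cpow 2 n s
        push_cast at this ⊢; exact this
      rw [this]
      rw [one_div, one_div, mul_inv]
    · intro n hn
      rw [if_neg]
      rintro ⟨m, rfl⟩
      exact hn ⟨m, by simp; ring⟩
  have h3 := hz.sub (he.mul_left 2)
  have h4 : HasSum (fun n : ℕ => (fun n : ℕ => 1/(n:ℂ)^s - 2 * (if Even n then 1/(n:ℂ)^s else 0)) (n+1))
      (riemannZeta s - 2*(2^(-s) * riemannZeta s)) := by
    rw [hasSum_nat_add_iff (f := fun n : ℕ => 1/(n:ℂ)^s - 2 * (if Even n then 1/(n:ℂ)^s else 0)) 1]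
    simpa [Complex.zero_cpow hs0] using h3
  have e : riemannZeta s - 2*(2^(-s) * riemannZeta s) = (1 - 2^(1-s)) * riemannZeta s := by
    rw [sub_eq_add_neg (1:ℂ) s, Complex.cpow_add _ _ (by norm_num), Complex.cpow_one]; ring
  rw [← e]
  refine hasSum_cg h4 fun n => ?_
  simp only
  rw [Complex.cpow_neg]
  push_cast
  rcases Nat.even_or_odd n with h | h
  · rw [if_neg (by simpa using h.add_one), h.neg_one_pow]; simp
  · rw [if_pos (by simpa using h.add_one), h.neg_one_pow]; simp; ring

end MZ

namespace MZ

lemma Ef_hasSum (z : ℂ) (hz : 0 < z.re) :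
    HasSum (fun n : ℕ => (-1:ℂ)^n * Complex.exp (-(((n:ℂ)+1)*z))) (Ef z) := by
  have hn : ‖-Complex.exp (-z)‖ < 1 := by
    rw [norm_neg, Complex.norm_exp]; simpa using hz
  have h := (hasSum_geometric_of_norm_lt_one hn).mul_left (Complex.exp (-z))
  have e : Complex.exp (-z) * (1 - -Complex.exp (-z))⁻¹ = Ef z := by
    unfold Ef
    have h1 := exp_add_one_ne hz
    have h2 := Complex.exp_ne_zero z
    rw [Complex.exp_neg]
    have : (1 - -(Complex.exp z)⁻¹) = (Complex.exp z + 1) / Complex.exp z := by field_simp; ring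
    rw [this]; field_simp
  rw [e] at h
  refine hasSum_cg h fun n => ?_
  rw [neg_pow, ← Complex.exp_nat_mul, mul_left_comm, ← Complex.exp_add]
  congr 2; ring

lemma mellin_Ef (w s : ℂ) (hw : 0 < w.re) (hs : 1 < s.re) :
    ∫ t in Set.Ioi (0:ℝ), (t:ℂ)^(s-1) * Ef (w*t) =
      (1/w)^s * Complex.Gamma s * ((1 - 2^(1-s)) * riemannZeta s) := by
  have hw0 : w ≠ 0 := by rintro rfl; simp at hw
  have hre : ∀ n : ℕ, 0 < ((((n+1:ℕ):ℂ))*w).re := by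
    intro n
    rw [← Complex.ofReal_natCast, Complex.re_ofReal_mul]; positivity
  set F : ℕ → ℝ → ℂ := fun n t => (-1:ℂ)^n * ((t:ℂ)^(s-1) * Complex.exp (-((((n+1:ℕ):ℂ)*w)*t))) with hF
  have hint : ∀ n, Integrable (F n) (volume.restrict (Set.Ioi 0)) := by
    intro n
    exact (gam_int s (((n+1:ℕ):ℂ)*w) (by linarith) (hre n)).const_mul _
  have hnorm : ∀ n, ∫ t in Set.Ioi (0:ℝ), ‖F n t‖ = (1/((n:ℝ)+1)^s.re) * ((1/w.re)^s.re * Real.Gamma s.re) := by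
    intro n
    have : ∫ t in Set.Ioi (0:ℝ), ‖F n t‖ = ∫ t in Set.Ioi (0:ℝ), t^(s.re-1) * Real.exp (-((((n:ℝ)+1)*w.re)*t)) := by
      apply setIntegral_congr_fun measurableSet_Ioi
      intro t ht
      simp only [hF]
      rw [norm_mul, gam_norm _ _ _ ht, norm_pow, norm_neg, norm_one, one_pow, one_mul,
        ← Complex.ofReal_natCast, Complex.re_ofReal_mul]
      push_cast; rfl
    rw [this, Real.integral_rpow_mul_exp_neg_mul_Ioi (by linarith) (by positivity),
      one_div_mul_eq_div, ← div_div, Real.div_rpow (by positivity) (by positivity)] 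
    rw [Real.div_rpow (by positivity) (by positivity), Real.div_rpow zero_le_one hw.le, Real.one_rpow]
    ring
  have hsum : Summable fun n => ∫ t in Set.Ioi (0:ℝ), ‖F n t‖ := by
    simp only [hnorm]
    apply Summable.mul_right
    have := (summable_nat_add_iff 1).2 (Real.summable_one_div_nat_rpow.2 hs)
    simpa using this
  have h := hasSum_integral_of_summable_integral_norm hint hsum
  have e1 : ∫ t in Set.Ioi (0:ℝ), ∑' n, F n t = ∫ t in Set.Ioi (0:ℝ), (t:ℂ)^(s-1) * Ef (w*t) := by
    apply setIntegral_congr_fun measurableSet_Ioi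
    intro t ht
    have ht : 0 < t := ht
    have hz : 0 < (w*(t:ℂ)).re := by rw [Complex.re_mul_ofReal]; positivity
    have := (Ef_hasSum _ hz).mul_left ((t:ℂ)^(s-1))
    simp only
    rw [← this.tsum_eq]
    apply tsum_congr; intro n
    simp only [hF]
    rw [mul_left_comm]; push_cast; congr 4; ring
  rw [e1] at h
  refine h.unique ?_
  have h2 := (eta_sum s hs).mul_left ((1/w)^s * Complex.Gamma s)
  refine hasSum_cg h2 fun n => ?_
  simp only [hF]
  rw [integral_const_mul, gam_complex s _ (by linarith) (hre n), nat_mul_cpow (n+1) (by omega) w s hw0]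
  push_cast; ring

lemma Ef_bigO (w : ℂ) (hw : 0 < w.re) : (fun v : ℝ => Ef (w*v)) =O[atTop] fun v => Real.exp (-w.re * v) := by
  apply Asymptotics.IsBigO.of_bound 2
  filter_upwards [eventually_ge_atTop (1/w.re)] with v hv
  have h1 : 1 ≤ w.re * v := by rwa [div_le_iff₀' hw] at hv
  have hz : (w*(v:ℂ)).re = w.re * v := by rw [Complex.re_mul_ofReal]
  refine (Ef_bound (by rw [hz]; linarith)).trans ?_
  rw [hz, Real.norm_eq_abs, abs_of_pos (Real.exp_pos _), neg_mul, Real.exp_neg]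
  have h2 : 2 ≤ Real.exp (w.re*v) := by
    have := Real.add_one_le_exp (w.re*v); linarith
  rw [div_le_iff₀ (by linarith)]
  have : 2 * (Real.exp (w.re*v))⁻¹ * (Real.exp (w.re*v) - 1) = 2 - 2 * (Real.exp (w.re*v))⁻¹ := by
    field_simp
  rw [this]
  have : (Real.exp (w.re*v))⁻¹ ≤ 2⁻¹ := inv_anti₀ (by norm_num) h2
  linarith

lemma Ef_bigO0 (w : ℂ) : (fun v : ℝ => Ef (w*v)) =O[nhdsWithin 0 (Set.Ioi 0)] fun v => v ^ (-(0:ℝ)) := by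
  apply Asymptotics.IsBigO.of_bound 1
  have : Tendsto (fun v : ℝ => ‖w*(v:ℂ)‖) (nhdsWithin 0 (Set.Ioi 0)) (nhds ‖w * ((0:ℝ):ℂ)‖) :=
    (Continuous.tendsto (by fun_prop) 0).mono_left nhdsWithin_le_nhds
  have h2 := this.eventually (gt_mem_nhds (show ‖w * ((0:ℝ):ℂ)‖ < 1/2 by simp))
  filter_upwards [h2] with v hv
  have := Ef_small (w*v) hv.le
  simpa using this

lemma om_w (d : ℕ) (hd : 0 < d) (T : ℝ) (hT : 0 < T) : 1/T ≤ ((d:ℂ)*om T).re := by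
  rw [← Complex.ofReal_natCast, Complex.re_ofReal_mul, om_re]
  have : (1:ℝ) ≤ d := by exact_mod_cast hd
  have h2 : 0 < 1/T := by positivity
  nlinarith

lemma GG_bigO (b : ℕ → ℂ) (D : ℕ) (T : ℝ) (hT : 0 < T) :
    GG b D T =O[atTop] fun v => Real.exp (-(1/T) * v) := by
  unfold GG
  apply Asymptotics.IsBigO.fun_sum
  intro d hd
  have hd := (Finset.mem_Ioc.1 hd).1
  have hw := om_w d hd T hT
  have hT' : 0 < 1/T := by positivity
  apply Asymptotics.IsBigO.const_mul_left
  refine (Ef_bigO _ (by linarith)).trans ?_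
  apply Asymptotics.IsBigO.of_bound 1
  filter_upwards [eventually_ge_atTop 0] with v hv
  rw [one_mul, Real.norm_eq_abs, Real.norm_eq_abs, abs_of_pos (Real.exp_pos _), abs_of_pos (Real.exp_pos _)]
  apply Real.exp_le_exp.2; nlinarith

lemma GG_bigO0 (b : ℕ → ℂ) (D : ℕ) (T : ℝ) :
    GG b D T =O[nhdsWithin 0 (Set.Ioi 0)] fun v => v ^ (-(0:ℝ)) := by
  unfold GG
  apply Asymptotics.IsBigO.fun_sum
  intro d hd
  exact (Ef_bigO0 _).const_mul_left _

lemma GG_loc (b : ℕ → ℂ) (D : ℕ) (T : ℝ) (hT : 0 < T) : LocallyIntegrableOn (GG b D T) (Set.Ioi 0) :=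
  (GG_cont b D T hT).locallyIntegrableOn measurableSet_Ioi

lemma GG_conv (b : ℕ → ℂ) (D : ℕ) (T : ℝ) (hT : 0 < T) (s : ℂ) (hs : 0 < s.re) :
    MellinConvergent (GG b D T) s :=
  mellinConvergent_of_isBigO_rpow_exp (a := 1/T) (by positivity) (GG_loc b D T hT) (GG_bigO b D T hT)
    (GG_bigO0 b D T) hs

lemma GG_diff (b : ℕ → ℂ) (D : ℕ) (T : ℝ) (hT : 0 < T) (s : ℂ) (hs : 0 < s.re) :
    DifferentiableAt ℂ (mellin (GG b D T)) s :=
  mellin_differentiableAt_of_isBigO_rpow_exp (a := 1/T) (by positivity) (GG_loc b D T hT) (GG_bigO b D T hT)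
    (GG_bigO0 b D T) hs

lemma Ef_conv (w : ℂ) (hw : 0 < w.re) (s : ℂ) (hs : 0 < s.re) :
    MellinConvergent (fun v : ℝ => Ef (w*v)) s := by
  refine mellinConvergent_of_isBigO_rpow_exp (a := w.re) hw ?_ (Ef_bigO w hw)
    (Ef_bigO0 w) hs
  refine ContinuousOn.locallyIntegrableOn ?_ measurableSet_Ioi
  unfold Ef
  apply ContinuousOn.inv₀
  · fun_prop
  · intro v hv
    apply exp_add_one_ne
    rw [Complex.re_mul_ofReal]
    have : 0 < v := hv
    positivity

lemma om_ne (T : ℝ) : om T ≠ 0 := by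
  intro h
  have := congrArg Complex.im h
  rw [om_im] at this; simp at this

def Dir (b : ℕ → ℂ) (D : ℕ) (s : ℂ) : ℂ := ∑ d ∈ Finset.Ioc 0 D, b d * (d:ℂ)^(-s)

lemma mellin_one (b : ℕ → ℂ) (D : ℕ) (T : ℝ) (hT : 0 < T) (s : ℂ) (hs : 1 < s.re) :
    mellin (GG b D T) s = (1/om T)^s * Complex.Gamma s * ((1 - 2^(1-s)) * riemannZeta s) * Dir b D s := by
  have hT' : 0 < 1/T := by positivity
  unfold mellin GG Dir
  simp only [smul_eq_mul, Finset.mul_sum]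
  rw [integral_finsetSum]
  · apply Finset.sum_congr rfl
    intro d hd
    have hd := (Finset.mem_Ioc.1 hd).1
    have hw := om_w d hd T hT
    have := mellin_Ef _ s (lt_of_lt_of_le hT' hw) hs
    simp only [mul_left_comm _ (b d)]
    rw [integral_const_mul, this, nat_mul_cpow d hd.ne' _ _ (om_ne T)]
    ring
  · intro d hd
    have hd := (Finset.mem_Ioc.1 hd).1
    have hw := om_w d hd T hT
    have h1 := Ef_conv _ (lt_of_lt_of_le hT' hw) s (by linarith)
    unfold MellinConvergent at h1
    simp only [mul_left_comm _ (b d)]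
    exact h1.const_mul (b d)

def QQ : Set ℂ := {z | 0 < z.re ∧ 0 < z.im}

lemma QQ_open : IsOpen QQ :=
  (isOpen_lt continuous_const Complex.continuous_re).inter (isOpen_lt continuous_const Complex.continuous_im)

lemma QQ_conn : IsPreconnected QQ :=
  ((convex_halfSpace_re_gt 0).inter (convex_halfSpace_im_gt 0)).isPreconnected

lemma cpow_diff (w : ℂ) (hw : w ≠ 0) (z : ℂ) : DifferentiableAt ℂ (fun s : ℂ => w^s) z :=
  (differentiableAt_id).const_cpow (Or.inl hw)

lemma Dir_diff (b : ℕ → ℂ) (D : ℕ) (z : ℂ) : DifferentiableAt ℂ (Dir b D) z := by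
  unfold Dir
  apply DifferentiableAt.fun_sum
  intro d hd
  have hd := (Finset.mem_Ioc.1 hd).1
  apply DifferentiableAt.const_mul
  exact (differentiableAt_id.neg).const_cpow (Or.inl (by exact_mod_cast hd.ne'))

lemma mellin_formula (b : ℕ → ℂ) (D : ℕ) (T : ℝ) (hT : 0 < T) (s : ℂ) (hs : s ∈ QQ) :
    mellin (GG b D T) s = (1/om T)^s * Complex.Gamma s * ((1 - 2^(1-s)) * riemannZeta s) * Dir b D s := by
  have h1 : AnalyticOnNhd ℂ (mellin (GG b D T)) QQ :=
    DifferentiableOn.analyticOnNhd (fun z hz => (GG_diff b D T hT z hz.1).differentiableWithinAt) QQ_open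
  have h2 : AnalyticOnNhd ℂ (fun s => (1/om T)^s * Complex.Gamma s * ((1 - 2^(1-s)) * riemannZeta s) * Dir b D s) QQ := by
    refine DifferentiableOn.analyticOnNhd (fun z hz => DifferentiableAt.differentiableWithinAt ?_) QQ_open
    apply DifferentiableAt.mul _ (Dir_diff b D z)
    apply DifferentiableAt.mul
    · apply DifferentiableAt.mul (cpow_diff _ (one_div_ne_zero (om_ne T)) z)
      apply Complex.differentiableAt_Gamma
      intro m h
      have := hz.2
      rw [h] at this; simp at this
    · apply DifferentiableAt.mul
      · apply DifferentiableAt.const_sub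
        exact ((differentiableAt_const _).sub differentiableAt_id).const_cpow (Or.inl (by norm_num))
      · apply differentiableAt_riemannZeta
        rintro rfl
        have := hz.2
        simp at this
  have hz0 : (2 + Complex.I : ℂ) ∈ QQ := by constructor <;> simp
  have hev : mellin (GG b D T) =ᶠ[nhds (2 + Complex.I)] (fun s => (1/om T)^s * Complex.Gamma s * ((1 - 2^(1-s)) * riemannZeta s) * Dir b D s) := by
    have : {z : ℂ | 1 < z.re} ∈ nhds (2 + Complex.I) :=
      (isOpen_lt continuous_const Complex.continuous_re).mem_nhds (by simp)
    filter_upwards [this] with z hz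
    exact mellin_one b D T hT z hz
  exact h1.eqOn_of_preconnected_of_eventuallyEq h2 QQ_conn hz0 hev hs

lemma moll_eq (T ϑ : ℝ) (P : Polynomial ℝ) (s c : ℂ) :
    (∑ n ∈ Finset.Icc 1 ⌊T ^ ϑ⌋₊,
    (ArithmeticFunction.moebius n : ℂ) *
      (P.eval (Real.log (T ^ ϑ / n) / Real.log (T ^ ϑ)) : ℝ) * (n : ℂ) ^ (-(s+c))) =
    Dir (cf (T^ϑ) P c) ⌊T^ϑ⌋₊ s := by
  unfold Dir cf
  apply Finset.sum_congr rfl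
  intro d hd
  have hd := (Finset.mem_Icc.1 hd).1
  have hd0 : (d:ℂ) ≠ 0 := by exact_mod_cast (show d ≠ 0 by omega)
  rw [neg_add, Complex.cpow_add _ _ hd0]
  ring

end MZ

namespace MZ

lemma arg_om (T : ℝ) (hT : 0 < T) : π/2 - 1/T ≤ Complex.arg (om T) := by
  have hre : 0 < (om T).re := by rw [om_re]; positivity
  have h1 : Real.tan (Complex.arg (om T)) = T := by
    rw [Complex.tan_arg, om_re, om_im]; field_simp
  have h2 := Complex.abs_arg_lt_pi_div_two_iff.2 (Or.inl hre)
  rw [abs_lt] at h2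
  have h3 : Complex.arg (om T) = Real.arctan T := by
    rw [← Real.arctan_tan h2.1 h2.2, h1]
  have h4 := Real.arctan_inv_of_pos hT
  have h5 : Real.arctan (T⁻¹) ≤ T⁻¹ := by
    have h6 : 0 < Real.arctan T⁻¹ := Real.arctan_pos.2 (by positivity)
    have h7 := Real.lt_tan h6 (Real.arctan_lt_pi_div_two _)
    rw [Real.tan_arctan] at h7; exact h7.le
  rw [h3, one_div]; linarith

lemma om_cpow (T γ : ℝ) (hT : 1 ≤ T) (hγ : 0 < γ) (hγT : γ ≤ 2*T) :
    Real.exp (π*γ) * Real.exp (-4) / 2 ≤ ‖(1/om T)^((1:ℂ)/2 + γ * Complex.I)‖^2 := by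
  have hT0 : 0 < T := by linarith
  have hre : 0 < (om T).re := by rw [om_re]; positivity
  rw [Complex.norm_cpow_of_ne_zero (one_div_ne_zero (om_ne T))]
  have e1 : ((1:ℂ)/2 + γ * Complex.I).re = 1/2 := by simp
  have e2 : ((1:ℂ)/2 + γ * Complex.I).im = γ := by simp
  have h2 := Complex.abs_arg_lt_pi_div_two_iff.2 (Or.inl hre)
  rw [abs_lt] at h2
  have e3 : Complex.arg (1/om T) = -Complex.arg (om T) := by
    rw [one_div, Complex.arg_inv, if_neg]
    intro h; linarith [Real.pi_pos, h2.2]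
  rw [e1, e2, e3, div_pow, ← Real.rpow_natCast (‖1/om T‖^(1/2:ℝ)), ← Real.rpow_mul (norm_nonneg _),
    ← Real.exp_nat_mul]
  norm_num
  rw [div_eq_mul_inv _ (Real.exp _), ← Real.exp_neg]
  have hn : ‖om T‖ ≤ 2 := by
    unfold om
    refine (norm_add_le _ _).trans ?_
    rw [Complex.norm_real, Complex.norm_I, Real.norm_eq_abs, abs_of_pos (by positivity)]
    have : 1/T ≤ 1 := by rw [div_le_one hT0]; exact hT
    linarith
  have hn0 : 0 < ‖om T‖ := norm_pos_iff.2 (om_ne T)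
  have h3 : (1:ℝ)/2 ≤ ‖om T‖⁻¹ := by rw [one_div]; exact inv_anti₀ hn0 hn
  have h4 : Real.exp (π*γ) * Real.exp (-4) ≤ Real.exp (-(-(2 * (Complex.arg (om T) * γ)))) := by
    rw [← Real.exp_add]
    apply Real.exp_le_exp.2
    have := arg_om T hT0
    have h5 : γ/T ≤ 2 := by rw [div_le_iff₀ hT0]; exact hγT
    have h6 : (π/2 - 1/T)*γ ≤ Complex.arg (om T) * γ := mul_le_mul_of_nonneg_right this hγ.le
    have h7 : (π/2 - 1/T)*γ = π*γ/2 - γ/T := by ring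
    linarith
  calc Real.exp (π*γ) * Real.exp (-4) / 2 = 1/2 * (Real.exp (π*γ) * Real.exp (-4)) := by ring
    _ ≤ _ := mul_le_mul h3 h4 (by positivity) (by positivity)

lemma Gam_low (γ : ℝ) (hγ : 0 < γ) :
    Real.exp (-(π*γ)) ≤ ‖Complex.Gamma ((1:ℂ)/2 + γ * Complex.I)‖^2 := by
  set s : ℂ := (1:ℂ)/2 + γ * Complex.I with hs
  have h1 := Complex.Gamma_mul_Gamma_one_sub s
  have hc : 1 - s = (starRingEnd ℂ) s := by
    apply Complex.ext <;> simp [hs]; norm_num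
  rw [hc, Complex.Gamma_conj] at h1
  have h2 := congrArg norm h1
  rw [norm_mul, RCLike.norm_conj, norm_div, Complex.norm_real, Real.norm_eq_abs, abs_of_pos Real.pi_pos] at h2
  rw [sq, h2]
  have h3 : ‖Complex.sin (π*s)‖ ≤ Real.exp (π*γ) := by
    rw [Complex.sin, norm_div, norm_mul, Complex.norm_I, mul_one]
    have h4 := norm_sub_le (Complex.exp (-(π*s) * Complex.I)) (Complex.exp (π*s*Complex.I))
    rw [Complex.norm_exp, Complex.norm_exp] at h4
    have e1 : (-(π*s) * Complex.I).re = π*γ := by simp [hs]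
    have e2 : ((π*s) * Complex.I).re = -(π*γ) := by simp [hs]
    rw [e1, e2] at h4
    have h5 : Real.exp (-(π*γ)) ≤ Real.exp (π*γ) := Real.exp_le_exp.2 (by
      have := mul_pos Real.pi_pos hγ; linarith)
    rw [show ‖(2:ℂ)‖ = 2 by simp, div_le_iff₀ (by norm_num)]
    linarith
  have h6 : 0 < ‖Complex.sin (π*s)‖ := by
    rcases (norm_nonneg (Complex.sin (π*s))).eq_or_lt with h | h
    · exfalso
      rw [← h, div_zero] at h2
      have h7 : Complex.Gamma s ≠ 0 := by
        apply Complex.Gamma_ne_zero_of_re_pos; simp [hs]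
      have := norm_pos_iff.2 h7
      nlinarith
    · exact h
  rw [Real.exp_neg, le_div_iff₀ h6]
  have h8 := Real.pi_gt_three
  calc _ ≤ (Real.exp (π*γ))⁻¹ * Real.exp (π*γ) := by gcongr
    _ = 1 := inv_mul_cancel₀ (Real.exp_pos _).ne'
    _ ≤ π := by linarith

lemma two_low (γ : ℝ) : 1/9 ≤ ‖(1:ℂ) - 2^(1 - ((1:ℂ)/2 + γ * Complex.I))‖^2 := by
  have h1 : ‖(2:ℂ)^(1 - ((1:ℂ)/2 + γ * Complex.I))‖ = Real.sqrt 2 := by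
    have := Complex.norm_cpow_eq_rpow_re_of_pos (x := 2) (by norm_num) (1 - ((1:ℂ)/2 + γ * Complex.I))
    rw [Complex.ofReal_ofNat] at this
    rw [this, Real.sqrt_eq_rpow]; congr 1; simp; norm_num
  have h2 := norm_sub_norm_le ((2:ℂ)^(1 - ((1:ℂ)/2 + γ * Complex.I))) 1
  rw [norm_sub_rev, h1, norm_one] at h2
  have h3 : (4/3:ℝ) ≤ Real.sqrt 2 := by apply Real.le_sqrt_of_sq_le; norm_num
  nlinarith

lemma deriv_low (b : ℕ → ℂ) (D : ℕ) (T γ : ℝ) (hT : 1 ≤ T) (hγ : 0 < γ) (hγT : γ ≤ 2*T)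
    (hz : riemannZeta ((1:ℂ)/2 + γ * Complex.I) = 0) :
    ‖deriv riemannZeta ((1:ℂ)/2 + γ * Complex.I) * Dir b D ((1:ℂ)/2 + γ * Complex.I)‖^2 ≤
      (18 * Real.exp 4) * ‖deriv (mellin (GG b D T)) ((1:ℂ)/2 + γ * Complex.I)‖^2 := by
  have hT0 : 0 < T := by linarith
  have g1 := om_cpow T γ hT hγ hγT
  have g2 := Gam_low γ hγ
  have g3 := two_low γ
  set s : ℂ := (1:ℂ)/2 + γ * Complex.I with hs
  have hsQ : s ∈ QQ := by constructor <;> simp [hs, hγ]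
  have hs1 : s ≠ 1 := by
    intro h; have := congrArg Complex.im h; simp [hs] at this; linarith
  have hev : mellin (GG b D T) =ᶠ[nhds s] fun s => ((1/om T)^s * Complex.Gamma s * (1 - 2^(1-s)) * Dir b D s) * riemannZeta s := by
    filter_upwards [QQ_open.mem_nhds hsQ] with z hz
    rw [mellin_formula b D T hT0 z hz]; ring
  have hA : DifferentiableAt ℂ (fun s => ((1/om T)^s * Complex.Gamma s * (1 - 2^(1-s)) * Dir b D s)) s := by
    apply DifferentiableAt.mul _ (Dir_diff b D s)
    apply DifferentiableAt.mul
    · apply DifferentiableAt.mul (cpow_diff _ (one_div_ne_zero (om_ne T)) s)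
      apply Complex.differentiableAt_Gamma
      intro m h
      have := hsQ.2
      rw [h] at this; simp at this
    · apply DifferentiableAt.const_sub
      exact ((differentiableAt_const _).sub differentiableAt_id).const_cpow (Or.inl (by norm_num))
  have hd : deriv (mellin (GG b D T)) s = ((1/om T)^s * Complex.Gamma s * (1 - 2^(1-s)) * Dir b D s) * deriv riemannZeta s := by
    rw [hev.deriv_eq]
    have := hA.hasDerivAt.mul (differentiableAt_riemannZeta hs1).hasDerivAt
    rw [hz, mul_zero, zero_add] at this
    exact this.deriv
  rw [hd]
  simp only [norm_mul, mul_pow]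
  have key : Real.exp (-4) / 18 ≤ ‖(1/om T)^s‖^2 * ‖Complex.Gamma s‖^2 * ‖(1:ℂ) - 2^(1-s)‖^2 := by
    calc Real.exp (-4) / 18 = (Real.exp (π*γ) * Real.exp (-4) / 2) * Real.exp (-(π*γ)) * (1/9) := by
          rw [Real.exp_neg (π*γ)]; field_simp; norm_num
      _ ≤ _ := by gcongr
  have h5 : 1 ≤ (18 * Real.exp 4) * (‖(1/om T)^s‖^2 * ‖Complex.Gamma s‖^2 * ‖(1:ℂ) - 2^(1-s)‖^2) := by
    calc (1:ℝ) = (18 * Real.exp 4) * (Real.exp (-4)/18) := by rw [Real.exp_neg]; field_simp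
      _ ≤ _ := mul_le_mul_of_nonneg_left key (by positivity)
  have h6 : 0 ≤ ‖deriv riemannZeta s‖^2 * ‖Dir b D s‖^2 := by positivity
  have := mul_le_mul_of_nonneg_right h5 h6
  linarith

end MZ

namespace MZ

lemma circ_mem (c : ℂ) (r ρ θ : ℝ) (h0 : 0 ≤ ρ) (h1 : ρ < r) : circleMap c ρ θ ∈ Metric.ball c r := by
  rw [Metric.mem_ball, dist_eq_norm, circleMap_sub_center, norm_circleMap_zero, abs_of_nonneg h0]; exact h1

lemma circ_mean (g : ℂ → ℂ) (c : ℂ) (R ρ : ℝ) (h0 : 0 < ρ) (h1 : ρ < R)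
    (hg : DifferentiableOn ℂ g (Metric.ball c R)) :
    ENNReal.ofReal (2*π) * ‖g c‖ₑ^2 ≤ ∫⁻ θ in Set.Ioo (-π) π, ‖g (circleMap c ρ θ)‖ₑ^2 := by
  have hd : DiffContOnCl ℂ (fun z => g z ^ 2) (Metric.ball c |ρ|) := by
    rw [abs_of_pos h0]
    apply DifferentiableOn.diffContOnCl
    apply (hg.fun_pow 2).mono
    exact Metric.closure_ball_subset_closedBall.trans (Metric.closedBall_subset_ball h1)
  have h2 := hd.circleAverage
  rw [Real.circleAverage_def] at h2
  have hper : Function.Periodic (fun θ => (g (circleMap c ρ θ))^2) (2*π) := by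
    intro θ; simp only [periodic_circleMap c ρ θ]
  have h3 := hper.intervalIntegral_add_eq 0 (-π)
  rw [zero_add, show -π + 2*π = π by ring] at h3
  rw [h3, intervalIntegral.integral_of_le (by linarith [Real.pi_pos])] at h2
  have h4 : ((2*π:ℝ):ℂ) * g c ^ 2 = ∫ θ in Set.Ioc (-π) π, (g (circleMap c ρ θ))^2 := by
    rw [← h2, Complex.real_smul, ← mul_assoc, ← Complex.ofReal_mul, mul_inv_cancel₀ (by positivity)]; simp
  calc ENNReal.ofReal (2*π) * ‖g c‖ₑ^2 = ‖((2*π:ℝ):ℂ) * g c ^ 2‖ₑ := by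
        rw [enorm_mul, enorm_pow, ← ofReal_norm ((2*π:ℝ):ℂ), Complex.norm_real, Real.norm_eq_abs,
          abs_of_pos (by positivity)]
    _ ≤ ∫⁻ θ in Set.Ioc (-π) π, ‖(g (circleMap c ρ θ))^2‖ₑ := by
        rw [h4]; exact enorm_integral_le_lintegral_enorm _
    _ = _ := by rw [restrict_Ioo_eq_restrict_Ioc]; simp only [enorm_pow]

lemma disc_area (f : ℂ → ℂ) (c : ℂ) (r : ℝ) (hr : 0 < r) (hf : ContinuousOn f (Metric.ball c (8*r)))
    (K : ENNReal) (hK : ∀ ρ ∈ Set.Icc (6*r) (7*r), K ≤ ∫⁻ θ in Set.Ioo (-π) π, ‖f (circleMap c ρ θ)‖ₑ^2) :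
    ENNReal.ofReal (6*r*r) * K ≤ ∫⁻ z in Metric.ball c (8*r), ‖f z‖ₑ^2 := by
  rw [← lintegral_indicator Metric.isOpen_ball.measurableSet, ← lintegral_add_left_eq_self _ c,
    ← Complex.lintegral_comp_polarCoord_symm]
  set S : Set (ℝ × ℝ) := Set.Icc (6*r) (7*r) ×ˢ Set.Ioo (-π) π with hS
  have hsub : S ⊆ polarCoord.target := by
    rw [polarCoord_target]
    apply Set.prod_mono _ le_rfl
    intro x hx; have := hx.1; simp only [Set.mem_Ioi]; linarith
  have hSm : MeasurableSet S := measurableSet_Icc.prod measurableSet_Ioo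
  refine le_trans ?_ (lintegral_mono_set hsub)
  have e1 : ∫⁻ p in S, ENNReal.ofReal p.1 • (Metric.ball c (8*r)).indicator (fun z => ‖f z‖ₑ^2) (c + Complex.polarCoord.symm p)
      = ∫⁻ p in S, ENNReal.ofReal p.1 * ‖f (circleMap c p.1 p.2)‖ₑ^2 := by
    apply setLIntegral_congr_fun hSm
    intro p hp
    have hc : c + Complex.polarCoord.symm p = circleMap c p.1 p.2 := by
      rw [Complex.polarCoord_symm_apply, circleMap, Complex.exp_mul_I]; push_cast; rfl
    simp only
    rw [hc, Set.indicator_of_mem, smul_eq_mul]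
    exact circ_mem c _ _ _ (by linarith [hp.1.1]) (by linarith [hp.1.2])
  rw [e1]
  have hcont : ContinuousOn (fun p : ℝ × ℝ => ENNReal.ofReal p.1 * ‖f (circleMap c p.1 p.2)‖ₑ^2) S := by
    have h1 : ContinuousOn (fun p : ℝ × ℝ => f (circleMap c p.1 p.2)) S := by
      apply hf.comp
      · unfold circleMap; fun_prop
      · intro p hp
        exact circ_mem c _ _ _ (by linarith [hp.1.1]) (by linarith [hp.1.2])
    have h2 : ContinuousOn (fun p : ℝ × ℝ => ENNReal.ofReal (p.1 * ‖f (circleMap c p.1 p.2)‖^2)) S :=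
      ENNReal.continuous_ofReal.comp_continuousOn (continuousOn_fst.mul (h1.norm.pow 2))
    refine h2.congr fun p hp => ?_
    simp only
    rw [ENNReal.ofReal_mul (by linarith [hp.1.1]), ENNReal.ofReal_pow (norm_nonneg _), ofReal_norm]
  have hvol : (volume : Measure (ℝ × ℝ)) = (volume : Measure ℝ).prod volume := rfl
  rw [hvol, hS, setLIntegral_prod _ (by rw [← hvol, ← hS]; exact hcont.aemeasurable hSm)]
  calc ENNReal.ofReal (6*r*r) * K = ∫⁻ x in Set.Icc (6*r) (7*r), ENNReal.ofReal (6*r) * K := by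
        rw [setLIntegral_const, Real.volume_Icc, ENNReal.ofReal_mul (by positivity),
          show 7*r-6*r = r by ring]; ring
    _ ≤ _ := by
        apply setLIntegral_mono' measurableSet_Icc
        intro x hx
        rw [lintegral_const_mul' _ _ ENNReal.ofReal_ne_top]
        exact mul_le_mul' (ENNReal.ofReal_le_ofReal hx.1) (hK x hx)

lemma factor (f : ℂ → ℂ) (U : Set ℂ) (hU : IsOpen U) (hf : DifferentiableOn ℂ f U) (S : Finset ℂ)
    (hS : ∀ z ∈ S, z ∈ U ∧ f z = 0) :
    ∃ g : ℂ → ℂ, DifferentiableOn ℂ g U ∧ ∀ z ∈ U, f z = (∏ a ∈ S, (z - a)) * g z := by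
  induction S using Finset.induction_on with
  | empty => exact ⟨f, hf, by simp⟩
  | insert a S ha ih =>
    obtain ⟨g, hg, hfg⟩ := ih fun z hz => hS z (Finset.mem_insert_of_mem hz)
    have haU := hS a (Finset.mem_insert_self _ _)
    have hga : g a = 0 := by
      have := hfg a haU.1
      rw [haU.2] at this
      rcases mul_eq_zero.1 this.symm with h | h
      · exfalso
        rw [Finset.prod_eq_zero_iff] at h
        obtain ⟨b, hb, hab⟩ := h
        rw [sub_eq_zero] at hab
        exact ha (hab ▸ hb)
      · exact h
    refine ⟨dslope g a, (Complex.differentiableOn_dslope (hU.mem_nhds haU.1)).2 hg, fun z hz => ?_⟩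
    rw [Finset.prod_insert ha, hfg z hz]
    have h := sub_smul_dslope g a z
    rw [hga, sub_zero, smul_eq_mul] at h
    rw [← h]; ring

lemma disc_main (f : ℂ → ℂ) (S : Finset ℂ) (c : ℂ) (hc : c ∈ S) (r : ℝ) (hr : 0 < r)
    (hf : DifferentiableOn ℂ f (Metric.ball c (8*r)))
    (hS : ∀ z ∈ S, f z = 0) (hd : ∀ z ∈ S, ‖c - z‖ ≤ 2*r) :
    ENNReal.ofReal (S.card * r^4 * ‖deriv f c‖^2) ≤ ∫⁻ z in Metric.ball c (8*r), ‖f z‖ₑ^2 := by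
  have hUo : IsOpen (Metric.ball c (8*r)) := Metric.isOpen_ball
  obtain ⟨g, hg, hfg⟩ := factor f _ hUo hf S (fun z hz => ⟨by
    rw [Metric.mem_ball, dist_comm, dist_eq_norm]; linarith [hd z hz], hS z hz⟩)
  have hcU : c ∈ Metric.ball c (8*r) := Metric.mem_ball_self (by linarith)
  set n := S.card with hn
  have hn1 : 1 ≤ n := Finset.card_pos.2 ⟨c, hc⟩
  have hder : deriv f c = (∏ a ∈ S.erase c, (c - a)) * g c := by
    have hev : f =ᶠ[nhds c] fun z => (z - c) * ((∏ a ∈ S.erase c, (z - a)) * g z) := by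
      filter_upwards [hUo.mem_nhds hcU] with z hz
      rw [hfg z hz, ← Finset.mul_prod_erase S _ hc]; ring
    rw [hev.deriv_eq]
    have h1 : DifferentiableAt ℂ (fun z => (∏ a ∈ S.erase c, (z - a)) * g z) c := by
      apply DifferentiableAt.mul _ (hg.differentiableAt (hUo.mem_nhds hcU))
      fun_prop
    have := ((hasDerivAt_id c).sub_const c).mul h1.hasDerivAt
    have h2 := this.deriv
    simp only [id, sub_self, zero_mul, add_zero, one_mul] at h2
    exact h2
  have hdb : ‖deriv f c‖ ≤ (2*r)^(n-1) * ‖g c‖ := by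
    rw [hder, norm_mul, norm_prod]
    apply mul_le_mul_of_nonneg_right _ (norm_nonneg _)
    rw [hn, ← Finset.card_erase_of_mem hc, ← Finset.prod_const]
    exact Finset.prod_le_prod (fun _ _ => norm_nonneg _) (fun a ha => hd a (Finset.mem_of_mem_erase ha))
  have hfb : ∀ ρ ∈ Set.Icc (6*r) (7*r), ∀ θ, (4*r)^n * ‖g (circleMap c ρ θ)‖ ≤ ‖f (circleMap c ρ θ)‖ := by
    intro ρ hρ θ
    have hm := circ_mem c (8*r) ρ θ (by linarith [hρ.1]) (by linarith [hρ.2])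
    rw [hfg _ hm, norm_mul, norm_prod]
    apply mul_le_mul_of_nonneg_right _ (norm_nonneg _)
    rw [hn, ← Finset.prod_const]
    apply Finset.prod_le_prod
    · intro _ _; positivity
    · intro a ha
      have h1 := hd a ha
      have h2 : ‖circleMap c ρ θ - c‖ = ρ := by
        rw [circleMap_sub_center, norm_circleMap_zero, abs_of_nonneg (by linarith [hρ.1])]
      have h3 := norm_sub_norm_le (circleMap c ρ θ - c) (-(c - a))
      rw [sub_neg_eq_add, sub_add_sub_cancel, norm_neg, h2] at h3
      linarith [hρ.1]
  have key := disc_area f c r hr hf.continuousOn (ENNReal.ofReal ((4*r)^n)^2 * (ENNReal.ofReal (2*π) * ‖g c‖ₑ^2)) (by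
    intro ρ hρ
    refine (mul_le_mul_right (circ_mean g c (8*r) ρ (by linarith [hρ.1]) (by linarith [hρ.2]) hg) _).trans ?_
    rw [← lintegral_const_mul' _ _ (by simp)]
    apply lintegral_mono
    intro θ
    simp only
    rw [← mul_pow]
    gcongr
    rw [← ofReal_norm, ← ofReal_norm, ← ENNReal.ofReal_mul (by positivity)]
    exact ENNReal.ofReal_le_ofReal (hfb ρ hρ θ))
  refine le_trans ?_ key
  rw [← ofReal_norm, ← ENNReal.ofReal_pow (by positivity), ← ENNReal.ofReal_pow (by positivity),
    ← ENNReal.ofReal_mul (by positivity), ← ENNReal.ofReal_mul (by positivity), ← ENNReal.ofReal_mul (by positivity)]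
  apply ENNReal.ofReal_le_ofReal
  obtain ⟨m, hm⟩ : ∃ m, n = m + 1 := ⟨n-1, by omega⟩
  rw [hm] at hdb ⊢
  simp only [Nat.add_sub_cancel] at hdb
  have h1 : ‖deriv f c‖^2 ≤ ((2*r)^m * ‖g c‖)^2 := by gcongr
  have h2 : ((m+1:ℕ):ℝ) ≤ 4^m := by
    have : m + 1 ≤ 4^m := by
      have := Nat.lt_pow_self (n := m) (a := 4) (by norm_num); omega
    exact_mod_cast this
  have hpi := Real.pi_gt_three
  calc ((m+1:ℕ):ℝ) * r^4 * ‖deriv f c‖^2 ≤ 4^m * r^4 * ((2*r)^m * ‖g c‖)^2 := by gcongr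
    _ = ((4*r)^m)^2 * ‖g c‖^2 * r^4 := by
      rw [mul_pow _ _ 2, mul_pow, mul_pow, mul_pow, mul_pow, ← pow_mul, ← pow_mul, ← pow_mul,
        show (4:ℝ) = 2^2 by norm_num, ← pow_mul, ← pow_mul]; ring
    _ ≤ (((4*r)^m)^2 * ‖g c‖^2 * r^4) * (192*π) := by
      have : 0 ≤ (((4*r)^m)^2 * ‖g c‖^2 * r^4) := by positivity
      nlinarith
    _ = _ := by rw [pow_succ]; ring

end MZ

namespace MZ

def strip (r : ℝ) : Set ℂ := {z | |z.re - 1/2| < 8*r}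
def cell (r : ℝ) (m : ℤ) : Set ℂ := {z | |z.re - 1/2| < 8*r ∧ |z.im/r - m| < 9}

lemma strip_open (r : ℝ) : IsOpen (strip r) :=
  isOpen_lt (by fun_prop) continuous_const

lemma cell_open (r : ℝ) (m : ℤ) : IsOpen (cell r m) := by
  have h : IsOpen {z : ℂ | |z.im/r - m| < 9} := isOpen_lt (by fun_prop) continuous_const
  exact (strip_open r).inter h

lemma strip_pos (r : ℝ) (hr : 16*r ≤ 1) (z : ℂ) (hz : z ∈ strip r) : 0 < z.re := by
  have := (abs_lt.1 (show |z.re - 1/2| < 8*r from hz)).1; linarith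

lemma cell_sum (f : ℂ → ℂ) (r : ℝ) (hr : 0 < r) (hr2 : 16*r ≤ 1) (hf : DifferentiableOn ℂ f {z | 0 < z.re})
    (Z : Finset ℝ) (m : ℤ) (hZ : ∀ γ ∈ Z, f (1/2 + γ * Complex.I) = 0 ∧ ⌊γ/r⌋ = m) :
    ∑ γ ∈ Z, ENNReal.ofReal (r^4 * ‖deriv f (1/2 + γ * Complex.I)‖^2) ≤ ∫⁻ z in cell r m, ‖f z‖ₑ^2 := by
  classical
  rcases Z.eq_empty_or_nonempty with h | hne
  · simp [h]
  set I := ∫⁻ z in cell r m, ‖f z‖ₑ^2 with hI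
  have hinj : Function.Injective (fun γ : ℝ => (1/2 + γ * Complex.I : ℂ)) := by
    intro a b h
    have := congrArg Complex.im h
    simpa using this
  have hn0 : (Z.card : ENNReal) ≠ 0 := by
    exact_mod_cast (Finset.card_pos.2 hne).ne'
  have hk : ∀ γ ∈ Z, ENNReal.ofReal (r^4 * ‖deriv f (1/2 + γ * Complex.I)‖^2) ≤ I / Z.card := by
    intro γ hγ
    rw [ENNReal.le_div_iff_mul_le (Or.inl hn0) (Or.inl (by simp))]
    have hball : Metric.ball (1/2 + γ * Complex.I : ℂ) (8*r) ⊆ cell r m := by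
      intro z hz
      rw [Metric.mem_ball, dist_eq_norm] at hz
      have h1 := Complex.abs_re_le_norm (z - (1/2 + γ * Complex.I))
      have h2 := Complex.abs_im_le_norm (z - (1/2 + γ * Complex.I))
      simp at h1 h2
      refine ⟨by norm_num at h1 ⊢; linarith, ?_⟩
      have h3 : |z.im/r - γ/r| < 8 := by
        rw [← sub_div, abs_div, abs_of_pos hr, div_lt_iff₀ hr]; linarith
      have h4 : |γ/r - m| < 1 := by
        rw [← (hZ γ hγ).2, Int.self_sub_floor, Int.abs_fract]; exact Int.fract_lt_one _
      have h5 := abs_sub_le (z.im/r) (γ/r) m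
      linarith
    have h := disc_main f (Z.image (fun γ : ℝ => (1/2 + γ * Complex.I : ℂ))) (1/2 + γ * Complex.I)
      (Finset.mem_image_of_mem _ hγ) r hr
      (hf.mono fun z hz => strip_pos r hr2 z (hball hz).1) (by
        intro z hz
        obtain ⟨γ', hγ', rfl⟩ := Finset.mem_image.1 hz
        exact (hZ γ' hγ').1) (by
        intro z hz
        obtain ⟨γ', hγ', rfl⟩ := Finset.mem_image.1 hz
        have h1 : |γ/r - γ'/r| < 1 :=
          Int.abs_sub_lt_one_of_floor_eq_floor ((hZ γ hγ).2.trans (hZ γ' hγ').2.symm)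
        rw [← sub_div, abs_div, abs_of_pos hr, div_lt_iff₀ hr] at h1
        rw [add_sub_add_left_eq_sub, ← sub_mul, norm_mul, Complex.norm_I, mul_one, ← Complex.ofReal_sub,
          Complex.norm_real, Real.norm_eq_abs]
        linarith)
    rw [Finset.card_image_of_injective _ hinj] at h
    calc _ = ENNReal.ofReal (Z.card * r^4 * ‖deriv f (1/2 + γ * Complex.I)‖^2) := by
          rw [mul_assoc, ENNReal.ofReal_mul (by positivity) (p := (Z.card:ℝ)), ENNReal.ofReal_natCast, mul_comm]
      _ ≤ _ := h.trans (lintegral_mono_set hball)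
  refine (Finset.sum_le_card_nsmul _ _ _ hk).trans ?_
  rw [nsmul_eq_mul, ENNReal.mul_div_cancel hn0 (by simp)]

lemma sum_zeros (f : ℂ → ℂ) (r : ℝ) (hr : 0 < r) (hr2 : 16*r ≤ 1) (hf : DifferentiableOn ℂ f {z | 0 < z.re})
    (Z : Finset ℝ) (hZ : ∀ γ ∈ Z, f (1/2 + γ * Complex.I) = 0) :
    ENNReal.ofReal (r^4 * ∑ γ ∈ Z, ‖deriv f (1/2 + γ * Complex.I)‖^2) ≤ 19 * ∫⁻ z in strip r, ‖f z‖ₑ^2 := by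
  classical
  rw [Finset.mul_sum, ENNReal.ofReal_sum_of_nonneg (fun _ _ => by positivity)]
  set M := Z.image (fun γ => ⌊γ/r⌋) with hM
  rw [← Finset.sum_fiberwise_of_maps_to (t := M) (g := fun γ => ⌊γ/r⌋) (fun γ hγ => Finset.mem_image_of_mem _ hγ)]
  have h1 : ∀ m ∈ M, ∑ γ ∈ Z with ⌊γ/r⌋ = m, ENNReal.ofReal (r^4 * ‖deriv f (1/2 + γ * Complex.I)‖^2) ≤
      ∫⁻ z in cell r m, ‖f z‖ₑ^2 := by
    intro m hm
    apply cell_sum f r hr hr2 hf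
    intro γ hγ
    rw [Finset.mem_filter] at hγ
    exact ⟨hZ γ hγ.1, hγ.2⟩
  refine (Finset.sum_le_sum h1).trans ?_
  have hmeas : ∀ m, AEMeasurable ((cell r m).indicator (fun z => ‖f z‖ₑ^2)) := by
    intro m
    rw [aemeasurable_indicator_iff (cell_open r m).measurableSet]
    have : AEMeasurable f (volume.restrict (cell r m)) :=
      (hf.continuousOn.mono fun z hz => strip_pos r hr2 z hz.1).aemeasurable (cell_open r m).measurableSet
    exact this.enorm.pow_const 2
  have h2 : ∀ m, ∫⁻ z in cell r m, ‖f z‖ₑ^2 = ∫⁻ z, (cell r m).indicator (fun z => ‖f z‖ₑ^2) z :=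
    fun m => (lintegral_indicator (cell_open r m).measurableSet _).symm
  simp only [h2]
  rw [← lintegral_finsetSum' _ (fun m _ => hmeas m), ← lintegral_indicator (strip_open r).measurableSet,
    ← lintegral_const_mul' _ _ (by norm_num)]
  apply lintegral_mono
  intro z
  simp only
  by_cases hz : z ∈ strip r
  · rw [Set.indicator_of_mem hz]
    have : ∀ m ∈ M, (cell r m).indicator (fun z => ‖f z‖ₑ^2) z ≤
        if m ∈ Finset.Icc (⌊z.im/r⌋-9) (⌊z.im/r⌋+9) then ‖f z‖ₑ^2 else 0 := by
      intro m hm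
      by_cases hc : z ∈ cell r m
      · rw [Set.indicator_of_mem hc, if_pos]
        have h3 := abs_lt.1 hc.2
        have h4 := Int.floor_le (z.im/r)
        have h5 := Int.lt_floor_add_one (z.im/r)
        rw [Finset.mem_Icc]
        constructor
        · have : ((⌊z.im/r⌋ - 9 : ℤ) : ℝ) < m := by push_cast; linarith
          exact (by exact_mod_cast this : ⌊z.im/r⌋ - 9 < m).le
        · have : (m:ℝ) < ((⌊z.im/r⌋ + 10 : ℤ) : ℝ) := by push_cast; linarith
          have : m < ⌊z.im/r⌋ + 10 := by exact_mod_cast this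
          omega
      · rw [Set.indicator_of_notMem hc]; exact zero_le
    refine (Finset.sum_le_sum this).trans ?_
    rw [← Finset.sum_filter, Finset.sum_const, nsmul_eq_mul]
    apply mul_le_mul_left
    have hcard : (M.filter (· ∈ Finset.Icc (⌊z.im/r⌋-9) (⌊z.im/r⌋+9))).card ≤ 19 := by
      refine (Finset.card_le_card (t := Finset.Icc (⌊z.im/r⌋-9) (⌊z.im/r⌋+9)) ?_).trans ?_
      · intro m hm; exact (Finset.mem_filter.1 hm).2
      · rw [Int.card_Icc]; omega
    exact_mod_cast hcard
  · rw [Finset.sum_eq_zero]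
    · exact zero_le
    · intro m hm
      rw [Set.indicator_of_notMem]
      intro h; exact hz h.1

lemma strip_int (f : ℂ → ℂ) (r : ℝ) (hr2 : 16*r ≤ 1) (hf : DifferentiableOn ℂ f {z | 0 < z.re})
    (K : ENNReal) (hK : ∀ σ : ℝ, |σ - 1/2| < 8*r → ∫⁻ t : ℝ, ‖f (σ + t * Complex.I)‖ₑ^2 ≤ K) :
    ∫⁻ z in strip r, ‖f z‖ₑ^2 ≤ ENNReal.ofReal (16*r) * K := by
  have hmeas : AEMeasurable ((strip r).indicator (fun z => ‖f z‖ₑ^2)) := by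
    rw [aemeasurable_indicator_iff (strip_open r).measurableSet]
    have : AEMeasurable f (volume.restrict (strip r)) :=
      (hf.continuousOn.mono fun z hz => strip_pos r hr2 z hz).aemeasurable (strip_open r).measurableSet
    exact this.enorm.pow_const 2
  rw [← lintegral_indicator (strip_open r).measurableSet]
  have hmp := Complex.volume_preserving_equiv_real_prod.symm
  rw [← hmp.lintegral_comp_emb (Complex.measurableEquivRealProd.symm).measurableEmbedding]
  have hvol : (volume : Measure (ℝ × ℝ)) = (volume : Measure ℝ).prod volume := rfl
  rw [hvol, lintegral_prod _ (by
    rw [← hvol]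
    exact hmeas.comp_quasiMeasurePreserving hmp.quasiMeasurePreserving)]
  have hle : ∀ σ : ℝ, (∫⁻ t : ℝ, (strip r).indicator (fun z => ‖f z‖ₑ^2) (Complex.measurableEquivRealProd.symm (σ, t)))
      ≤ (Set.Ioo (1/2 - 8*r) (1/2+8*r)).indicator (fun _ => K) σ := by
    intro σ
    by_cases h : |σ - 1/2| < 8*r
    · rw [Set.indicator_of_mem (by rw [abs_lt] at h; constructor <;> linarith)]
      refine le_trans (lintegral_mono fun t => ?_) (hK σ h)
      refine (Set.indicator_le_self _ _ _).trans ?_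
      rw [Complex.measurableEquivRealProd_symm_apply, Complex.mk_eq_add_mul_I]
    · have : ∀ t : ℝ, (strip r).indicator (fun z => ‖f z‖ₑ^2) (Complex.measurableEquivRealProd.symm (σ, t)) = 0 := by
        intro t
        rw [Set.indicator_of_notMem]
        rw [Complex.measurableEquivRealProd_symm_apply]
        exact h
      simp only [this, lintegral_zero]; exact zero_le
  refine (lintegral_mono hle).trans ?_
  rw [lintegral_indicator measurableSet_Ioo, setLIntegral_const, Real.volume_Ioo, mul_comm]
  apply le_of_eq; congr 2; ring

end MZ

/-- Assume RH. Fix a real `η`, a number `0 < ϑ < 1/2`, and a polynomial `P` with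
`P(0) = 0`. Then as `T → ∞`,
`Σ_{T<γ≤2T} |ζ'(ρ) M(ρ + 2πiη/log T, P)|² ≪ T (log T)³`,
where `ρ = 1/2 + iγ` runs over the nontrivial zeros with ordinate in `(T, 2T]`, counted
with multiplicity. -/
theorem mollified_zeta_deriv_moment (hRH : RiemannHypothesis) (η ϑ : ℝ)
    (hϑ₀ : 0 < ϑ) (hϑ₁ : ϑ < 1 / 2) (P : Polynomial ℝ) (hP : P.eval 0 = 0) :
    ∃ C : ℝ, 0 < C ∧ ∀ᶠ T : ℝ in atTop,
      (∑ᶠ γ ∈ {γ : ℝ | T < γ ∧ γ ≤ 2 * T ∧ riemannZeta (1 / 2 + γ * Complex.I) = 0},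
        (ordMult γ : ℝ) *
          ‖deriv riemannZeta (1 / 2 + γ * Complex.I) *
            moll T ϑ P ((1 / 2 + γ * Complex.I) + 2 * π * Complex.I * η / Real.log T)‖ ^ 2)
        ≤ C * (T * Real.log T ^ 3) := by
  obtain ⟨C, hC, hev⟩ := MZ.mean_bound P hP η ϑ 8 hϑ₀ hϑ₁ (by norm_num)
  refine ⟨18 * Real.exp 4 * (608 * π * C), by positivity, ?_⟩
  filter_upwards [hev, eventually_ge_atTop 1, Real.tendsto_log_atTop.eventually_ge_atTop 16] with T hT hT1 hL
  have hT0 : 0 < T := by linarith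
  have hLp : 0 < Real.log T := by linarith
  set S := {γ : ℝ | T < γ ∧ γ ≤ 2 * T ∧ riemannZeta (1 / 2 + γ * Complex.I) = 0} with hS
  set F : ℝ → ℝ := fun γ => (ordMult γ : ℝ) *
          ‖deriv riemannZeta (1 / 2 + γ * Complex.I) *
            moll T ϑ P ((1 / 2 + γ * Complex.I) + 2 * π * Complex.I * η / Real.log T)‖ ^ 2 with hF
  have hR : 0 ≤ 18 * Real.exp 4 * (608 * π * C) * (T * Real.log T ^ 3) := by positivity
  change (∑ᶠ γ ∈ S, F γ) ≤ _
  by_cases hfin : (S ∩ Function.support F).Finite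
  swap
  · have := finsum_mem_eq_zero_of_infinite (f := F) (s := S) hfin
    rw [this]; exact hR
  rw [← finsum_mem_inter_support, finsum_mem_eq_finite_toFinset_sum F hfin]
  set Z := hfin.toFinset with hZ
  set b := MZ.cf (T^ϑ) P (MZ.cpar η T) with hb
  set D := ⌊T^ϑ⌋₊ with hD
  set f := mellin (MZ.GG b D T) with hf
  have hmem : ∀ γ ∈ Z, γ ∈ S ∧ F γ ≠ 0 := by
    intro γ hγ
    rw [hZ, Set.Finite.mem_toFinset] at hγ
    exact ⟨hγ.1, hγ.2⟩
  have hterm : ∀ γ ∈ Z, F γ ≤ 18 * Real.exp 4 * ‖deriv f (1/2 + γ * Complex.I)‖^2 := by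
    intro γ hγ
    obtain ⟨⟨h1, h2, h3⟩, h4⟩ := hmem γ hγ
    have hd : deriv riemannZeta (1 / 2 + γ * Complex.I) ≠ 0 := by
      intro h0; apply h4; simp only [hF, h0]; simp
    have ho : ordMult γ ≤ 1 := by
      unfold ordMult zetaMult
      apply Nat.sInf_le
      simpa [iteratedDeriv_one] using hd
    have hm : moll T ϑ P ((1 / 2 + γ * Complex.I) + 2 * π * Complex.I * η / Real.log T) =
        MZ.Dir b D (1/2 + γ * Complex.I) := by
      have := MZ.moll_eq T ϑ P (1/2 + γ * Complex.I) (MZ.cpar η T)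
      rw [hb, hD, ← this]
      rfl
    have hl := MZ.deriv_low b D T γ hT1 (by linarith) h2 h3
    rw [← hm] at hl
    have ho' : (ordMult γ : ℝ) ≤ 1 := by exact_mod_cast ho
    calc F γ ≤ 1 * ‖deriv riemannZeta (1 / 2 + γ * Complex.I) *
            moll T ϑ P ((1 / 2 + γ * Complex.I) + 2 * π * Complex.I * η / Real.log T)‖ ^ 2 :=
          mul_le_mul_of_nonneg_right ho' (by positivity)
      _ ≤ _ := by rw [one_mul]; exact hl
  have hzero : ∀ γ ∈ Z, f (1/2 + γ * Complex.I) = 0 := by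
    intro γ hγ
    obtain ⟨⟨h1, h2, h3⟩, h4⟩ := hmem γ hγ
    have hq : (1/2 + γ * Complex.I : ℂ) ∈ MZ.QQ := by
      constructor
      · simp
      · simp; linarith
    rw [hf, MZ.mellin_formula b D T hT0 _ hq, h3]; simp
  set r := 1 / Real.log T with hr
  have hr0 : 0 < r := by positivity
  have hrL : r * Real.log T = 1 := by rw [hr]; field_simp
  have hr2 : 16 * r ≤ 1 := by nlinarith
  have hdf : DifferentiableOn ℂ f {z | 0 < z.re} := fun z hz =>
    (MZ.GG_diff b D T hT0 z hz).differentiableWithinAt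
  have h1 := MZ.sum_zeros f r hr0 hr2 hdf Z hzero
  have h2 := MZ.strip_int f r hr2 hdf (ENNReal.ofReal (2*π) * ENNReal.ofReal (C*T)) (by
    intro σ hσ
    have hσ0 : 0 < σ := by have := (abs_lt.1 hσ).1; linarith
    have hm := hT σ (by rw [show 8 / Real.log T = 8 * r by rw [hr]; ring]; exact hσ.le)
    rw [hf, MZ.mellin_planch _ σ (MZ.GG_cont b D T hT0) (MZ.GG_conv b D T hT0 _ (by simpa using hσ0))
      (lt_of_le_of_lt hm ENNReal.ofReal_lt_top)]
    gcongr)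
  set X := ∑ γ ∈ Z, ‖deriv f (1/2 + γ * Complex.I)‖^2 with hX
  have hX0 : 0 ≤ X := Finset.sum_nonneg fun _ _ => by positivity
  have h3 : ENNReal.ofReal (r^4 * X) ≤ ENNReal.ofReal (19 * (16 * r * (2*π * (C*T)))) := by
    refine h1.trans ((mul_le_mul_right h2 19).trans (le_of_eq ?_))
    rw [← ENNReal.ofReal_mul (by positivity), ← ENNReal.ofReal_mul (by positivity),
      show (19 : ENNReal) = ENNReal.ofReal 19 by norm_num, ← ENNReal.ofReal_mul (by norm_num)]
  rw [ENNReal.ofReal_le_ofReal_iff (by positivity)] at h3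
  have h4 : X ≤ 608 * π * C * (T * Real.log T ^ 3) := by
    have h5 := mul_le_mul_of_nonneg_right h3 (by positivity : 0 ≤ Real.log T ^ 4)
    have e1 : r^4 * X * Real.log T ^ 4 = X := by
      rw [show r^4 * X * Real.log T ^ 4 = (r * Real.log T)^4 * X by ring, hrL]; ring
    have e2 : 19 * (16 * r * (2*π * (C*T))) * Real.log T ^ 4 = 608 * π * C * (T * Real.log T ^ 3) := by
      rw [show 19 * (16 * r * (2*π * (C*T))) * Real.log T ^ 4 =
        608 * π * C * (T * Real.log T ^ 3) * (r * Real.log T) by ring, hrL]; ring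
    rw [e1, e2] at h5; exact h5
  calc ∑ γ ∈ Z, F γ ≤ ∑ γ ∈ Z, 18 * Real.exp 4 * ‖deriv f (1/2 + γ * Complex.I)‖^2 :=
        Finset.sum_le_sum hterm
    _ = 18 * Real.exp 4 * X := by rw [hX, Finset.mul_sum]
    _ ≤ 18 * Real.exp 4 * (608 * π * C * (T * Real.log T ^ 3)) := by gcongr
    _ = _ := by ring
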